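/- Let N ≥ 2 and let X ⊆ ℂ^N be a connected open set admitting a C^∞ exhaustion function ρ : X → ℝ whose Levi form has at least two positive eigenvalues at every point of X. Let D ⊂ ℂ be a bounded connected smoothly bounded domain and let f : D̄ → X be of class C² on D̄ and holomorphic in D. Given an integer k ∈ ℕ and finitely many points z₁,…,z_l ∈ D, there is a sequence of proper holomorphic maps g_ν : D → X converging to f|_D uniformly on compact subsets of D such that each g_ν agrees with f to order k at each of the points z_j. -/

import Mathlib

open Set Filter Complex Metric

noncomputable section

abbrev Cn (N : ℕ) := EuclideanSpace ℂ (Fin N)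

/-- The Levi form of a `C²` function `ρ` at `x` in direction `v`:
`(1/4)(H_x(v,v) + H_x(iv,iv))` where `H_x` is the real Hessian of `ρ` at `x`. -/
def LeviForm {N : ℕ} (ρ : Cn N → ℝ) (x v : Cn N) : ℝ :=
  (1 / 4) * (iteratedFDeriv ℝ 2 ρ x ![v, v] +
    iteratedFDeriv ℝ 2 ρ x ![Complex.I • v, Complex.I • v])

/-- The Levi form of `ρ` has at least two positive eigenvalues at `x`. -/
def TwoPosEigen {N : ℕ} (ρ : Cn N → ℝ) (x : Cn N) : Prop :=
  ∃ W : Submodule ℂ (Cn N), Module.finrank ℂ W = 2 ∧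
    ∀ v ∈ W, v ≠ 0 → 0 < LeviForm ρ x v

/-- A bounded (connected) open set `D ⊆ ℂ` is smoothly bounded. -/
def SmoothlyBounded (D : Set ℂ) : Prop :=
  ∃ V : Set ℂ, IsOpen V ∧ frontier D ⊆ V ∧
    ∃ v : ℂ → ℝ, ContDiffOn ℝ (⊤ : ℕ∞) v V ∧
      D ∩ V = {z ∈ V | v z < 0} ∧
      frontier D = {z ∈ V | v z = 0} ∧
      ∀ z ∈ frontier D, fderiv ℝ v z ≠ 0

/-- `f` is of class `C^r` on `D̄` and holomorphic in `D`. -/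
def ClassA {F : Type*} [NormedAddCommGroup F] [NormedSpace ℂ F] (r : ℕ) (D : Set ℂ)
    (f : ℂ → F) : Prop :=
  ContinuousOn f (closure D) ∧ DifferentiableOn ℂ f D ∧
  ∀ k ≤ r, ∃ g : ℂ → F, ContinuousOn g (closure D) ∧ EqOn g (iteratedDeriv k f) D

section

lemma taylor2_lower {h h' h'' : ℝ → ℝ} {m : ℝ}
    (h1 : ∀ t ∈ Icc (0:ℝ) 1, HasDerivAt h (h' t) t)
    (h2 : ∀ t ∈ Icc (0:ℝ) 1, HasDerivAt h' (h'' t) t)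
    (hm : ∀ t ∈ Icc (0:ℝ) 1, m ≤ h'' t) :
    h 0 + h' 0 + m / 2 ≤ h 1 := by
  have k2 : MonotoneOn (fun t => h' t - m * t) (Icc 0 1) := by
    apply monotoneOn_of_hasDerivWithinAt_nonneg (f' := fun t => h'' t - m) (convex_Icc 0 1)
    · intro t ht
      exact ((h2 t ht).continuousAt.sub (by fun_prop)).continuousWithinAt
    · intro t ht
      have := ((h2 t (interior_subset ht)).sub ((hasDerivAt_id t).const_mul m))
      apply this.hasDerivWithinAt.congr_deriv
      simp
    · intro t ht
      have := hm t (interior_subset ht); linarith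
  have k1 : MonotoneOn (fun t => h t - h' 0 * t - m * t ^ 2 / 2) (Icc 0 1) := by
    apply monotoneOn_of_hasDerivWithinAt_nonneg (f' := fun t => h' t - h' 0 - m * t)
      (convex_Icc 0 1)
    · intro t ht
      exact (((h1 t ht).continuousAt.sub (by fun_prop)).sub (by fun_prop)).continuousWithinAt
    · intro t ht
      have := ((h1 t (interior_subset ht)).sub ((hasDerivAt_id t).const_mul (h' 0))).sub
        ((((hasDerivAt_id t).pow 2).const_mul m).div_const 2)
      apply this.hasDerivWithinAt.congr_deriv
      simp; ring
    · intro t ht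
      have := k2 (left_mem_Icc.2 zero_le_one) (interior_subset ht) (interior_subset ht).1
      simp at this; linarith
  have := k1 (left_mem_Icc.2 zero_le_one) (right_mem_Icc.2 zero_le_one) zero_le_one
  simp at this; linarith

lemma levi_choice {N : ℕ} (H : Cn N →L[ℝ] Cn N →L[ℝ] ℝ) (hs : ∀ a b, H a b = H b a)
    (d : Cn N →L[ℝ] ℝ) (W : Submodule ℂ (Cn N)) (hW : Module.finrank ℂ W = 2)
    (hpos : ∀ v ∈ W, v ≠ 0 → 0 < H v v + H (I • v) (I • v)) :
    ∃ v u : Cn N, ∃ l > 0, d v = 0 ∧ d (I • v) = 0 ∧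
      ∀ μ : ℂ, H (μ • v) (μ • v) + d ((2 * μ ^ 2) • u) = l * ‖μ‖ ^ 2 := by
  have dec : ∀ (μ : ℂ) (w : Cn N), μ • w = μ.re • w + μ.im • (I • w) := by
    intro μ w
    conv_lhs => rw [← Complex.re_add_im μ]
    rw [add_smul, mul_smul]; simp
  suffices h : ∃ v u : Cn N, v ∈ W ∧ v ≠ 0 ∧ d v = 0 ∧ d (I • v) = 0 ∧
      d u = - (H v v - H (I • v) (I • v)) / 4 ∧ d (I • u) = - H v (I • v) / 2 by
    obtain ⟨v, u, hv, hv0, h1, h2, h3, h4⟩ := h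
    refine ⟨v, u, (H v v + H (I • v) (I • v)) / 2, by linarith [hpos v hv hv0], h1, h2, ?_⟩
    intro μ
    rw [dec μ v, dec (2 * μ ^ 2) u]
    simp only [map_add, map_smul, add_apply, smul_apply,
      smul_eq_mul, h3, h4, hs (I • v) v]
    rw [← Complex.normSq_eq_norm_sq, Complex.normSq_apply]
    simp [pow_two]
    ring
  -- the complex linear form
  let A : Cn N →ₗ[ℂ] ℂ :=
    { toFun := fun w => (d w : ℂ) - I * (d (I • w) : ℂ)
      map_add' := by intro x y; simp; ring
      map_smul' := by
        intro m x
        have e1 : I • m • x = (-m.im) • x + m.re • (I • x) := by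
          rw [smul_smul, dec (I * m) x]; simp
        simp only [RingHom.id_apply, smul_eq_mul]
        rw [e1, dec m x]
        simp only [map_add, map_smul, smul_eq_mul]
        apply Complex.ext <;> simp <;> ring }
  have hA : ∀ w, A w = (d w : ℂ) - I * (d (I • w) : ℂ) := fun w => rfl
  have hAre : ∀ w, (A w).re = d w := by intro w; simp [hA]
  have hAim : ∀ w, (A w).im = - d (I • w) := by intro w; simp [hA]
  by_cases hd : A = 0
  · have hd0 : ∀ w, d w = 0 := by intro w; rw [← hAre, hd]; simp
    -- find isotropic vector
    obtain ⟨b⟩ : Nonempty (Module.Basis (Fin 2) ℂ W) := by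
      have := Module.finrank_pos_iff.1 (by rw [hW]; norm_num : 0 < Module.finrank ℂ W)
      have : FiniteDimensional ℂ W := inferInstance
      exact ⟨Module.finBasisOfFinrankEq ℂ W hW⟩
    let Q : Cn N → Cn N → ℂ := fun x y =>
      ((H x y - H (I • x) (I • y) : ℝ) : ℂ) - I * ((H x (I • y) + H (I • x) y : ℝ) : ℂ)
    have hQ : ∀ x y, Q x y = ((H x y - H (I • x) (I • y) : ℝ) : ℂ) - I * ((H x (I • y) + H (I • x) y : ℝ) : ℂ) := fun _ _ => rfl
    have hQfin : ∀ v, Q v v = 0 → H v v - H (I • v) (I • v) = 0 ∧ H v (I • v) = 0 := by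
      intro v h
      have h1 := congrArg Complex.re h
      have h2 := congrArg Complex.im h
      simp [hQ, hs (I • v) v] at h1 h2
      constructor <;> linarith
    suffices h : ∃ v ∈ W, v ≠ 0 ∧ Q v v = 0 by
      obtain ⟨v, hv, hv0, hq⟩ := h
      obtain ⟨e1, e2⟩ := hQfin v hq
      refine ⟨v, 0, hv, hv0, hd0 _, hd0 _, ?_, ?_⟩
      · rw [e1]; simp
      · rw [e2]; simp
    by_cases hq2 : Q (b 1 : Cn N) (b 1 : Cn N) = 0
    · exact ⟨b 1, (b 1).2, by simpa using b.ne_zero 1, hq2⟩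
    · obtain ⟨z, hz⟩ := exists_quadratic_eq_zero (b := 2 * Q (b 0) (b 1)) (c := Q (b 0) (b 0)) hq2
        (IsAlgClosed.exists_eq_mul_self _)
      refine ⟨((b 0 + z • b 1 : W) : Cn N), (b 0 + z • b 1 : W).2, ?_, ?_⟩
      · intro h0
        have h0' : b 0 + z • b 1 = 0 := by ext1; simpa using h0
        have := congrArg (fun w => b.repr w 0) h0'
        simp at this
      · rw [← hz]
        have e1 : ∀ w : Cn N, I • z • w = (-z.im) • w + z.re • (I • w) := by
          intro w
          rw [smul_smul, dec (I * z) w]; simp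
        push_cast
        rw [hQ, hQ, hQ, hQ]
        simp only [Submodule.coe_add, Submodule.coe_smul, smul_add, e1]
        rw [dec z]
        simp only [map_add, map_smul, add_apply, smul_apply,
          smul_eq_mul, hs (I • (b 0 : Cn N)) (b 0 : Cn N), hs (b 1 : Cn N) (b 0 : Cn N), hs (I • (b 1 : Cn N)) (b 1 : Cn N),
          hs (I • (b 1 : Cn N)) (b 0 : Cn N), hs (b 1 : Cn N) (I • (b 0 : Cn N)), hs (I • (b 1 : Cn N)) (I • (b 0 : Cn N))]
        apply Complex.ext
        · simp [pow_two]; ring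
        · simp [pow_two]; ring
  · obtain ⟨w, hw⟩ : ∃ w, A w ≠ 0 := by
      by_contra! hcon
      exact hd (LinearMap.ext hcon)
    have hker : LinearMap.ker (A.domRestrict W) ≠ ⊥ := by
      have : FiniteDimensional ℂ W := inferInstance
      apply LinearMap.ker_ne_bot_of_finrank_lt
      rw [hW]; simp
    obtain ⟨v, hv, hv0⟩ := Submodule.exists_mem_ne_zero_of_ne_bot hker
    have hAv : A (v : Cn N) = 0 := by simpa using hv
    let t : ℂ := (((- (H (v:Cn N) (v:Cn N) - H (I • (v:Cn N)) (I • (v:Cn N))) / 4 : ℝ) : ℂ) - I * ((- H (v:Cn N) (I • (v:Cn N)) / 2 : ℝ) : ℂ))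
    have hu : A ((t / A w) • w) = t := by
      rw [map_smul, smul_eq_mul, div_mul_cancel₀ _ hw]
    refine ⟨v, (t / A w) • w, v.2, by simpa using hv0, ?_, ?_, ?_, ?_⟩
    · rw [← hAre, hAv]; simp
    · have := hAim v; rw [hAv] at this; simp at this; linarith
    · rw [← hAre, hu]; simp [t]
    · have := hAim ((t / A w) • w); rw [hu] at this
      have e : t.im = H (v:Cn N) (I • (v:Cn N)) / 2 := by simp [t]; ring
      linarith

end

section

lemma hasDerivAt_two_line {E : Type*} [NormedAddCommGroup E] [NormedSpace ℝ E] {g : E → ℝ}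
    {γ γ' : ℝ → E} {γ'' : E} {t : ℝ} (hg : ContDiffAt ℝ 2 g (γ t))
    (h2 : HasDerivAt γ (γ' t) t) (h3 : HasDerivAt γ' γ'' t) :
    HasDerivAt (fun t => fderiv ℝ g (γ t) (γ' t))
      (fderiv ℝ (fderiv ℝ g) (γ t) (γ' t) (γ' t) + fderiv ℝ g (γ t) γ'') t := by
  have h1 : ContDiffAt ℝ 1 (fderiv ℝ g) (γ t) := hg.fderiv_right (by norm_num)
  have h4 : HasDerivAt (fun t => fderiv ℝ g (γ t)) (fderiv ℝ (fderiv ℝ g) (γ t) (γ' t)) t :=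
    (h1.differentiableAt (by norm_num)).hasFDerivAt.comp_hasDerivAt t h2
  exact h4.clm_apply h3

lemma hess_near {E : Type*} [NormedAddCommGroup E] [NormedSpace ℝ E] {g : E → ℝ} {p : E}
    (hg : ContDiffAt ℝ 2 g p) {ε : ℝ} (hε : 0 < ε) :
    ∀ᶠ y in nhds p, ∀ w, fderiv ℝ (fderiv ℝ g) p w w - ε * ‖w‖ ^ 2 ≤
      fderiv ℝ (fderiv ℝ g) y w w := by
  have h1 : ContDiffAt ℝ 1 (fderiv ℝ g) p := hg.fderiv_right (by norm_num)
  have h2 : ContDiffAt ℝ 0 (fderiv ℝ (fderiv ℝ g)) p := h1.fderiv_right (by norm_num)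
  have h3 := h2.continuousAt.eventually_mem (ball_mem_nhds _ hε)
  filter_upwards [h3] with y hy w
  rw [mem_ball, dist_eq_norm] at hy
  have h3 : ‖(fderiv ℝ (fderiv ℝ g) y - fderiv ℝ (fderiv ℝ g) p) w w‖ ≤ ε * ‖w‖ * ‖w‖ :=
    (ContinuousLinearMap.le_opNorm₂ _ _ _).trans (by gcongr)
  simp only [sub_apply] at h3
  have := (abs_le.1 h3).1
  nlinarith

lemma goodBall {N : ℕ} {X : Set (Cn N)} (hX : IsOpen X) {ρ : Cn N → ℝ}
    (hρ : ContDiffOn ℝ (⊤ : ℕ∞) ρ X) {x0 : Cn N} (hx0 : x0 ∈ X) (hL : TwoPosEigen ρ x0) :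
    ∃ v u : Cn N, ∃ c s : ℝ, ∃ A : Cn N → ℂ, 0 < c ∧ c ≤ 1 ∧ 0 < s ∧ ball x0 s ⊆ X ∧
      ContinuousOn A (ball x0 s) ∧ ∀ x ∈ ball x0 s, ‖A x‖ ≤ c / 2 ∧
        ∀ μ : ℂ, ‖μ‖ ≤ 2 → x + μ • v + μ ^ 2 • u ∈ X ∧
          ρ x + (μ * A x).re + c * ‖μ‖ ^ 2 ≤ ρ (x + μ • v + μ ^ 2 • u) := by
  have hC : ∀ x ∈ X, ContDiffAt ℝ 2 ρ x := fun x hx =>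
    (hρ.contDiffAt (hX.mem_nhds hx)).of_le (WithTop.coe_le_coe.2 (le_top : (2:ℕ∞) ≤ ⊤))
  obtain ⟨W, hW, hpos⟩ := hL
  obtain ⟨v, u, l, hl, hdv, hdiv, hH⟩ := levi_choice (fderiv ℝ (fderiv ℝ ρ) x0)
    (by
      have := (hC x0 hx0).isSymmSndFDerivAt (by simp)
      exact fun a b => this a b)
    (fderiv ℝ ρ x0) W hW (by
      intro v hv hv0
      have := hpos v hv hv0
      simp only [LeviForm, iteratedFDeriv_two_apply] at this
      simp at this
      linarith)
  let Y : Cn N × ℂ → Cn N := fun p => p.1 + p.2 • v + p.2 ^ 2 • u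
  have hYs : ContDiff ℝ 2 Y := by
    have e1 : ContDiff ℝ 2 (fun p : Cn N × ℂ => p.2 • v) :=
      ((ContinuousLinearMap.toSpanSingleton ℂ v).restrictScalars ℝ).contDiff.comp contDiff_snd
    have e2 : ContDiff ℝ 2 (fun p : Cn N × ℂ => p.2 ^ 2 • u) :=
      ((ContinuousLinearMap.toSpanSingleton ℂ u).restrictScalars ℝ).contDiff.comp (contDiff_snd.pow 2)
    exact (contDiff_fst.add e1).add e2
  have hY0 : Y (x0, 0) = x0 := by simp [Y]
  let g : Cn N × ℂ → ℝ := fun p => ρ (Y p)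
  have hYX : ∀ᶠ p in nhds (x0, (0:ℂ)), Y p ∈ X := by
    apply hYs.continuous.continuousAt.eventually_mem
    rw [hY0]; exact hX.mem_nhds hx0
  have hg2 : ∀ p, Y p ∈ X → ContDiffAt ℝ 2 g p := fun p hp => (hC _ hp).comp p hYs.contDiffAt
  have hp0 : Y (x0, 0) ∈ X := by rwa [hY0]
  -- curve derivatives
  have hγ1 : ∀ (x : Cn N) (μ : ℂ) (t : ℝ), HasDerivAt (fun t : ℝ => x + ((t:ℂ) * μ) • v + ((t:ℂ) * μ) ^ 2 • u)
      (μ • v + (2 * (t:ℂ) * μ ^ 2) • u) t := by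
    intro x μ t
    have a1 : HasDerivAt (fun t : ℝ => (t:ℂ) * μ) μ t := by
      simpa using (Complex.ofRealCLM.hasDerivAt (x := t)).mul_const μ
    have := ((hasDerivAt_const t x).add (a1.smul_const v)).add ((a1.pow 2).smul_const u)
    apply this.congr_deriv
    simp; congr 1; ring
  have hγ2 : ∀ (μ : ℂ) (t : ℝ), HasDerivAt (fun t : ℝ => μ • v + (2 * (t:ℂ) * μ ^ 2) • u)
      ((2 * μ ^ 2) • u) t := by
    intro μ t
    have a1 : HasDerivAt (fun t : ℝ => 2 * (t:ℂ) * μ ^ 2) (2 * μ ^ 2) t := by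
      simpa using ((Complex.ofRealCLM.hasDerivAt (x := t)).const_mul 2).mul_const (μ ^ 2)
    exact (a1.smul_const u).const_add _
  have hδ1 : ∀ (x : Cn N) (μ : ℂ) (t : ℝ), HasDerivAt (fun t : ℝ => (x, (t:ℂ) * μ)) ((0, μ) : Cn N × ℂ) t := by
    intro x μ t
    have a1 : HasDerivAt (fun t : ℝ => (t:ℂ) * μ) μ t := by
      simpa using (Complex.ofRealCLM.hasDerivAt (x := t)).mul_const μ
    exact (hasDerivAt_const t x).prodMk a1
  have hd1 : ∀ (x : Cn N) (μ : ℂ) (t : ℝ), Y (x, (t:ℂ) * μ) ∈ X →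
      HasDerivAt (fun t : ℝ => g (x, (t:ℂ) * μ)) (fderiv ℝ g (x, (t:ℂ) * μ) (0, μ)) t := by
    intro x μ t h
    exact ((hg2 _ h).differentiableAt (by norm_num)).hasFDerivAt.comp_hasDerivAt t (hδ1 x μ t)
  have hd1' : ∀ (x : Cn N) (μ : ℂ) (t : ℝ), Y (x, (t:ℂ) * μ) ∈ X →
      fderiv ℝ g (x, (t:ℂ) * μ) (0, μ) = fderiv ℝ ρ (Y (x, (t:ℂ) * μ)) (μ • v + (2 * (t:ℂ) * μ ^ 2) • u) := by
    intro x μ t h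
    have h2 := HasFDerivAt.comp_hasDerivAt t (f := fun t : ℝ => x + ((t:ℂ) * μ) • v + ((t:ℂ) * μ) ^ 2 • u)
      ((hC _ h).differentiableAt (by norm_num)).hasFDerivAt (hγ1 x μ t)
    exact (hd1 x μ t h).unique h2
  have hd2 : ∀ (x : Cn N) (μ : ℂ) (t : ℝ), Y (x, (t:ℂ) * μ) ∈ X →
      HasDerivAt (fun t : ℝ => fderiv ℝ g (x, (t:ℂ) * μ) (0, μ))
        (fderiv ℝ (fderiv ℝ g) (x, (t:ℂ) * μ) (0, μ) (0, μ)) t := by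
    intro x μ t h
    have := hasDerivAt_two_line (g := g) (γ := fun t : ℝ => (x, (t:ℂ) * μ)) (γ' := fun _ => (0, μ))
      (γ'' := 0) (t := t) (hg2 _ h) (hδ1 x μ t) (hasDerivAt_const t _)
    simpa using this
  have hbase : ∀ μ : ℂ, fderiv ℝ (fderiv ℝ g) (x0, 0) (0, μ) (0, μ) = l * ‖μ‖ ^ 2 := by
    intro μ
    have h0 : Y (x0, ((0:ℝ):ℂ) * μ) ∈ X := by simpa using hp0
    have h1 := hd2 x0 μ 0 h0
    have h2 := hasDerivAt_two_line (g := ρ) (γ := fun t : ℝ => x0 + ((t:ℂ) * μ) • v + ((t:ℂ) * μ) ^ 2 • u)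
      (γ' := fun t : ℝ => μ • v + (2 * (t:ℂ) * μ ^ 2) • u) (t := 0) (hC _ h0) (hγ1 x0 μ 0) (hγ2 μ 0)
    have hev : (fun t : ℝ => fderiv ℝ g (x0, (t:ℂ) * μ) (0, μ)) =ᶠ[nhds 0]
        (fun t : ℝ => fderiv ℝ ρ (x0 + ((t:ℂ) * μ) • v + ((t:ℂ) * μ) ^ 2 • u) (μ • v + (2 * (t:ℂ) * μ ^ 2) • u)) := by
      have : ContinuousAt (fun t : ℝ => Y (x0, (t:ℂ) * μ)) 0 := by
        apply hYs.continuous.continuousAt.comp; fun_prop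
      filter_upwards [this.eventually_mem (hX.mem_nhds h0)] with t ht
      exact hd1' x0 μ t ht
    have h3 := h1.unique (h2.congr_of_eventuallyEq hev)
    rw [← hH μ]
    simpa using h3
  -- the radius
  have hDDe := hess_near (hg2 _ hp0) (half_pos hl)
  obtain ⟨T, hT, hTb⟩ := Metric.eventually_nhds_iff_ball.1
    (hYX.and hDDe)
  have hmain : ∀ x ∈ ball x0 T, ∀ μ : ℂ, ‖μ‖ < T → Y (x, μ) ∈ X ∧
      ρ x + fderiv ℝ ρ x (μ • v) + l / 4 * ‖μ‖ ^ 2 ≤ ρ (Y (x, μ)) := by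
    intro x hx μ hμ
    have hin : ∀ t ∈ Icc (0:ℝ) 1, ((x, (t:ℂ) * μ) : Cn N × ℂ) ∈ ball (x0, (0:ℂ)) T := by
      intro t ht
      rw [← ball_prod_same]
      refine ⟨hx, ?_⟩
      simp only [mem_ball, dist_zero_right, norm_mul, Complex.norm_real, Real.norm_eq_abs]
      rw [abs_of_nonneg ht.1]
      nlinarith [ht.1, ht.2, norm_nonneg μ]
    have h1 := taylor2_lower (h := fun t : ℝ => g (x, (t:ℂ) * μ))
      (h' := fun t : ℝ => fderiv ℝ g (x, (t:ℂ) * μ) (0, μ))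
      (h'' := fun t : ℝ => fderiv ℝ (fderiv ℝ g) (x, (t:ℂ) * μ) (0, μ) (0, μ)) (m := l / 2 * ‖μ‖ ^ 2)
      (fun t ht => hd1 x μ t (hTb _ (hin t ht)).1) (fun t ht => hd2 x μ t (hTb _ (hin t ht)).1)
      (by
        intro t ht
        have h2 := (hTb _ (hin t ht)).2
        have h3 := h2 (0, μ)
        have h4 : ‖((0, μ) : Cn N × ℂ)‖ = ‖μ‖ := by simp [Prod.norm_def]
        rw [hbase, h4] at h3
        linarith)
    refine ⟨by simpa using (hTb _ (hin 1 (by simp))).1, ?_⟩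
    have h0X := (hTb _ (hin 0 (by simp))).1
    have h5 := hd1' x μ 0 h0X
    have h6 : Y (x, 0) = x := by simp [Y]
    simp only [h5] at h1
    simp [g, h6] at h1
    linarith
  -- the form A
  let A : Cn N → ℂ := fun x => (fderiv ℝ ρ x v : ℂ) - I * (fderiv ℝ ρ x (I • v) : ℂ)
  have hAc : ∀ x ∈ X, ContinuousAt A x := by
    intro x hx
    have h1 : ContDiffAt ℝ 1 (fderiv ℝ ρ) x := (hC x hx).fderiv_right (by norm_num)
    have h2 := h1.continuousAt
    have h3 : ∀ w, ContinuousAt (fun x => (fderiv ℝ ρ x w : ℂ)) x := fun w =>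
      Complex.continuous_ofReal.continuousAt.comp (h2.clm_apply continuousAt_const)
    exact (h3 v).sub (continuousAt_const.mul (h3 _))
  have hA0 : A x0 = 0 := by simp [A, hdv, hdiv]
  have hAre : ∀ x (μ : ℂ), fderiv ℝ ρ x (μ • v) = (μ * A x).re := by
    intro x μ
    have dec : μ • v = μ.re • v + μ.im • (I • v) := by
      conv_lhs => rw [← Complex.re_add_im μ]
      rw [add_smul, mul_smul]; simp
    rw [dec]; simp [A]
  set τ := T / 4 with hτ
  have hτ0 : 0 < τ := by positivity
  set c := min 1 (l / 4 * τ ^ 2) with hc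
  have hc0 : 0 < c := by rw [hc]; positivity
  obtain ⟨s1, hs1, hs1b⟩ := Metric.eventually_nhds_iff_ball.1
    (Metric.continuousAt_iff'.1 (hAc x0 hx0) (c / 2 / τ) (by positivity))
  have hcont : ball x0 (min T s1) ⊆ X := by
    intro x hx
    have hx' : x ∈ ball x0 T := ball_subset_ball (min_le_left _ _) hx
    simpa [Y] using (hmain x hx' 0 (by simpa using hT)).1
  refine ⟨τ • v, (τ ^ 2) • u, c, min T s1, fun x => τ * A x, hc0, min_le_left _ _, lt_min hT hs1,
    hcont, ?_, ?_⟩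
  · intro x hx
    exact (continuousAt_const.mul (hAc x (hcont hx))).continuousWithinAt
  · intro x hx
    have hx' : x ∈ ball x0 T := ball_subset_ball (min_le_left _ _) hx
    have hx1 : x ∈ ball x0 s1 := ball_subset_ball (min_le_right _ _) hx
    constructor
    · have := hs1b x hx1
      rw [hA0, dist_zero_right, lt_div_iff₀ hτ0] at this
      simp only [norm_mul, Complex.norm_real, Real.norm_eq_abs, abs_of_pos hτ0]
      linarith
    · intro μ hμ
      have hn : ‖μ * (τ:ℂ)‖ = ‖μ‖ * τ := by simp [abs_of_pos hτ0]
      have := hmain x hx' (μ * (τ:ℂ)) (by rw [hn]; nlinarith)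
      have hYe : Y (x, μ * (τ:ℂ)) = x + μ • (τ • v) + μ ^ 2 • ((τ ^ 2) • u) := by
        simp only [Y]
        rw [mul_pow, mul_smul, mul_smul]
        congr 2
        rw [← Complex.ofReal_pow]; rfl
      rw [hYe, hAre, hn] at this
      refine ⟨this.1, ?_⟩
      have h7 : μ * (↑τ * A x) = μ * ↑τ * A x := by ring
      rw [h7]
      have h8 : c * ‖μ‖ ^ 2 ≤ l / 4 * (‖μ‖ * τ) ^ 2 := by
        have : c ≤ l / 4 * τ ^ 2 := min_le_right _ _
        nlinarith [sq_nonneg ‖μ‖]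
      linarith [this.2]

end

section
open MeasureTheory

lemma lint_inv_ball (z : ℂ) {r : ℝ} (hr : 0 < r) :
    ∫⁻ ζ in ball z r, ‖(ζ - z)⁻¹‖ₑ ≤ ENNReal.ofReal (2 * Real.pi * r) := by
  have h1 : ∫⁻ ζ in ball z r, ‖(ζ - z)⁻¹‖ₑ = ∫⁻ ζ, (ball (0:ℂ) r).indicator (fun ζ => ‖ζ⁻¹‖ₑ) ζ := by
    rw [← lintegral_indicator measurableSet_ball]
    rw [← lintegral_add_right_eq_self _ z]
    congr 1; ext ζ
    by_cases h : ζ ∈ ball (0:ℂ) r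
    · rw [indicator_of_mem h, indicator_of_mem (by simpa using h)]; simp
    · rw [indicator_of_notMem h, indicator_of_notMem (by simpa using h)]
  rw [h1, ← Complex.lintegral_comp_polarCoord_symm]
  calc _ ≤ ∫⁻ p in polarCoord.target, (Ioo 0 r ×ˢ Ioo (-Real.pi) Real.pi).indicator (fun _ => 1) p := by
        apply setLIntegral_mono' polarCoord.open_target.measurableSet
        rintro ⟨a, b⟩ hp
        simp only [polarCoord_target, mem_prod, mem_Ioi] at hp
        by_cases h : Complex.polarCoord.symm (a, b) ∈ ball (0:ℂ) r
        · rw [indicator_of_mem h]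
          have hn : ‖Complex.polarCoord.symm (a, b)‖ = a := by
            rw [Complex.norm_polarCoord_symm, abs_of_pos hp.1]
          rw [indicator_of_mem]
          · rw [enorm_inv (by rw [← norm_ne_zero_iff, hn]; exact hp.1.ne'), ← ofReal_norm, hn]
            rw [smul_eq_mul, ENNReal.mul_inv_cancel]
            · simpa using hp.1
            · simp
          · rw [mem_ball_zero_iff, hn] at h
            exact ⟨⟨hp.1, h⟩, hp.2⟩
        · rw [indicator_of_notMem h]; simp
    _ ≤ ∫⁻ p : ℝ × ℝ, (Ioo 0 r ×ˢ Ioo (-Real.pi) Real.pi).indicator (fun _ => 1) p := setLIntegral_le_lintegral _ _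
    _ = ENNReal.ofReal (2 * Real.pi * r) := by
        rw [lintegral_indicator (measurableSet_Ioo.prod measurableSet_Ioo)]
        simp only [lintegral_const, one_mul, Measure.restrict_apply MeasurableSet.univ, univ_inter]
        rw [Measure.volume_eq_prod, Measure.prod_prod, Real.volume_Ioo, Real.volume_Ioo, ← ENNReal.ofReal_mul (by linarith)]
        congr 1; ring

def cT (F : ℂ → ℂ) (z : ℂ) : ℂ := ∫ ζ, F ζ * (ζ - z)⁻¹

structure BddSupp (F : ℂ → ℂ) (R C : ℝ) : Prop where
  meas : AEStronglyMeasurable F volume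
  bdd : ∀ z, ‖F z‖ ≤ C
  supp : ∀ z, R ≤ ‖z‖ → F z = 0

lemma meas_kernel (z : ℂ) : Measurable (fun ζ : ℂ => (ζ - z)⁻¹) := by fun_prop

lemma integrableOn_kernel (z : ℂ) {r : ℝ} (hr : 0 < r) :
    IntegrableOn (fun ζ : ℂ => (ζ - z)⁻¹) (ball z r) :=
  ⟨(meas_kernel z).aestronglyMeasurable, (lint_inv_ball z hr).trans_lt ENNReal.ofReal_lt_top⟩

lemma norm_kernel_ball (z : ℂ) {r : ℝ} (hr : 0 < r) :
    ∫ ζ in ball z r, ‖(ζ - z)⁻¹‖ ≤ 2 * Real.pi * r := by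
  rw [integral_norm_eq_lintegral_enorm (integrableOn_kernel z hr).1]
  apply ENNReal.toReal_le_of_le_ofReal (by positivity) (lint_inv_ball z hr)

lemma BddSupp.nonneg {F : ℂ → ℂ} {R C : ℝ} (h : BddSupp F R C) : 0 ≤ C := (norm_nonneg _).trans (h.bdd 0)

lemma BddSupp.integrable_mul {F : ℂ → ℂ} {R C : ℝ} (h : BddSupp F R C) (z : ℂ) :
    Integrable (fun ζ => F ζ * (ζ - z)⁻¹) := by
  have h1 := (integrableOn_kernel z (r := |R| + ‖z‖ + 1) (by positivity)).integrable_indicator measurableSet_ball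
  have := h1.bdd_mul h.meas (ae_of_all _ h.bdd)
  refine this.congr (ae_of_all _ fun ζ => ?_)
  by_cases hz : ζ ∈ ball z (|R| + ‖z‖ + 1)
  · simp only [indicator_of_mem hz]
  · simp only [indicator_of_notMem hz]
    rw [h.supp]; · simp
    rw [mem_ball, dist_eq_norm] at hz
    have := norm_sub_le ζ z
    linarith [le_abs_self R]

lemma BddSupp.integrable {F : ℂ → ℂ} {R C : ℝ} (h : BddSupp F R C) : Integrable F := by
  have : IntegrableOn F (closedBall 0 |R|) :=
    Measure.integrableOn_of_bounded (isCompact_closedBall _ _).measure_lt_top.ne h.meas (M := C) (ae_of_all _ h.bdd)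
  rw [← integrableOn_iff_integrable_of_support_subset (s := closedBall 0 |R|)]
  · exact this
  · intro z hz
    by_contra hc
    apply hz
    apply h.supp
    simp at hc
    linarith [le_abs_self R]

/-- truncated kernel -/
def kT (r : ℝ) (η : ℂ) : ℂ := (starRingEnd ℂ) η * ((max (‖η‖ ^ 2) (r ^ 2) : ℝ) : ℂ)⁻¹

lemma kT_cont {r : ℝ} (hr : 0 < r) : Continuous (kT r) := by
  unfold kT
  apply Continuous.mul Complex.continuous_conj
  apply Continuous.inv₀
  · fun_prop
  · intro x
    have : 0 < max (‖x‖ ^ 2) (r ^ 2) := lt_max_of_lt_right (by positivity)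
    exact_mod_cast this.ne'

lemma kT_norm {r : ℝ} (hr : 0 < r) (η : ℂ) : ‖kT r η‖ = ‖η‖ / max (‖η‖ ^ 2) (r ^ 2) := by
  have : 0 < max (‖η‖ ^ 2) (r ^ 2) := lt_max_of_lt_right (by positivity)
  unfold kT
  rw [norm_mul, norm_inv, Complex.norm_real, Complex.norm_conj, Real.norm_eq_abs, abs_of_pos this, div_eq_mul_inv]

lemma kT_bdd {r : ℝ} (hr : 0 < r) (η : ℂ) : ‖kT r η‖ ≤ r⁻¹ := by
  have h : 0 < max (‖η‖ ^ 2) (r ^ 2) := lt_max_of_lt_right (by positivity)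
  rw [kT_norm hr, div_le_iff₀ h, inv_mul_eq_div, le_div_iff₀ hr]
  have h1 := le_max_left (‖η‖ ^ 2) (r ^ 2)
  have h2 := le_max_right (‖η‖ ^ 2) (r ^ 2)
  nlinarith [sq_nonneg (‖η‖ - r)]

lemma kT_le {r : ℝ} (hr : 0 < r) (η : ℂ) : ‖kT r η‖ ≤ ‖η⁻¹‖ := by
  have h : 0 < max (‖η‖ ^ 2) (r ^ 2) := lt_max_of_lt_right (by positivity)
  by_cases h0 : η = 0
  · simp [h0, kT]
  have : 0 < ‖η‖ := norm_pos_iff.2 h0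
  rw [kT_norm hr, norm_inv, div_le_iff₀ h, inv_mul_eq_div, le_div_iff₀ this]
  have h1 := le_max_left (‖η‖ ^ 2) (r ^ 2)
  nlinarith

lemma kT_eq {r : ℝ} (hr : 0 < r) (η : ℂ) (h : r ≤ ‖η‖) : kT r η = η⁻¹ := by
  unfold kT
  rw [max_eq_left (by gcongr), Complex.inv_def η, Complex.normSq_eq_norm_sq]; simp

lemma BddSupp.trunc_close {F : ℂ → ℂ} {R C : ℝ} (h : BddSupp F R C) {r : ℝ} (hr : 0 < r) (z : ℂ) :
    ‖cT F z - ∫ ζ, F ζ * kT r (ζ - z)‖ ≤ 4 * Real.pi * C * r := by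
  have hi2 : Integrable (fun ζ => F ζ * kT r (ζ - z)) := by
    apply h.integrable.mul_bdd (c := r⁻¹)
    · exact ((kT_cont hr).comp (continuous_id.sub continuous_const)).aestronglyMeasurable
    · exact ae_of_all _ fun ζ => kT_bdd hr _
  unfold cT
  rw [← integral_sub (h.integrable_mul z) hi2]
  have hind : Integrable ((ball z r).indicator (fun ζ => ‖(ζ - z)⁻¹‖)) :=
    IntegrableOn.integrable_indicator (Integrable.norm (integrableOn_kernel z hr)) measurableSet_ball
  calc _ ≤ ∫ ζ, (2 * C) * (ball z r).indicator (fun ζ => ‖(ζ - z)⁻¹‖) ζ := by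
        apply norm_integral_le_of_norm_le (hind.const_mul _)
        refine ae_of_all _ fun ζ => ?_
        rw [← mul_sub]
        by_cases hz : ζ ∈ ball z r
        · rw [indicator_of_mem hz, norm_mul]
          have h1 := kT_le hr (ζ - z)
          have h2 := norm_sub_le (ζ - z)⁻¹ (kT r (ζ - z))
          calc _ ≤ C * (2 * ‖(ζ - z)⁻¹‖) := by
                apply mul_le_mul (h.bdd _) (by linarith) (norm_nonneg _) h.nonneg
            _ = _ := by ring
        · rw [indicator_of_notMem hz, kT_eq hr]
          · simp
          · simpa [dist_eq_norm] using hz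
    _ = 2 * C * ∫ ζ in ball z r, ‖(ζ - z)⁻¹‖ := by
        rw [integral_const_mul, integral_indicator measurableSet_ball]
    _ ≤ 2 * C * (2 * Real.pi * r) := by
        have := h.nonneg
        gcongr
        exact norm_kernel_ball z hr
    _ = _ := by ring

lemma BddSupp.cT_cont {F : ℂ → ℂ} {R C : ℝ} (h : BddSupp F R C) : Continuous (cT F) := by
  apply continuous_of_uniform_approx_of_continuous
  intro u hu
  obtain ⟨ε, hε, hεu⟩ := Metric.mem_uniformity_dist.1 hu
  have hC := h.nonneg
  set r := ε / (4 * Real.pi * C + 1) with hr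
  have hr0 : 0 < r := by positivity
  refine ⟨fun z => ∫ ζ, F ζ * kT r (ζ - z), ?_, ?_⟩
  · apply continuous_of_dominated (bound := fun ζ => ‖F ζ‖ * r⁻¹)
    · intro z
      exact h.meas.mul ((kT_cont hr0).comp (continuous_id.sub continuous_const)).aestronglyMeasurable
    · intro z
      refine ae_of_all _ fun ζ => ?_
      rw [norm_mul]; gcongr; exact kT_bdd hr0 _
    · exact h.integrable.norm.mul_const _
    · refine ae_of_all _ fun ζ => ?_
      exact continuous_const.mul ((kT_cont hr0).comp (continuous_const.sub continuous_id))
  · intro z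
    apply hεu
    rw [dist_eq_norm]
    refine (h.trunc_close hr0 z).trans_lt ?_
    rw [hr, mul_div_assoc', div_lt_iff₀ (by positivity)]
    nlinarith

lemma cT_small {F : ℕ → ℂ → ℂ} {R C : ℝ} (h : ∀ n, BddSupp (F n) R C)
    (hlim : ∀ z, Tendsto (fun n => F n z) atTop (nhds 0)) {ε : ℝ} (hε : 0 < ε) :
    ∀ᶠ n in atTop, ∀ z, ‖cT (F n) z‖ ≤ ε := by
  have hC := (h 0).nonneg
  set r := ε / 2 / (4 * Real.pi * C + 1) with hr
  have hr0 : 0 < r := by positivity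
  have hr1 : 4 * Real.pi * C * r ≤ ε / 2 := by
    rw [hr, mul_div_assoc', div_le_iff₀ (by positivity)]
    nlinarith
  have h0 : Tendsto (fun n => ∫ ζ, ‖F n ζ‖) atTop (nhds (∫ _ : ℂ, (0:ℝ))) := by
    apply tendsto_integral_of_dominated_convergence (bound := (closedBall (0:ℂ) |R|).indicator fun _ => C)
    · intro n; exact (h n).meas.norm
    · rw [integrable_indicator_iff measurableSet_closedBall]
      exact integrableOn_const (isCompact_closedBall _ _).measure_lt_top.ne
    · intro n
      refine ae_of_all _ fun ζ => ?_
      by_cases hz : ζ ∈ closedBall (0:ℂ) |R|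
      · rw [indicator_of_mem hz]; simpa using (h n).bdd ζ
      · rw [indicator_of_notMem hz, (h n).supp]; · simp
        simp at hz
        linarith [le_abs_self R]
    · refine ae_of_all _ fun ζ => ?_
      simpa using (hlim ζ).norm
  simp only [integral_zero] at h0
  filter_upwards [h0.eventually_lt_const (show 0 < ε / 2 * r by positivity)] with n hn z
  have h1 := (h n).trunc_close hr0 z
  have h2 : ‖∫ ζ, F n ζ * kT r (ζ - z)‖ ≤ ∫ ζ, ‖F n ζ‖ * r⁻¹ := by
    apply norm_integral_le_of_norm_le ((h n).integrable.norm.mul_const _)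
    refine ae_of_all _ fun ζ => ?_
    rw [norm_mul]; gcongr; exact kT_bdd hr0 _
  rw [integral_mul_const] at h2
  have h3 : (∫ ζ, ‖F n ζ‖) * r⁻¹ ≤ ε / 2 := by
    rw [← div_eq_mul_inv, div_le_iff₀ hr0]; exact hn.le
  have h4 := norm_le_norm_sub_add (cT (F n) z) (∫ ζ, F n ζ * kT r (ζ - z))
  linarith

end

section
open MeasureTheory

def dbar (u : ℂ → ℂ) (z : ℂ) : ℂ := (fderiv ℝ u z 1 + I * fderiv ℝ u z I) / 2

lemma dbar_polar_aux {h : ℂ → ℂ} (hh : ContDiff ℝ 1 h) {R : ℝ} (hR : ∀ z, R ≤ ‖z‖ → fderiv ℝ h z = 0)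
    (m : ℂ) :
    Integrable (fun p : ℝ × ℝ => fderiv ℝ h (p.1 * Complex.exp (p.2 * I)) (m * Complex.exp (p.2 * I)))
      ((volume.restrict (Ioi 0)).prod (volume.restrict (Ioo (-Real.pi) Real.pi))) := by
  rw [Measure.prod_restrict]
  have hc : Continuous (fun p : ℝ × ℝ => fderiv ℝ h (p.1 * Complex.exp (p.2 * I)) (m * Complex.exp (p.2 * I))) := by
    apply Continuous.clm_apply
    · exact (hh.continuous_fderiv (by norm_num)).comp (by fun_prop)
    · fun_prop
  have h1 : IntegrableOn (fun p : ℝ × ℝ => fderiv ℝ h (p.1 * Complex.exp (p.2 * I)) (m * Complex.exp (p.2 * I)))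
    (Icc 0 |R| ×ˢ Icc (-Real.pi) Real.pi) (volume.prod volume) :=
    hc.continuousOn.integrableOn_compact (isCompact_Icc.prod isCompact_Icc)
  apply h1.of_forall_diff_eq_zero (measurableSet_Ioi.prod measurableSet_Ioo)
  rintro ⟨a, b⟩ ⟨⟨ha, hb⟩, hn⟩
  simp only at ha hb ⊢
  rw [hR]; · simp
  have hbI : b ∈ Icc (-Real.pi) Real.pi := Ioo_subset_Icc_self hb
  have : ¬ a ≤ |R| := fun hle => hn ⟨⟨(mem_Ioi.1 ha).le, hle⟩, hbI⟩
  rw [norm_mul, Complex.norm_exp_ofReal_mul_I, mul_one, Complex.norm_real, Real.norm_eq_abs,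
    abs_of_pos (mem_Ioi.1 ha)]
  linarith [le_abs_self R]

lemma cT_dbar_zero {h : ℂ → ℂ} (hh : ContDiff ℝ 1 h) (hs : HasCompactSupport h) :
    cT (dbar h) 0 = - Real.pi * h 0 := by
  obtain ⟨R, hRpos, hR⟩ : ∃ R > 0, ∀ z, R ≤ ‖z‖ → z ∉ tsupport h := by
    obtain ⟨R, hR, hR2⟩ := hs.isCompact.isBounded.subset_ball_lt 0 0
    exact ⟨R, hR, fun z hz hz2 => by have := hR2 hz2; simp at this; linarith⟩
  have hRd : ∀ z, R ≤ ‖z‖ → fderiv ℝ h z = 0 := by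
    intro z hz
    by_contra hc
    exact hR z hz (support_fderiv_subset ℝ hc)
  have hRh : ∀ z, R ≤ ‖z‖ → h z = 0 := fun z hz => image_eq_zero_of_notMem_tsupport (hR z hz)
  have hdiff : Differentiable ℝ h := hh.differentiable (by norm_num)
  set g : ℂ → ℝ × ℝ → ℂ := fun m p => fderiv ℝ h (p.1 * Complex.exp (p.2 * I)) (m * Complex.exp (p.2 * I)) with hg
  have hgi : ∀ m, Integrable (g m)
      ((volume.restrict (Ioi 0)).prod (volume.restrict (Ioo (-Real.pi) Real.pi))) := fun m =>
    dbar_polar_aux hh hRd m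
  have e1 : cT (dbar h) 0 = ∫ p, (g 1 p + I * g I p) / 2
      ∂((volume.restrict (Ioi 0)).prod (volume.restrict (Ioo (-Real.pi) Real.pi))) := by
    unfold cT
    rw [← Complex.integral_comp_polarCoord_symm, Measure.prod_restrict, polarCoord_target, ← Measure.volume_eq_prod]
    apply setIntegral_congr_fun (measurableSet_Ioi.prod measurableSet_Ioo)
    rintro ⟨a, b⟩ ⟨ha, hb⟩
    have ha : 0 < a := ha
    simp only [hg]
    have hP : Complex.polarCoord.symm (a, b) = a * Complex.exp (b * I) := by
      rw [Complex.polarCoord_symm_apply, Complex.exp_mul_I]; simp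
    rw [hP, sub_zero, mul_inv, ← Complex.exp_neg]
    set L := fderiv ℝ h (a * Complex.exp (b * I)) with hL
    have dec : ∀ w : ℂ, L w = w.re * L 1 + w.im * L I := by
      intro w
      have : w = w.re • (1:ℂ) + w.im • I := by
        apply Complex.ext <;> simp
      conv_lhs => rw [this]
      rw [map_add, map_smul, map_smul]; simp
    rw [dec (1 * _), dec (I * _)]
    have ha' : (a:ℂ) ≠ 0 := by exact_mod_cast ha.ne'
    have hre : (Complex.exp (b * I)).re = Real.cos b := Complex.exp_ofReal_mul_I_re b
    have him : (Complex.exp (b * I)).im = Real.sin b := Complex.exp_ofReal_mul_I_im b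
    have hneg : Complex.exp (-(b * I)) = Real.cos b - Real.sin b * I := by
      rw [← neg_mul, Complex.exp_mul_I]; simp
      ring
    simp only [dbar, ← hL, one_mul, Complex.mul_re, Complex.mul_im, Complex.I_re, Complex.I_im, hre, him, hneg,
      Complex.real_smul]
    field_simp
    push_cast
    ring_nf
    simp
  have e2 : ∫ p, g 1 p ∂((volume.restrict (Ioi 0)).prod (volume.restrict (Ioo (-Real.pi) Real.pi))) =
      - (2 * Real.pi) * h 0 := by
    rw [integral_prod_symm _ (hgi 1)]
    have : ∀ b : ℝ, ∫ a in Ioi (0:ℝ), g 1 (a, b) = - h 0 := by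
      intro b
      have k1 : ContDiff ℝ 1 (fun a : ℝ => h (a * Complex.exp (b * I))) := by
        apply hh.comp
        exact (Complex.ofRealCLM.contDiff).mul contDiff_const
      have k2 : HasCompactSupport (fun a : ℝ => h (a * Complex.exp (b * I))) := by
        apply HasCompactSupport.intro (K := Icc (-R) R) isCompact_Icc
        intro a ha
        apply hRh
        rw [norm_mul, Complex.norm_exp_ofReal_mul_I, mul_one, Complex.norm_real, Real.norm_eq_abs]
        by_contra hc
        exact ha (abs_le.1 (not_le.1 hc).le)
      have k3 := k2.integral_Ioi_deriv_eq k1 0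
      simp only [Complex.ofReal_zero, zero_mul] at k3
      rw [← k3]
      congr 1; ext a
      have a1 : HasDerivAt (fun t : ℝ => (t:ℂ) * Complex.exp (b * I)) (1 * Complex.exp (b * I)) a := by
        simpa using (Complex.ofRealCLM.hasDerivAt (x := a)).mul_const (Complex.exp (b * I))
      exact (((hdiff _).hasFDerivAt).comp_hasDerivAt a a1).deriv.symm
    simp only [this]
    rw [integral_const]
    simp [Real.pi_pos.le]
    left; ring
  have e3 : ∫ p, g I p ∂((volume.restrict (Ioi 0)).prod (volume.restrict (Ioo (-Real.pi) Real.pi))) = 0 := by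
    rw [integral_prod _ (hgi I)]
    have : ∀ a ∈ Ioi (0:ℝ), ∫ b in Ioo (-Real.pi) Real.pi, g I (a, b) = 0 := by
      intro a ha
      have ha : 0 < a := ha
      have ha' : (a:ℂ) ≠ 0 := by exact_mod_cast ha.ne'
      have d1 : ∀ b : ℝ, HasDerivAt (fun t : ℝ => h (a * Complex.exp (t * I))) (a * g I (a, b)) b := by
        intro b
        have a1 : HasDerivAt (fun t : ℝ => (a:ℂ) * Complex.exp (t * I)) ((a:ℂ) * (I * Complex.exp (b * I))) b := by
          have := (((Complex.ofRealCLM.hasDerivAt (x := b)).mul_const I).cexp).const_mul (a:ℂ)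
          apply this.congr_deriv
          simp only [Complex.ofRealCLM_apply, Complex.ofReal_one]; ring
        have := ((hdiff _).hasFDerivAt).comp_hasDerivAt b a1
        apply this.congr_deriv
        have e : (a:ℂ) * (I * Complex.exp (b * I)) = a • (I * Complex.exp (b * I)) := by simp
        rw [e, map_smul]; simp [hg]
      have hcont : Continuous (fun b : ℝ => (a:ℂ) * g I (a, b)) := by
        apply continuous_const.mul
        apply Continuous.clm_apply
        · exact (hh.continuous_fderiv (by norm_num)).comp (by fun_prop)
        · fun_prop
      have k := intervalIntegral.integral_eq_sub_of_hasDerivAt (a := -Real.pi) (b := Real.pi) (fun b _ => d1 b)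
        (hcont.intervalIntegrable _ _)
      rw [intervalIntegral.integral_of_le (by linarith [Real.pi_pos]), integral_Ioc_eq_integral_Ioo,
        integral_const_mul] at k
      have e : Complex.exp ((-Real.pi : ℝ) * I) = Complex.exp ((Real.pi : ℝ) * I) := by
        push_cast
        rw [neg_mul, Complex.exp_neg, Complex.exp_pi_mul_I]; norm_num
      rw [e, sub_self] at k
      exact (mul_eq_zero.1 k).resolve_left ha'
    rw [setIntegral_congr_fun measurableSet_Ioi this]
    simp
  rw [e1, integral_div, integral_add (hgi 1) ((hgi I).const_mul I), integral_const_mul, e2, e3]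
  ring

lemma cT_dbar {h : ℂ → ℂ} (hh : ContDiff ℝ 1 h) (hs : HasCompactSupport h) (z : ℂ) :
    cT (dbar h) z = - Real.pi * h z := by
  have h1 := cT_dbar_zero (h := fun ζ => h (ζ + z)) (hh.comp (by fun_prop))
    (hs.comp_homeomorph (Homeomorph.addRight z))
  simp only [zero_add] at h1
  rw [← h1]
  unfold cT
  rw [← integral_add_right_eq_self _ z]
  congr 1; ext ζ
  simp [dbar, fderiv_comp_add_right]

end

section
open MeasureTheory

lemma cT_diff_of_zero {G : ℂ → ℂ} (hG : Integrable G) {z0 : ℂ} {δ : ℝ} (hδ : 0 < δ)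
    (h0 : ∀ z ∈ ball z0 δ, G z = 0) : DifferentiableAt ℂ (cT G) z0 := by
  have hfar : ∀ ζ, G ζ ≠ 0 → ∀ z ∈ ball z0 (δ / 2), δ / 2 ≤ ‖ζ - z‖ := by
    intro ζ hζ z hz
    by_contra hc
    apply hζ; apply h0
    rw [mem_ball, dist_eq_norm] at hz ⊢
    have := norm_sub_le_norm_sub_add_norm_sub ζ z z0
    push Not at hc; linarith
  have hm : ∀ z, Measurable (fun ζ : ℂ => (ζ - z)⁻¹) := meas_kernel
  have := hasDerivAt_integral_of_dominated_loc_of_deriv_le (μ := volume) (𝕜 := ℂ)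
    (F := fun z ζ => G ζ * (ζ - z)⁻¹) (F' := fun z ζ => G ζ * ((ζ - z) ^ 2)⁻¹) (x₀ := z0)
    (s := ball z0 (δ / 2)) (bound := fun ζ => ‖G ζ‖ * ((δ / 2) ^ 2)⁻¹) (ball_mem_nhds _ (by positivity))
    (Eventually.of_forall fun z => hG.1.mul (hm z).aestronglyMeasurable)
    (by
      refine Integrable.mono (hG.norm.mul_const (δ / 2)⁻¹) (hG.1.mul (hm z0).aestronglyMeasurable) ?_
      refine ae_of_all _ fun ζ => ?_
      by_cases hζ : G ζ = 0
      · simp [hζ]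
      have := hfar ζ hζ z0 (mem_ball_self (by positivity))
      simp only [norm_mul, norm_inv, norm_norm]
      rw [Real.norm_of_nonneg (by positivity : 0 ≤ δ / 2)]
      gcongr)
    (hG.1.mul (by
      have : Measurable (fun ζ : ℂ => ((ζ - z0) ^ 2)⁻¹) := by fun_prop
      exact this.aestronglyMeasurable))
    (by
      refine ae_of_all _ fun ζ z hz => ?_
      by_cases hζ : G ζ = 0
      · simp [hζ]
      have := hfar ζ hζ z hz
      simp only [norm_mul, norm_inv, norm_pow]
      gcongr)
    (hG.norm.mul_const _)
    (by
      refine ae_of_all _ fun ζ z hz => ?_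
      by_cases hζ : G ζ = 0
      · simpa [hζ] using hasDerivAt_const z (0:ℂ)
      have := hfar ζ hζ z hz
      have hne : ζ - z ≠ 0 := by
        rw [← norm_pos_iff]; linarith
      have h1 : HasDerivAt (fun z => ζ - z) (-1) z := by
        simpa using (hasDerivAt_id z).const_sub ζ
      have h2 := (h1.inv hne).const_mul (G ζ)
      apply h2.congr_deriv
      simp)
  exact this.2.differentiableAt

lemma dbar_cont {h : ℂ → ℂ} (hh : ContDiff ℝ 1 h) : Continuous (dbar h) := by
  have := hh.continuous_fderiv (by norm_num)
  unfold dbar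
  have h1 : ∀ w, Continuous fun z => fderiv ℝ h z w := fun w => this.clm_apply continuous_const
  exact ((h1 1).add (continuous_const.mul (h1 I))).div_const 2

lemma dbar_bddSupp {h : ℂ → ℂ} (hh : ContDiff ℝ 1 h) (hs : HasCompactSupport h) :
    ∃ R C, BddSupp (dbar h) R C := by
  obtain ⟨R, hRpos, hR⟩ : ∃ R > 0, ∀ z, R ≤ ‖z‖ → z ∉ tsupport h := by
    obtain ⟨R, hR, hR2⟩ := hs.isCompact.isBounded.subset_ball_lt 0 0
    exact ⟨R, hR, fun z hz hz2 => by have := hR2 hz2; simp at this; linarith⟩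
  have hz : ∀ z, R ≤ ‖z‖ → dbar h z = 0 := by
    intro z hz
    have : fderiv ℝ h z = 0 := by
      by_contra hc
      exact hR z hz (support_fderiv_subset ℝ hc)
    simp [dbar, this]
  have hc : HasCompactSupport (dbar h) :=
    HasCompactSupport.intro (isCompact_closedBall (0:ℂ) R) fun z hz' => hz z (by simp at hz'; exact hz'.le)
  obtain ⟨C, hC⟩ := hc.exists_bound_of_continuous (dbar_cont hh)
  exact ⟨R, C, (dbar_cont hh).aestronglyMeasurable, hC, hz⟩

lemma dbar_contOn {u : ℂ → ℂ} {D : Set ℂ} (hD : IsOpen D) (hu : ContDiffOn ℝ 1 u D) :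
    ContinuousOn (dbar u) D := by
  have := hu.continuousOn_fderiv_of_isOpen hD (by norm_num)
  unfold dbar
  have h1 : ∀ w, ContinuousOn (fun z => fderiv ℝ u z w) D := fun w => this.clm_apply continuousOn_const
  exact ((h1 1).add (continuousOn_const.mul (h1 I))).div_const 2

lemma dbar_indicator_bddSupp {u : ℂ → ℂ} {D : Set ℂ} (hD : IsOpen D) (hu : ContDiffOn ℝ 1 u D) {R C : ℝ}
    (hR : D ⊆ ball 0 R) (hC : ∀ z ∈ D, ‖dbar u z‖ ≤ C) (hC0 : 0 ≤ C) : BddSupp (D.indicator (dbar u)) R C := by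
  refine ⟨?_, ?_, ?_⟩
  · rw [aestronglyMeasurable_indicator_iff hD.measurableSet]
    exact (dbar_contOn hD hu).aestronglyMeasurable hD.measurableSet
  · intro z
    by_cases h : z ∈ D
    · rw [indicator_of_mem h]; exact hC z h
    · rw [indicator_of_notMem h]; simpa using hC0
  · intro z hz
    apply indicator_of_notMem
    intro h
    have := hR h
    simp at this; linarith

lemma cauchy_holo {u : ℂ → ℂ} {D : Set ℂ} (hD : IsOpen D) (hu : ContDiffOn ℝ 1 u D) {R C : ℝ}
    (hF : BddSupp (D.indicator (dbar u)) R C) :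
    DifferentiableOn ℂ (fun z => u z + (Real.pi : ℂ)⁻¹ * cT (D.indicator (dbar u)) z) D := by
  intro z0 hz0
  apply DifferentiableAt.differentiableWithinAt
  obtain ⟨d, hd, hdD⟩ := Metric.isOpen_iff.1 hD z0 hz0
  let β : ContDiffBump z0 := ⟨d / 4, d / 2, by positivity, by linarith⟩
  have hβD : tsupport β ⊆ D := by
    rw [β.tsupport_eq]
    exact (closedBall_subset_ball (by simp [β]; linarith)).trans hdD
  let h : ℂ → ℂ := fun z => β z • u z
  have hts : tsupport h ⊆ tsupport β := by
    apply closure_mono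
    intro z hz hb
    apply hz; simp only [h, hb, zero_smul]
  have hh : ContDiff ℝ 1 h := by
    rw [contDiff_iff_contDiffAt]
    intro z
    by_cases hz : z ∈ tsupport h
    · exact β.contDiffAt.smul (hu.contDiffAt (hD.mem_nhds (hβD (hts hz))))
    · have : h =ᶠ[nhds z] fun _ => 0 := notMem_tsupport_iff_eventuallyEq.1 hz
      exact contDiffAt_const.congr_of_eventuallyEq this
  have hs : HasCompactSupport h :=
    β.hasCompactSupport.of_isClosed_subset (isClosed_tsupport h) hts
  obtain ⟨R', C', hB⟩ := dbar_bddSupp hh hs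
  have hG : DifferentiableAt ℂ (cT (fun ζ => D.indicator (dbar u) ζ - dbar h ζ)) z0 := by
    apply cT_diff_of_zero (hF.integrable.sub hB.integrable) (δ := d / 4) (by positivity)
    intro z hz
    have hzD : z ∈ D := hdD (ball_subset_ball (by linarith) hz)
    rw [Pi.sub_apply, indicator_of_mem hzD]
    have he : h =ᶠ[nhds z] u := by
      filter_upwards [isOpen_ball.mem_nhds hz] with y hy
      simp only [h]
      rw [β.one_of_mem_closedBall (ball_subset_closedBall hy), one_smul]
    simp [dbar, he.fderiv_eq]
  have hsum : ∀ z, cT (D.indicator (dbar u)) z =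
      cT (fun ζ => D.indicator (dbar u) ζ - dbar h ζ) z - Real.pi * h z := by
    intro z
    have h1 := cT_dbar hh hs z
    have h2 : cT (fun ζ => D.indicator (dbar u) ζ - dbar h ζ) z =
        cT (D.indicator (dbar u)) z - cT (dbar h) z := by
      unfold cT
      rw [← integral_sub (hF.integrable_mul z) (hB.integrable_mul z)]
      simp only [sub_mul]
    rw [h2, h1]; ring
  have hpi : (Real.pi : ℂ) ≠ 0 := by exact_mod_cast Real.pi_ne_zero
  have hev : (fun z => u z + (Real.pi : ℂ)⁻¹ * cT (D.indicator (dbar u)) z) =ᶠ[nhds z0]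
      fun z => (Real.pi : ℂ)⁻¹ * cT (fun ζ => D.indicator (dbar u) ζ - dbar h ζ) z := by
    filter_upwards [ball_mem_nhds z0 (show 0 < d / 4 by positivity)] with y hy
    have : h y = u y := by
      simp only [h]
      rw [β.one_of_mem_closedBall (ball_subset_closedBall hy), one_smul]
    rw [hsum, this]
    field_simp
    ring
  exact (hG.const_mul _).congr_of_eventuallyEq hev

/-- Combined solution of the inhomogeneous Cauchy-Riemann equation with small data. -/
lemma dbar_solve {D : Set ℂ} (hD : IsOpen D) (hDb : Bornology.IsBounded D) {u : ℕ → ℂ → ℂ} {C : ℝ}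
    (hu : ∀ n, ContDiffOn ℝ 1 (u n) D) (hC : ∀ n, ∀ z ∈ D, ‖dbar (u n) z‖ ≤ C)
    (hlim : ∀ z ∈ D, Tendsto (fun n => dbar (u n) z) atTop (nhds 0)) :
    ∃ w : ℕ → ℂ → ℂ, (∀ n, Continuous (w n)) ∧ (∀ n, DifferentiableOn ℂ (fun z => u n z - w n z) D) ∧
      ∀ ε > 0, ∀ᶠ n in atTop, ∀ z, ‖w n z‖ ≤ ε := by
  obtain ⟨R, hR⟩ := hDb.subset_ball 0
  have hF : ∀ n, BddSupp (D.indicator (dbar (u n))) R (max C 0) := fun n =>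
    dbar_indicator_bddSupp hD (hu n) hR (fun z hz => (hC n z hz).trans (le_max_left _ _)) (le_max_right _ _)
  refine ⟨fun n z => - ((Real.pi : ℂ)⁻¹ * cT (D.indicator (dbar (u n))) z), ?_, ?_, ?_⟩
  · intro n
    exact (continuous_const.mul (hF n).cT_cont).neg
  · intro n
    simpa using cauchy_holo hD (hu n) (hF n)
  · intro ε hε
    have := cT_small hF (by
      intro z
      by_cases hz : z ∈ D
      · simpa [indicator_of_mem hz] using hlim z hz
      · simp [indicator_of_notMem hz]) (mul_pos Real.pi_pos hε)
    filter_upwards [this] with n hn z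
    rw [norm_neg, norm_mul, norm_inv, Complex.norm_real, Real.norm_of_nonneg Real.pi_pos.le,
      inv_mul_le_iff₀ Real.pi_pos]
    exact hn z

end

section

lemma uhp_sqrt : ∃ S : ℂ → ℂ, ContinuousOn S {z | 0 ≤ z.im} ∧ DifferentiableOn ℂ S {z | 0 < z.im} ∧
    ∀ z, 0 ≤ z.im → S z ^ 2 = z ∧ 0 ≤ (S z).re ∧ 0 ≤ (S z).im := by
  let T : ℂ → ℂ := fun z => (-I * z) ^ (1 / 2 : ℂ)
  have hT2 : ∀ z, T z ^ 2 = -I * z := by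
    intro z
    have := Complex.cpow_nat_inv_pow (-I * z) (n := 2) (by norm_num)
    simpa [T] using this
  have hTre : ∀ z, 0 ≤ (T z).re := by
    intro z
    by_cases hz : -I * z = 0
    · simp only [T, hz]; simp
    · simp only [T]
      rw [Complex.cpow_def_of_ne_zero hz, Complex.exp_re]
      apply mul_nonneg (Real.exp_pos _).le
      have h1 := Complex.neg_pi_lt_arg (-I * z)
      have h2 := Complex.arg_le_pi (-I * z)
      have : (Complex.log (-I * z) * (1 / 2)).im = (-I * z).arg / 2 := by
        have e : Complex.log (-I * z) * (1 / 2) = ((1/2 : ℝ):ℂ) * Complex.log (-I * z) := by push_cast; ring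
        rw [e, Complex.im_ofReal_mul, Complex.log_im]
        ring
      rw [this]
      apply Real.cos_nonneg_of_neg_pi_div_two_le_of_le <;> linarith
  have hs2 : ((Real.sqrt 2 : ℝ) : ℂ) ^ 2 = 2 := by
    rw [← Complex.ofReal_pow, Real.sq_sqrt (by norm_num)]; norm_num
  refine ⟨fun z => (1 + I) * T z * (((Real.sqrt 2)⁻¹ : ℝ) : ℂ), ?_, ?_, ?_⟩
  · intro z hz
    apply ContinuousAt.continuousWithinAt
    apply ContinuousAt.mul (ContinuousAt.mul continuousAt_const _) continuousAt_const
    have := Complex.continuousAt_cpow_const_of_re_pos (z := -I * z) (w := 1 / 2) (by left; simpa using hz) (by norm_num)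
    exact ContinuousAt.comp (f := fun z => -I * z) this (by fun_prop)
  · intro z hz
    apply DifferentiableAt.differentiableWithinAt
    apply DifferentiableAt.mul_const
    apply DifferentiableAt.const_mul
    apply DifferentiableAt.cpow (by fun_prop) (by fun_prop)
    left; simpa using hz
  · intro z hz
    have h2 := hT2 z
    have hr := hTre z
    have hre := congrArg Complex.re h2
    simp [pow_two] at hre
    have hzz : 0 ≤ z.im := hz
    have habs : |(T z).im| ≤ |(T z).re| := by
      apply sq_le_sq.1; nlinarith
    rw [abs_of_nonneg hr] at habs
    have := abs_le.1 habs
    refine ⟨?_, ?_, ?_⟩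
    · rw [mul_pow, mul_pow, h2, Complex.ofReal_inv, inv_pow, hs2]
      have : (1 + I) ^ 2 = 2 * I := by ring_nf; simp
      rw [this]
      ring_nf; simp
    · rw [Complex.mul_re, Complex.ofReal_im, Complex.ofReal_re]
      simp only [mul_zero, sub_zero]
      apply mul_nonneg _ (by positivity)
      simp; linarith
    · rw [Complex.mul_im, Complex.ofReal_im, Complex.ofReal_re]
      simp only [mul_zero, zero_add]
      apply mul_nonneg _ (by positivity)
      simp; linarith

lemma model_fun : ∃ Φ : ℂ → ℂ, ContinuousOn Φ {z | 0 ≤ z.im} ∧ DifferentiableOn ℂ Φ {z | 0 < z.im} ∧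
    (∀ z, 0 ≤ z.im → ‖Φ z‖ ≤ 1) ∧ (∀ z, 0 < z.im → ‖Φ z‖ < 1) ∧
    (∀ x : ℝ, |x| ≤ 1 → ‖Φ x‖ = 1) ∧ (∀ x : ℝ, 1 < |x| → ‖Φ x‖ < 1 ∧ (Φ x).im = 0) := by
  obtain ⟨S, hSc, hSd, hS⟩ := uhp_sqrt
  have key : ∀ z : ℂ, 0 ≤ z.im → ∃ k m : ℝ,
      k = (S (z + 1)).re * (S (z - 1)).re + (S (z + 1)).im * (S (z - 1)).im ∧ 0 ≤ k ∧
      m = ‖(S (z + 1) - S (z - 1)) ^ 2 / 2‖ ∧ 0 < m ∧ 1 / m - m = 2 * k := by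
    intro z hz
    obtain ⟨a1, a2, a3⟩ := hS (z + 1) (by simpa using hz)
    obtain ⟨b1, b2, b3⟩ := hS (z - 1) (by simpa using hz)
    set A := S (z + 1)
    set B := S (z - 1)
    have hds : (A - B) * (A + B) = 2 := by
      have : (A - B) * (A + B) = A ^ 2 - B ^ 2 := by ring
      rw [this, a1, b1]; ring
    have hn : ‖A - B‖ * ‖A + B‖ = 2 := by rw [← norm_mul, hds]; simp
    have hd0 : 0 < ‖A - B‖ := by
      rcases (norm_nonneg (A - B)).lt_or_eq with h | h
      · exact h
      · rw [← h] at hn; norm_num at hn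
    have hdiff : ‖A + B‖ ^ 2 - ‖A - B‖ ^ 2 = 4 * (A.re * B.re + A.im * B.im) := by
      rw [← Complex.normSq_eq_norm_sq, ← Complex.normSq_eq_norm_sq, Complex.normSq_apply, Complex.normSq_apply]
      simp; ring
    refine ⟨_, _, rfl, by positivity, rfl, ?_, ?_⟩
    · rw [norm_div, norm_pow]
      exact div_pos (pow_pos hd0 2) (by simp)
    · rw [norm_div, norm_pow]
      have e : ‖A + B‖ = 2 / ‖A - B‖ := by field_simp; linarith
      rw [e] at hdiff
      simp only [Complex.norm_ofNat]
      field_simp at hdiff ⊢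
      nlinarith
  refine ⟨fun z => (S (z + 1) - S (z - 1)) ^ 2 / 2, ?_, ?_, ?_, ?_, ?_, ?_⟩
  · apply ContinuousOn.div_const
    apply ContinuousOn.pow
    apply ContinuousOn.sub
    · exact hSc.comp (by fun_prop) (fun z hz => by simpa using hz)
    · exact hSc.comp (by fun_prop) (fun z hz => by simpa using hz)
  · apply DifferentiableOn.div_const
    apply DifferentiableOn.pow
    apply DifferentiableOn.sub
    · exact hSd.comp (by fun_prop) (fun z hz => by simpa using hz)
    · exact hSd.comp (by fun_prop) (fun z hz => by simpa using hz)
  · intro z hz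
    obtain ⟨k, m, _, hk, hm, hm0, hmk⟩ := key z hz
    simp only; rw [← hm]
    by_contra hc
    push Not at hc
    have : 1 / m < 1 := by rw [div_lt_one hm0]; exact hc
    linarith
  · intro z hz
    obtain ⟨k, m, hk', hk, hm, hm0, hmk⟩ := key z hz.le
    obtain ⟨a1, a2, a3⟩ := hS (z + 1) (by simpa using hz.le)
    obtain ⟨b1, b2, b3⟩ := hS (z - 1) (by simpa using hz.le)
    simp only; rw [← hm]
    have h1 := congrArg Complex.im a1
    have h2 := congrArg Complex.im b1
    simp [pow_two] at h1 h2
    have pa : 0 < (S (z + 1)).re := by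
      rcases a2.lt_or_eq with h | h
      · exact h
      · rw [← h] at h1; simp at h1; linarith
    have pb : 0 < (S (z - 1)).re := by
      rcases b2.lt_or_eq with h | h
      · exact h
      · rw [← h] at h2; simp at h2; linarith
    have hkp : 0 < k := by rw [hk']; positivity
    by_contra hc
    push Not at hc
    have : 1 / m ≤ 1 := by rw [div_le_one hm0]; exact hc
    linarith
  · intro x hx
    obtain ⟨k, m, hk', hk, hm, hm0, hmk⟩ := key x (by simp)
    obtain ⟨a1, a2, a3⟩ := hS (x + 1) (by simp)
    obtain ⟨b1, b2, b3⟩ := hS (x - 1) (by simp)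
    simp only; rw [← hm]
    have hx := abs_le.1 hx
    have h1 := congrArg Complex.im a1
    have h2 := congrArg Complex.im b1
    have h3 := congrArg Complex.re a1
    have h4 := congrArg Complex.re b1
    simp [pow_two] at h1 h2 h3 h4
    have pa : (S (x + 1)).im = 0 := by
      by_contra hc
      have hc' : 0 < (S (x + 1)).im := lt_of_le_of_ne a3 (Ne.symm hc)
      have : (S (x + 1)).re = 0 := by nlinarith
      rw [this] at h3; nlinarith
    have pb : (S (x - 1)).re = 0 := by
      by_contra hc
      have hc' : 0 < (S (x - 1)).re := lt_of_le_of_ne b2 (Ne.symm hc)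
      have : (S (x - 1)).im = 0 := by nlinarith
      rw [this] at h4; nlinarith
    have hk0 : k = 0 := by rw [hk', pa, pb]; simp
    rw [hk0] at hmk
    field_simp at hmk
    nlinarith
  · intro x hx
    obtain ⟨k, m, hk', hk, hm, hm0, hmk⟩ := key x (by simp)
    obtain ⟨a1, a2, a3⟩ := hS (x + 1) (by simp)
    obtain ⟨b1, b2, b3⟩ := hS (x - 1) (by simp)
    simp only; rw [← hm]
    have h1 := congrArg Complex.im a1
    have h2 := congrArg Complex.im b1
    have h3 := congrArg Complex.re a1
    have h4 := congrArg Complex.re b1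
    simp [pow_two] at h1 h2 h3 h4
    have hcase : ((S (x + 1)).im = 0 ∧ (S (x - 1)).im = 0 ∧ 0 < k) ∨
        ((S (x + 1)).re = 0 ∧ (S (x - 1)).re = 0 ∧ 0 < k) := by
      rcases lt_abs.1 hx with h | h
      · left
        have pa : (S (x + 1)).im = 0 := by
          by_contra hc
          have hc' : 0 < (S (x + 1)).im := lt_of_le_of_ne a3 (Ne.symm hc)
          have : (S (x + 1)).re = 0 := by nlinarith
          rw [this] at h3; nlinarith
        have pb : (S (x - 1)).im = 0 := by
          by_contra hc
          have hc' : 0 < (S (x - 1)).im := lt_of_le_of_ne b3 (Ne.symm hc)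
          have : (S (x - 1)).re = 0 := by nlinarith
          rw [this] at h4; nlinarith
        refine ⟨pa, pb, ?_⟩
        rw [pa] at h3; rw [pb] at h4
        have : 0 < (S (x + 1)).re := lt_of_le_of_ne a2 (by intro h0; rw [← h0] at h3; simp at h3; linarith)
        have : 0 < (S (x - 1)).re := lt_of_le_of_ne b2 (by intro h0; rw [← h0] at h4; simp at h4; linarith)
        rw [hk']; positivity
      · right
        have pa : (S (x + 1)).re = 0 := by
          by_contra hc
          have hc' : 0 < (S (x + 1)).re := lt_of_le_of_ne a2 (Ne.symm hc)
          have : (S (x + 1)).im = 0 := by nlinarith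
          rw [this] at h3; nlinarith
        have pb : (S (x - 1)).re = 0 := by
          by_contra hc
          have hc' : 0 < (S (x - 1)).re := lt_of_le_of_ne b2 (Ne.symm hc)
          have : (S (x - 1)).im = 0 := by nlinarith
          rw [this] at h4; nlinarith
        refine ⟨pa, pb, ?_⟩
        rw [pa] at h3; rw [pb] at h4
        have : 0 < (S (x + 1)).im := lt_of_le_of_ne a3 (by intro h0; rw [← h0] at h3; simp at h3; linarith)
        have : 0 < (S (x - 1)).im := lt_of_le_of_ne b3 (by intro h0; rw [← h0] at h4; simp at h4; linarith)
        rw [hk']; positivity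
    constructor
    · have hkp : 0 < k := by rcases hcase with h | h <;> exact h.2.2
      by_contra hc
      push Not at hc
      have : 1 / m ≤ 1 := by rw [div_le_one hm0]; exact hc
      linarith
    · rw [show (2:ℂ) = ((2:ℝ):ℂ) by norm_num, Complex.div_ofReal_im]
      rcases hcase with h | h
      · simp [pow_two, h.1, h.2.1]
      · simp [pow_two, h.1, h.2.1]

end

section

structure BChart (D Z : Set ℂ) (e : OpenPartialHomeomorph ℂ ℂ) (a C : ℝ) : Prop where
  apos : 0 < a
  cpos : 0 ≤ C
  tgt : ball 0 a ⊆ e.target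
  smooth : ContDiffOn ℝ 1 e e.source
  memD : ∀ z ∈ e.source, (z ∈ D ↔ 0 < (e z).im)
  memF : ∀ z ∈ e.source, (z ∈ frontier D ↔ (e z).im = 0)
  dbar_le : ∀ z ∈ e.source, z ∈ D → ‖dbar e z‖ ≤ C * (e z).im
  disj : ∀ z ∈ e.source, z ∉ Z

lemma exists_chart {D : Set ℂ} (hDsb : SmoothlyBounded D) {Z : Set ℂ} (hZ : IsClosed Z)
    {p : ℂ} (hp : p ∈ frontier D) (hpZ : p ∉ Z) :
    ∃ e : OpenPartialHomeomorph ℂ ℂ, ∃ a C : ℝ, p ∈ e.source ∧ e p = 0 ∧ BChart D Z e a C := by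
  obtain ⟨V, hV, hFV, v, hv, hDV, hF, hdv⟩ := hDsb
  have hpV := hFV hp
  have hv2 : ContDiffOn ℝ 2 v V := hv.of_le (WithTop.coe_le_coe.2 (le_top : (2:ℕ∞) ≤ ⊤))
  have hDv : ContDiffOn ℝ 1 (fderiv ℝ v) V := hv2.fderiv_of_isOpen hV (by norm_num)
  let n : ℂ → ℂ := fun z => (fderiv ℝ v z 1 : ℂ) + I * (fderiv ℝ v z I : ℂ)
  have hn : ContDiffOn ℝ 1 n V := by
    have h1 : ∀ w : ℂ, ContDiffOn ℝ 1 (fun z => ((fderiv ℝ v z w : ℝ) : ℂ)) V := fun w =>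
      Complex.ofRealCLM.contDiff.comp_contDiffOn (hDv.clm_apply contDiffOn_const)
    exact (h1 1).add (contDiffOn_const.mul (h1 I))
  have dec : ∀ (L : ℂ →L[ℝ] ℝ) (w : ℂ), L w = w.re * L 1 + w.im * L I := by
    intro L w
    have : w = w.re • (1:ℂ) + w.im • I := by
      apply Complex.ext <;> simp
    conv_lhs => rw [this]
    rw [map_add, map_smul, map_smul]; simp
  set n0 := n p with hn0
  have hn0ne : n0 ≠ 0 := by
    intro h
    apply hdv p hp
    have h1 := congrArg Complex.re h
    have h2 := congrArg Complex.im h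
    simp [hn0, n] at h1 h2
    ext w
    rw [dec, h1, h2]; simp
  let W0 : Set ℂ := V ∩ n ⁻¹' {0}ᶜ
  have hW0 : IsOpen W0 := hn.continuousOn.isOpen_inter_preimage hV isOpen_compl_singleton
  have hpW0 : p ∈ W0 := ⟨hpV, hn0ne⟩
  let m : ℂ → ℂ := fun z => n0 * (n z)⁻¹
  have hm : ContDiffOn ℝ 1 m W0 :=
    contDiffOn_const.mul ((hn.mono inter_subset_left).inv fun z hz => hz.2)
  have hmp : m p = 1 := mul_inv_cancel₀ hn0ne
  let ℓ : ℂ →L[ℝ] ℂ := Complex.ofRealCLM.comp (Complex.reCLM.comp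
    ((ContinuousLinearMap.mul ℝ ℂ) (starRingEnd ℂ (I * n0))))
  have hℓ : ∀ w, ℓ w = (((starRingEnd ℂ (I * n0)) * w).re : ℂ) := fun w => rfl
  let E : ℂ → ℂ := fun z => ℓ (z - p) - I * ((v z : ℂ) * m z)
  have hE : ContDiffOn ℝ 1 E W0 := by
    have h1 : ContDiffOn ℝ 1 (fun z => (v z : ℂ)) W0 :=
      Complex.ofRealCLM.contDiff.comp_contDiffOn ((hv2.of_le (by norm_num)).mono inter_subset_left)
    have h2 : ContDiffOn ℝ 1 (fun z => ℓ (z - p)) W0 :=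
      ℓ.contDiff.comp_contDiffOn (contDiffOn_id.sub contDiffOn_const)
    exact h2.sub (contDiffOn_const.mul (h1.mul hm))
  have hvd : ∀ z ∈ W0, HasFDerivAt v (fderiv ℝ v z) z := fun z hz =>
    ((hv2.contDiffAt (hV.mem_nhds hz.1)).differentiableAt (by norm_num)).hasFDerivAt
  have hmd : ∀ z ∈ W0, HasFDerivAt m (fderiv ℝ m z) z := fun z hz =>
    ((hm.contDiffAt (hW0.mem_nhds hz)).differentiableAt (by norm_num)).hasFDerivAt
  have hEd : ∀ z ∈ W0, ∀ w, fderiv ℝ E z w = ℓ w - I * ((v z : ℂ) * fderiv ℝ m z w + (fderiv ℝ v z w : ℂ) * m z) := by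
    intro z hz w
    have h1 : HasFDerivAt (fun z => (v z : ℂ)) (Complex.ofRealCLM.comp (fderiv ℝ v z)) z :=
      Complex.ofRealCLM.hasFDerivAt.comp z (hvd z hz)
    have h2 : HasFDerivAt (fun z => ℓ (z - p)) ℓ z := by
      have := ℓ.hasFDerivAt.comp z ((hasFDerivAt_id z).sub_const p)
      exact this
    have h3 := h2.sub ((h1.mul (hmd z hz)).const_mul I)
    rw [show fderiv ℝ E z = _ from h3.fderiv]
    simp
    ring
  have hEdbar : ∀ z ∈ W0, dbar E z = - I * (v z : ℂ) * dbar m z := by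
    intro z hz
    unfold dbar
    rw [hEd z hz, hEd z hz]
    have e1 : ℓ 1 + I * ℓ I = I * n0 := by
      rw [hℓ, hℓ]
      apply Complex.ext <;> simp
    have e2 : n z * m z = n0 := by
      have hnz : n z ≠ 0 := hz.2
      simp only [m]
      field_simp
    simp only [n] at e2
    linear_combination (1 / 2) * e1 - (I / 2) * e2
  have hvp : v p = 0 := by
    have : p ∈ {z ∈ V | v z = 0} := hF ▸ hp
    exact this.2
  have hEp : HasFDerivAt E (((ContinuousLinearEquiv.unitsEquivAut ℂ (Units.mk0 (-I * starRingEnd ℂ n0)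
      (by simp [hn0ne]))).restrictScalars ℝ : ℂ ≃L[ℝ] ℂ) : ℂ →L[ℝ] ℂ) p := by
    have h := ((hE.contDiffAt (hW0.mem_nhds hpW0)).differentiableAt (by norm_num)).hasFDerivAt
    have heq : fderiv ℝ E p = (((ContinuousLinearEquiv.unitsEquivAut ℂ (Units.mk0 (-I * starRingEnd ℂ n0)
      (by simp [hn0ne]))).restrictScalars ℝ : ℂ ≃L[ℝ] ℂ) : ℂ →L[ℝ] ℂ) := by
      refine ContinuousLinearMap.ext fun w => ?_
      rw [hEd p hpW0, hvp, hmp, dec (fderiv ℝ v p) w, hℓ]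
      change _ = w * (-I * starRingEnd ℂ n0)
      apply Complex.ext
      · simp [hn0, n]
        try ring
      · simp [hn0, n]
        try ring
    rw [← heq]; exact h
  have hEp0 : E p = 0 := by simp [E, hvp]
  let e0 := ContDiffAt.toOpenPartialHomeomorph E (hE.contDiffAt (hW0.mem_nhds hpW0)) hEp (by norm_num)
  have he0 : (e0 : ℂ → ℂ) = E := ContDiffAt.toOpenPartialHomeomorph_coe _ _ _
  have hpe0 : p ∈ e0.source := ContDiffAt.mem_toOpenPartialHomeomorph_source _ _ _
  have hmc : ContinuousOn (fun z => (m z).re) W0 := Complex.continuous_re.comp_continuousOn hm.continuousOn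
  have hdc : ContinuousOn (fun z => ‖dbar m z‖) W0 := (dbar_contOn hW0 hm).norm
  let W1 : Set ℂ := (W0 ∩ (fun z => (m z).re) ⁻¹' (Ioi (1/2))) ∩ (W0 ∩ (fun z => ‖dbar m z‖) ⁻¹' (Iio (‖dbar m p‖ + 1))) ∩ Zᶜ
  have hW1 : IsOpen W1 := ((hmc.isOpen_inter_preimage hW0 isOpen_Ioi).inter
    (hdc.isOpen_inter_preimage hW0 isOpen_Iio)).inter hZ.isOpen_compl
  have hpW1 : p ∈ W1 := by
    refine ⟨⟨⟨hpW0, ?_⟩, hpW0, ?_⟩, hpZ⟩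
    · simp only [mem_preimage, hmp]; norm_num
    · simp
  let e := e0.restrOpen W1 hW1
  have hee : (e : ℂ → ℂ) = E := by rw [← he0]; rfl
  have hes : e.source = e0.source ∩ W1 := rfl
  have hpe : p ∈ e.source := ⟨hpe0, hpW1⟩
  have htgt : e.target ∈ nhds (0:ℂ) := by
    have := e.map_source hpe
    rw [hee, hEp0] at this
    exact e.open_target.mem_nhds this
  obtain ⟨a, ha, hat⟩ := Metric.mem_nhds_iff.1 htgt
  have him : ∀ z, (E z).im = - v z * (m z).re := by
    intro z
    simp [E, hℓ]
  have hmr : ∀ z ∈ e.source, 1/2 < (m z).re := fun z hz => hz.2.1.1.2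
  refine ⟨e, a, 2 * (‖dbar m p‖ + 1), hpe, by rw [hee, hEp0], ha, by positivity, hat, ?_, ?_, ?_, ?_, ?_⟩
  · rw [hee]; exact hE.mono fun z hz => hz.2.1.1.1
  · intro z hz
    have hzV : z ∈ V := hz.2.1.1.1.1
    have h1 : z ∈ D ↔ v z < 0 := by
      have : z ∈ D ∩ V ↔ z ∈ {z ∈ V | v z < 0} := by rw [hDV]
      constructor
      · intro h; exact (this.1 ⟨h, hzV⟩).2
      · intro h; exact (this.2 ⟨hzV, h⟩).1
    rw [h1, hee, him]
    have := hmr z hz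
    constructor
    · intro h; nlinarith
    · intro h; by_contra h'; push Not at h'; nlinarith
  · intro z hz
    have hzV : z ∈ V := hz.2.1.1.1.1
    have h1 : z ∈ frontier D ↔ v z = 0 := by
      rw [hF]; exact ⟨fun h => h.2, fun h => ⟨hzV, h⟩⟩
    rw [h1, hee, him]
    have := hmr z hz
    constructor
    · intro h; rw [h]; simp
    · intro h
      rcases mul_eq_zero.1 h with h | h
      · linarith
      · linarith
  · intro z hz hzD
    have hzV : z ∈ V := hz.2.1.1.1.1
    have h1 : z ∈ {z ∈ V | v z < 0} := hDV ▸ ⟨hzD, hzV⟩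
    have h2 : v z < 0 := h1.2
    have h3 := hmr z hz
    have h4 : ‖dbar m z‖ < ‖dbar m p‖ + 1 := hz.2.1.2.2
    rw [hee, hEdbar z hz.2.1.1.1, him]
    have h5 : ‖-I * (v z : ℂ) * dbar m z‖ = -v z * ‖dbar m z‖ := by
      rw [norm_mul, norm_mul]; simp [abs_of_neg h2]
    rw [h5]
    have h6 : 0 ≤ ‖dbar m z‖ := norm_nonneg _
    nlinarith [mul_le_mul_of_nonneg_left h4.le (by linarith : 0 ≤ -v z), mul_pos (by linarith : 0 < -v z) (by linarith : 0 < (m z).re - 1/2)]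
  · intro z hz; exact hz.2.2

end

section

lemma cutoff_exists {K U : Set ℂ} (hK : IsCompact K) (hU : IsOpen U) (hKU : K ⊆ U) :
    ∃ L : Set ℂ, ∃ χ : ℂ → ℝ, IsCompact L ∧ L ⊆ U ∧ ContDiff ℝ 1 χ ∧ (∀ z ∈ K, χ z = 1) ∧
      (∀ z ∉ L, χ z = 0) ∧ ∀ z, 0 ≤ χ z ∧ χ z ≤ 1 := by
  obtain ⟨L, hL, hKL, hLU⟩ := exists_compact_between hK hU hKU
  obtain ⟨f, h1, h0, h⟩ := exists_contMDiffMap_one_nhds_of_subset_interior (n := 1)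
    (modelWithCornersSelf ℝ ℂ) hK.isClosed hKL
  refine ⟨L, f, hL, hLU, contMDiff_iff_contDiff.1 f.contMDiff, fun z hz => ?_, h0, h⟩
  exact h1.self_of_nhdsSet z hz

lemma model_fun2 {p r : ℝ} (hpr : p < r) : ∃ Ψ : ℂ → ℂ, ContinuousOn Ψ {z | 0 ≤ z.im} ∧
    DifferentiableOn ℂ Ψ {z | 0 < z.im} ∧
    (∀ z, 0 ≤ z.im → ‖Ψ z‖ ≤ 1) ∧ (∀ z, 0 < z.im → ‖Ψ z‖ < 1) ∧
    (∀ x : ℝ, x ∈ Icc p r → ‖Ψ x‖ = 1) ∧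
    (∀ x : ℝ, x ∉ Icc p r → ∃ τ : ℝ, 0 ≤ τ ∧ τ ≤ 1 ∧ Ψ x = τ) := by
  obtain ⟨Φ, h1, h2, h3, h4, h5, h6⟩ := model_fun
  have hd : 0 < r - p := by linarith
  let L : ℂ → ℂ := fun ζ => ((2 / (r - p) : ℝ) : ℂ) * ζ - (((p + r) / (r - p) : ℝ) : ℂ)
  have hLim : ∀ ζ, (L ζ).im = 2 / (r - p) * ζ.im := by
    intro ζ; simp only [L, Complex.sub_im, Complex.re_ofReal_mul, Complex.im_ofReal_mul, Complex.ofReal_im, sub_zero]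
  have hLd : Differentiable ℂ L := by fun_prop
  have hLx : ∀ x : ℝ, L x = (((2 * x - p - r) / (r - p) : ℝ) : ℂ) := by
    intro x
    have : (r : ℂ) - p ≠ 0 := by exact_mod_cast hd.ne'
    simp only [L]; push_cast; field_simp; ring
  have hmap : ∀ ζ : ℂ, 0 ≤ ζ.im → 0 ≤ (L ζ).im := fun ζ h => by rw [hLim]; positivity
  have hmap' : ∀ ζ : ℂ, 0 < ζ.im → 0 < (L ζ).im := fun ζ h => by rw [hLim]; positivity
  refine ⟨fun ζ => Φ (L ζ) ^ 2, ?_, ?_, ?_, ?_, ?_, ?_⟩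
  · exact (h1.comp hLd.continuous.continuousOn hmap).pow 2
  · exact (h2.comp hLd.differentiableOn hmap').pow 2
  · intro z hz
    rw [norm_pow]; exact pow_le_one₀ (norm_nonneg _) (h3 _ (hmap z hz))
  · intro z hz
    rw [norm_pow]; exact pow_lt_one₀ (norm_nonneg _) (h4 _ (hmap' z hz)) two_ne_zero
  · intro x hx
    simp only
    rw [norm_pow, hLx, h5, one_pow]
    rw [abs_div, abs_of_pos hd, div_le_one hd, abs_le]
    constructor <;> linarith [hx.1, hx.2]
  · intro x hx
    have : 1 < |(2 * x - p - r) / (r - p)| := by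
      rw [abs_div, abs_of_pos hd, one_lt_div hd, lt_abs]
      by_contra h
      push Not at h
      exact hx ⟨by linarith, by linarith⟩
    obtain ⟨h7, h8⟩ := h6 _ this
    set y := Φ ((((2 * x - p - r) / (r - p) : ℝ)) : ℂ)
    have hy : y = (y.re : ℂ) := Complex.ext (by simp) (by simp [h8])
    refine ⟨y.re ^ 2, sq_nonneg _, ?_, ?_⟩
    · rw [hy, Complex.norm_real, Real.norm_eq_abs] at h7
      exact (sq_lt_one_iff_abs_lt_one _).2 h7 |>.le
    · simp only
      rw [hLx]; change y ^ 2 = _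
      conv_lhs => rw [hy]
      push_cast; rfl

lemma arc_fun {D Z : Set ℂ} (hD : IsOpen D) (hDb : Bornology.IsBounded D)
    {e : OpenPartialHomeomorph ℂ ℂ} {a C : ℝ} (he : BChart D Z e a C)
    {q : ℂ → ℂ} (hq : Differentiable ℂ q) (hqZ : ∀ z ∉ Z, q z ≠ 0)
    {p r : ℝ} (hpr : p < r) {U : Set ℂ} (hU : IsOpen U) (hUt : U ⊆ e.target)
    (hpU : ∀ x : ℝ, x ∈ Icc p r → (x : ℂ) ∈ U) {ε : ℝ} (hε : 0 < ε) :
    ∃ ψ : ℂ → ℂ, ContinuousOn ψ (closure D) ∧ DifferentiableOn ℂ ψ D ∧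
      (∀ z ∈ closure D, ‖q z * ψ z‖ ≤ 1 + ε) ∧
      (∀ z ∈ closure D, ¬ (z ∈ e.source ∧ e z ∈ U) → ‖q z * ψ z‖ ≤ ε) ∧
      (∀ x : ℝ, x ∈ Icc p r → 1 - ε ≤ ‖q (e.symm x) * ψ (e.symm x)‖) ∧
      (∀ z ∈ e.source, (e z).im = 0 → (e z).re ∉ Icc p r →
        ∃ τ : ℝ, 0 ≤ τ ∧ τ ≤ 1 ∧ ‖q z * ψ z - τ‖ ≤ ε) := by
  obtain ⟨Ψ, hΨc, hΨd, hΨ1, hΨlt, hΨarc, hΨoff⟩ := model_fun2 hpr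
  have hKc : IsCompact ((fun x : ℝ => (x : ℂ)) '' Icc p r) :=
    isCompact_Icc.image Complex.continuous_ofReal
  obtain ⟨L, χ, hL, hLU, hχ, hχ1, hχ0, hχb⟩ := cutoff_exists hKc hU (by
    rintro _ ⟨x, hx, rfl⟩; exact hpU x hx)
  have hLt : L ⊆ e.target := hLU.trans hUt
  let S : Set ℂ := e.symm '' L
  have hS : IsCompact S := hL.image_of_continuousOn (e.continuousOn_symm.mono hLt)
  have hSsrc : S ⊆ e.source := by
    rintro _ ⟨y, hy, rfl⟩; exact e.map_target (hLt hy)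
  have hχS : ∀ z ∈ e.source, z ∉ S → χ (e z) = 0 := by
    intro z hz hzS
    apply hχ0
    intro h; exact hzS ⟨e z, h, e.left_inv hz⟩
  classical
  let B : ℂ → ℂ := fun z => if z ∈ e.source then (χ (e z) : ℂ) * (q z)⁻¹ else 0
  have hBS : ∀ z ∉ S, B z = 0 := by
    intro z hz
    by_cases h : z ∈ e.source
    · simp [B, h, hχS z h hz]
    · simp [B, h]
  have hcov : ∀ z, z ∈ e.source ∨ z ∈ Sᶜ := by
    intro z
    by_cases h : z ∈ e.source
    · exact Or.inl h
    · exact Or.inr fun h' => h (hSsrc h')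
  have hqR : ContDiff ℝ 1 q := (hq.contDiff (n := 1)).restrict_scalars ℝ
  have hBC : ContDiff ℝ 1 B := by
    rw [contDiff_iff_contDiffAt]
    intro z
    rcases hcov z with h | h
    · have h1 : ContDiffAt ℝ 1 (fun z => (χ (e z) : ℂ) * (q z)⁻¹) z := by
        have h2 : ContDiffAt ℝ 1 e z := he.smooth.contDiffAt (e.open_source.mem_nhds h)
        have h3 : ContDiffAt ℝ 1 (fun z => (χ (e z) : ℂ)) z :=
          Complex.ofRealCLM.contDiff.contDiffAt.comp z (hχ.contDiffAt.comp z h2)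
        exact h3.mul (hqR.contDiffAt.inv (hqZ z (he.disj z h)))
      refine h1.congr_of_eventuallyEq ?_
      filter_upwards [e.open_source.mem_nhds h] with w hw
      simp [B, hw]
    · have h1 : ContDiffAt ℝ 1 (fun _ => (0:ℂ)) z := contDiffAt_const
      refine h1.congr_of_eventuallyEq ?_
      filter_upwards [hS.isClosed.isOpen_compl.mem_nhds h] with w hw
      exact hBS w hw
  have hBsupp : HasCompactSupport B := HasCompactSupport.intro hS hBS
  have hBb : ∃ M, ∀ z, ‖B z‖ ≤ M := by
    obtain ⟨M, hM⟩ := hBsupp.exists_bound_of_continuous hBC.continuous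
    exact ⟨M, hM⟩
  have hdBb : ∃ M, ∀ z, ‖dbar B z‖ ≤ M := by
    have hc : Continuous (dbar B) := dbar_cont hBC
    have hs : HasCompactSupport (dbar B) := by
      refine HasCompactSupport.intro hS fun z hz => ?_
      have : B =ᶠ[nhds z] fun _ => 0 := by
        filter_upwards [hS.isClosed.isOpen_compl.mem_nhds hz] with w hw
        exact hBS w hw
      unfold dbar
      rw [this.fderiv_eq]; simp
    exact hs.exists_bound_of_continuous hc
  obtain ⟨MB, hMB⟩ := hBb
  obtain ⟨MD, hMD⟩ := hdBb
  have hMB0 : 0 ≤ MB := (norm_nonneg _).trans (hMB 0)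
  have hMD0 : 0 ≤ MD := (norm_nonneg _).trans (hMD 0)
  have hopen : IsOpen {z : ℂ | 0 < z.im} := isOpen_lt continuous_const Complex.continuous_im
  let u : ℕ → ℂ → ℂ := fun n z => B z * Ψ (e z) ^ n
  have hu0 : ∀ n, ∀ z ∉ S, u n z = 0 := fun n z hz => by simp [u, hBS z hz]
  have hclim : ∀ z ∈ closure D, z ∈ e.source → 0 ≤ (e z).im := by
    intro z hz hzs
    by_cases h : z ∈ D
    · exact ((he.memD z hzs).1 h).le
    · have : z ∈ frontier D := ⟨hz, by rwa [hD.interior_eq]⟩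
      exact ((he.memF z hzs).1 this).ge
  have huc : ∀ n, ContinuousOn (u n) (closure D) := by
    intro n z hz
    rcases hcov z with h | h
    · have h1 : ContinuousWithinAt Ψ {z | 0 ≤ z.im} (e z) := hΨc _ (hclim z hz h)
      have h2 : ContinuousWithinAt e (closure D ∩ e.source) z := (e.continuousAt h).continuousWithinAt
      have h3 : ContinuousWithinAt (fun z => Ψ (e z)) (closure D ∩ e.source) z :=
        h1.comp h2 fun w hw => hclim w hw.1 hw.2
      have h4 : ContinuousWithinAt (u n) (closure D ∩ e.source) z :=
        hBC.continuous.continuousWithinAt.mul (h3.pow n)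
      exact (continuousWithinAt_inter (e.open_source.mem_nhds h)).1 h4
    · have h1 : ContinuousAt (fun _ : ℂ => (0:ℂ)) z := continuousAt_const
      refine (h1.congr ?_).continuousWithinAt
      filter_upwards [hS.isClosed.isOpen_compl.mem_nhds h] with w hw
      exact (hu0 n w hw).symm
  -- the composite `Ψ ^ n ∘ e`
  have hH : ∀ n, ∀ z ∈ e.source, z ∈ D →
      HasDerivAt (fun ζ => Ψ ζ ^ n) (deriv (fun ζ => Ψ ζ ^ n) (e z)) (e z) := by
    intro n z hz hzD
    have := (hΨd.pow n).differentiableAt (hopen.mem_nhds ((he.memD z hz).1 hzD))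
    exact this.hasDerivAt
  have hHC : ∀ n, ∀ z ∈ e.source, z ∈ D → ContDiffAt ℝ 1 (fun z => Ψ (e z) ^ n) z := by
    intro n z hz hzD
    have h1 : ContDiffAt ℂ 1 Ψ (e z) :=
      (hΨd.contDiffOn hopen).contDiffAt (hopen.mem_nhds ((he.memD z hz).1 hzD))
    have h2 : ContDiffAt ℝ 1 e z := he.smooth.contDiffAt (e.open_source.mem_nhds hz)
    exact ((h1.restrict_scalars ℝ).comp z h2).pow n
  have huC : ∀ n, ContDiffOn ℝ 1 (u n) D := by
    intro n z hz
    apply ContDiffAt.contDiffWithinAt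
    rcases hcov z with h | h
    · exact hBC.contDiffAt.mul (hHC n z h hz)
    · have h1 : ContDiffAt ℝ 1 (fun _ => (0:ℂ)) z := contDiffAt_const
      refine h1.congr_of_eventuallyEq ?_
      filter_upwards [hS.isClosed.isOpen_compl.mem_nhds h] with w hw
      exact hu0 n w hw
  have hdb0 : ∀ n, ∀ z ∉ S, dbar (u n) z = 0 := by
    intro n z hz
    have : u n =ᶠ[nhds z] fun _ => 0 := by
      filter_upwards [hS.isClosed.isOpen_compl.mem_nhds hz] with w hw
      exact hu0 n w hw
    unfold dbar
    rw [this.fderiv_eq]; simp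
  have hdb : ∀ n, ∀ z ∈ e.source, z ∈ D → dbar (u n) z =
      dbar B z * Ψ (e z) ^ n + B z * (deriv (fun ζ => Ψ ζ ^ n) (e z) * dbar e z) := by
    intro n z hz hzD
    have h1 : HasFDerivAt B (fderiv ℝ B z) z := (hBC.differentiable (by norm_num) z).hasFDerivAt
    have h2 : HasFDerivAt e (fderiv ℝ e z) z :=
      ((he.smooth.contDiffAt (e.open_source.mem_nhds hz)).differentiableAt (by norm_num)).hasFDerivAt
    have h3 := ((hH n z hz hzD).hasFDerivAt.restrictScalars ℝ).comp z h2
    have h4 := h1.mul h3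
    have h5 : fderiv ℝ (u n) z = _ := h4.fderiv
    unfold dbar
    rw [h5]
    simp
    ring
  have hder : ∀ n, ∀ ζ : ℂ, 0 < ζ.im → ‖deriv (fun ζ => Ψ ζ ^ n) ζ‖ ≤ 2 / ζ.im := by
    intro n ζ hζ
    have hsub : closedBall ζ (ζ.im / 2) ⊆ {z | 0 < z.im} := by
      intro w hw
      have h1 : |(w - ζ).im| ≤ ζ.im / 2 := (Complex.abs_im_le_norm _).trans (by simpa [dist_eq_norm] using hw)
      have h2 := (abs_le.1 h1).1
      simp at h2
      simp only [mem_setOf_eq]; linarith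
    have h1 : DiffContOnCl ℂ (fun ζ => Ψ ζ ^ n) (ball ζ (ζ.im / 2)) := by
      apply DifferentiableOn.diffContOnCl_ball (U := {z | 0 < z.im}) (hΨd.pow n) hsub
    have h2 := Complex.norm_deriv_le_of_forall_mem_sphere_norm_le (C := 1) (by linarith : 0 < ζ.im / 2) h1 (by
      intro w hw
      rw [norm_pow]
      exact pow_le_one₀ (norm_nonneg _) (hΨ1 w (hsub (sphere_subset_closedBall hw)).le))
    refine h2.trans (le_of_eq ?_)
    field_simp
  have hbound : ∀ n, ∀ z ∈ D, ‖dbar (u n) z‖ ≤ MD + MB * (2 * C) := by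
    intro n z hz
    have hC := he.cpos
    rcases hcov z with h | h
    · have him := (he.memD z h).1 hz
      rw [hdb n z h hz]
      refine (norm_add_le _ _).trans (add_le_add ?_ ?_)
      · rw [norm_mul, norm_pow]
        exact (mul_le_of_le_one_right (norm_nonneg _) (pow_le_one₀ (norm_nonneg _) (hΨ1 _ him.le))).trans (hMD z)
      · rw [norm_mul, norm_mul]
        refine mul_le_mul (hMB z) ?_ (by positivity) hMB0
        calc _ ≤ 2 / (e z).im * (C * (e z).im) :=
              mul_le_mul (hder n _ him) (he.dbar_le z h hz) (norm_nonneg _) (by positivity)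
          _ = 2 * C := by field_simp
    · rw [hdb0 n z h]; simp; positivity
  have hlim : ∀ z ∈ D, Tendsto (fun n => dbar (u n) z) atTop (nhds 0) := by
    intro z hz
    rcases hcov z with h | h
    · have him := (he.memD z h).1 hz
      have hlt := hΨlt _ him
      have h0 : Tendsto (fun n => Ψ (e z) ^ n) atTop (nhds 0) := tendsto_pow_atTop_nhds_zero_of_norm_lt_one hlt
      have h1 : Tendsto (fun n => deriv (fun ζ => Ψ ζ ^ n) (e z)) atTop (nhds 0) := by
        have hd := (hΨd.differentiableAt (hopen.mem_nhds him)).hasDerivAt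
        have h2 : ∀ n : ℕ, deriv (fun ζ => Ψ ζ ^ n) (e z) = (n * Ψ (e z) ^ (n - 1)) * deriv Ψ (e z) := fun n =>
          (hd.pow n).deriv
        simp only [h2]
        rw [← zero_mul (deriv Ψ (e z))]
        refine Tendsto.mul_const _ ?_
        rw [← tendsto_add_atTop_iff_nat 1]
        have h3 := tendsto_self_mul_const_pow_of_lt_one (norm_nonneg _) hlt
        have h4 : Tendsto (fun n : ℕ => (n : ℂ) * Ψ (e z) ^ n) atTop (nhds 0) := by
          rw [tendsto_zero_iff_norm_tendsto_zero]
          simpa using h3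
        have h5 := h4.add h0
        rw [add_zero] at h5
        refine h5.congr fun n => ?_
        rw [Nat.add_sub_cancel]; push_cast; ring
      have h2 := (h0.const_mul (dbar B z)).add ((h1.mul_const (dbar e z)).const_mul (B z))
      simp only [mul_zero, zero_mul, add_zero] at h2
      exact h2.congr fun n => (hdb n z h hz).symm
    · simp only [hdb0 _ z h]; exact tendsto_const_nhds
  obtain ⟨w, hwc, hwd, hws⟩ := dbar_solve hD hDb huC hbound hlim
  have hcl : IsCompact (closure D) := hDb.isCompact_closure
  obtain ⟨Q, hQ⟩ := hcl.exists_bound_of_continuousOn (f := q) hq.continuous.continuousOn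
  have hQ' : ∀ z ∈ closure D, ‖q z‖ ≤ |Q| + 1 := fun z hz =>
    (hQ z hz).trans ((le_abs_self Q).trans (by linarith))
  have hQp : 0 < |Q| + 1 := by positivity
  obtain ⟨n, hn⟩ := (hws (ε / (|Q| + 1)) (by positivity)).exists
  have hqw : ∀ z ∈ closure D, ‖q z * w n z‖ ≤ ε := by
    intro z hz
    rw [norm_mul]
    calc _ ≤ (|Q| + 1) * (ε / (|Q| + 1)) :=
          mul_le_mul (hQ' z hz) (hn z) (norm_nonneg _) hQp.le
      _ = ε := by field_simp
  have hqu : ∀ z ∈ e.source, q z * u n z = (χ (e z) : ℂ) * Ψ (e z) ^ n := by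
    intro z hz
    have := hqZ z (he.disj z hz)
    simp only [u, B, if_pos hz]
    field_simp
  have hnχ : ∀ ζ, ‖(χ ζ : ℂ)‖ = χ ζ := fun ζ => by
    rw [Complex.norm_real, Real.norm_eq_abs, abs_of_nonneg (hχb ζ).1]
  have hsplit : ∀ z, q z * (u n z - w n z) = q z * u n z - q z * w n z := fun z => by ring
  refine ⟨fun z => u n z - w n z, (huc n).sub (hwc n).continuousOn, hwd n, ?_, ?_, ?_, ?_⟩
  · intro z hz
    simp only [hsplit]
    refine (norm_sub_le _ _).trans (add_le_add ?_ (hqw z hz))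
    rcases hcov z with h | h
    · rw [hqu z h, norm_mul, hnχ, norm_pow]
      exact mul_le_one₀ (hχb _).2 (by positivity) (pow_le_one₀ (norm_nonneg _) (hΨ1 _ (hclim z hz h)))
    · rw [hu0 n z h]; simp
  · intro z hz hzU
    have : u n z = 0 := by
      apply hu0
      intro hzS
      apply hzU
      obtain ⟨y, hy, rfl⟩ := hzS
      refine ⟨e.map_target (hLt hy), ?_⟩
      rw [e.right_inv (hLt hy)]; exact hLU hy
    simp only [hsplit]
    rw [this, mul_zero, zero_sub, norm_neg]
    exact hqw z hz
  · intro x hx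
    have hxt := hUt (hpU x hx)
    have hxs := e.map_target hxt
    have hxe := e.right_inv hxt
    have hfr : e.symm x ∈ closure D := by
      have := (he.memF _ hxs).2 (by rw [hxe]; simp)
      exact this.1
    simp only [hsplit]
    have h1 := hqu _ hxs
    rw [hxe, hχ1 x ⟨x, hx, rfl⟩, Complex.ofReal_one, one_mul] at h1
    have h2 : ‖q (e.symm x) * u n (e.symm x)‖ = 1 := by
      rw [h1, norm_pow, hΨarc x hx, one_pow]
    have h3 := norm_sub_norm_le (q (e.symm x) * u n (e.symm x)) (q (e.symm x) * w n (e.symm x))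
    have h4 := hqw _ hfr
    linarith
  · intro z hz him hre
    have hfr : z ∈ closure D := ((he.memF _ hz).2 him).1
    have hez : e z = ((e z).re : ℂ) := Complex.ext (by simp) (by simp [him])
    obtain ⟨τ, h0, h1, hτ⟩ := hΨoff _ hre
    rw [← hez] at hτ
    refine ⟨χ (e z) * τ ^ n, mul_nonneg (hχb _).1 (pow_nonneg h0 n), mul_le_one₀ (hχb _).2 (by positivity) (pow_le_one₀ h0 h1), ?_⟩
    simp only [hsplit]
    rw [hqu z hz, hτ]
    push_cast
    rw [sub_sub_cancel_left, norm_neg]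
    exact hqw z hfr

end

section

lemma multi_arc {D Z : Set ℂ} (hD : IsOpen D) (hDb : Bornology.IsBounded D)
    {e : OpenPartialHomeomorph ℂ ℂ} {a C : ℝ} (he : BChart D Z e a C)
    {q : ℂ → ℂ} (hq : Differentiable ℂ q) (hqZ : ∀ z ∉ Z, q z ≠ 0)
    {ι : Type*} (t : Finset ι) (p r : ι → ℝ) (U : ι → Set ℂ) (ω : ι → ℂ)
    (hpr : ∀ i ∈ t, p i < r i) (hU : ∀ i ∈ t, IsOpen (U i)) (hUt : ∀ i ∈ t, U i ⊆ e.target)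
    (hω : ∀ i ∈ t, ‖ω i‖ = 1)
    (hdis : ∀ i ∈ t, ∀ j ∈ t, i ≠ j → Disjoint (U i) (U j))
    (hpU : ∀ i ∈ t, ∀ x : ℝ, x ∈ Icc (p i) (r i) → (x : ℂ) ∈ U i) {ε : ℝ} (hε : 0 < ε) :
    ∃ ψ : ℂ → ℂ, ContinuousOn ψ (closure D) ∧ DifferentiableOn ℂ ψ D ∧
      (∀ z ∈ closure D, ‖q z * ψ z‖ ≤ 1 + ε) ∧
      (∀ z ∈ closure D, (∀ i ∈ t, ¬ (z ∈ e.source ∧ e z ∈ U i)) → ‖q z * ψ z‖ ≤ ε) ∧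
      (∀ i ∈ t, ∀ x : ℝ, x ∈ Icc (p i) (r i) → 1 - ε ≤ ‖q (e.symm x) * ψ (e.symm x)‖) ∧
      (∀ i ∈ t, ∀ z ∈ e.source, e z ∈ U i → (e z).im = 0 → (e z).re ∉ Icc (p i) (r i) →
        ∃ τ : ℝ, 0 ≤ τ ∧ τ ≤ 1 ∧ ‖q z * ψ z - τ * ω i‖ ≤ ε) := by
  classical
  induction t using Finset.induction_on generalizing ε with
  | empty =>
    refine ⟨fun _ => 0, continuousOn_const, differentiableOn_const _, ?_, ?_, ?_, ?_⟩
    · intro z _; simp; linarith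
    · intro z _ _; simp; linarith
    · intro i hi; simp at hi
    · intro i hi; simp at hi
  | insert i t hit ih =>
    have hε2 : 0 < ε / 2 := by linarith
    obtain ⟨ψ, h1, h2, h3, h4, h5, h6⟩ := ih (fun j hj => hpr j (Finset.mem_insert_of_mem hj))
      (fun j hj => hU j (Finset.mem_insert_of_mem hj)) (fun j hj => hUt j (Finset.mem_insert_of_mem hj))
      (fun j hj => hω j (Finset.mem_insert_of_mem hj))
      (fun j hj k hk => hdis j (Finset.mem_insert_of_mem hj) k (Finset.mem_insert_of_mem hk))
      (fun j hj => hpU j (Finset.mem_insert_of_mem hj)) hε2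
    have hi := Finset.mem_insert_self i t
    obtain ⟨ψ', k1, k2, k3, k4, k5, k6⟩ := arc_fun hD hDb he hq hqZ (hpr i hi) (hU i hi) (hUt i hi)
      (hpU i hi) hε2
    have hw := hω i hi
    have hsplit : ∀ z, q z * (ψ z + ω i * ψ' z) = q z * ψ z + ω i * (q z * ψ' z) := fun z => by ring
    have hnω : ∀ y, ‖ω i * y‖ = ‖y‖ := fun y => by rw [norm_mul, hw, one_mul]
    have hfr : ∀ z ∈ e.source, (e z).im = 0 → z ∈ closure D := fun z hz him => ((he.memF _ hz).2 him).1
    have hin : ∀ z, e z ∈ U i → ∀ j ∈ t, ¬ (z ∈ e.source ∧ e z ∈ U j) := by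
      intro z hz j hj h
      have hne : i ≠ j := fun h => hit (h ▸ hj)
      exact (hdis i hi j (Finset.mem_insert_of_mem hj) hne).le_bot ⟨hz, h.2⟩
    have hnot : ∀ z, ∀ j ∈ t, e z ∈ U j → ¬ (z ∈ e.source ∧ e z ∈ U i) := by
      intro z j hj hz h
      have hne : i ≠ j := fun h => hit (h ▸ hj)
      exact (hdis i hi j (Finset.mem_insert_of_mem hj) hne).le_bot ⟨h.2, hz⟩
    refine ⟨fun z => ψ z + ω i * ψ' z, h1.add (continuousOn_const.mul k1), h2.add (k2.const_mul _), ?_, ?_, ?_, ?_⟩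
    · intro z hz
      simp only [hsplit]
      refine (norm_add_le _ _).trans ?_
      rw [hnω]
      by_cases h : z ∈ e.source ∧ e z ∈ U i
      · have := h4 z hz (hin z h.2)
        linarith [k3 z hz]
      · have := k4 z hz h
        linarith [h3 z hz]
    · intro z hz h
      simp only [hsplit]
      refine (norm_add_le _ _).trans ?_
      rw [hnω]
      have := k4 z hz (h i hi)
      linarith [h4 z hz (fun j hj => h j (Finset.mem_insert_of_mem hj))]
    · intro j hj x hx
      have hxU := hpU j hj x hx
      have hxt := hUt j hj hxU
      have hxe := e.right_inv hxt
      have hxs := e.map_target hxt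
      have hcl := hfr _ hxs (by rw [hxe]; simp)
      simp only [hsplit]
      rcases Finset.mem_insert.1 hj with rfl | hj'
      · have a1 := h4 _ hcl (hin _ (by rw [hxe]; exact hxU))
        have a2 := k5 x hx
        have a3 := norm_sub_norm_le (ω j * (q (e.symm x) * ψ' (e.symm x))) (-(q (e.symm x) * ψ (e.symm x)))
        rw [hnω, norm_neg, sub_neg_eq_add, add_comm] at a3
        rw [add_comm]
        rw [add_comm] at a3
        linarith
      · have a1 := k4 _ hcl (hnot _ j hj' (by rw [hxe]; exact hxU))
        have a2 := h5 j hj' x hx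
        have a3 := norm_sub_norm_le (q (e.symm x) * ψ (e.symm x)) (-(ω i * (q (e.symm x) * ψ' (e.symm x))))
        rw [norm_neg, hnω, sub_neg_eq_add] at a3
        linarith
    · intro j hj z hz hzU him hre
      have hcl := hfr _ hz him
      simp only [hsplit]
      rcases Finset.mem_insert.1 hj with rfl | hj'
      · have a1 := h4 _ hcl (hin _ hzU)
        obtain ⟨τ, t0, t1, hτ⟩ := k6 z hz him hre
        refine ⟨τ, t0, t1, ?_⟩
        have : q z * ψ z + ω j * (q z * ψ' z) - τ * ω j = q z * ψ z + ω j * (q z * ψ' z - τ) := by ring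
        rw [this]
        refine (norm_add_le _ _).trans ?_
        rw [hnω]; linarith
      · have a1 := k4 _ hcl (hnot _ j hj' hzU)
        obtain ⟨τ, t0, t1, hτ⟩ := h6 j hj' z hz hzU him hre
        refine ⟨τ, t0, t1, ?_⟩
        have : q z * ψ z + ω i * (q z * ψ' z) - τ * ω j = (q z * ψ z - τ * ω j) + ω i * (q z * ψ' z) := by ring
        rw [this]
        refine (norm_add_le _ _).trans ?_
        rw [hnω]; linarith

lemma unif_nbhd {N : ℕ} {X K : Set (Cn N)} (hX : IsOpen X) {ρ : Cn N → ℝ} (hρ : ContinuousOn ρ X)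
    (hK : IsCompact K) (hKX : K ⊆ X) {ε : ℝ} (hε : 0 < ε) :
    ∃ η > 0, ∀ x ∈ K, ∀ y, ‖y - x‖ ≤ η → y ∈ X ∧ |ρ y - ρ x| ≤ ε := by
  by_contra hcon
  push Not at hcon
  have h1 : ∀ n : ℕ, ∃ x ∈ K, ∃ y, ‖y - x‖ ≤ 1 / ((n:ℝ) + 1) ∧ (y ∈ X → ε < |ρ y - ρ x|) :=
    fun n => hcon _ (by positivity)
  choose x hx y hy hbad using h1
  obtain ⟨x0, hx0, φ, hφ, hlim⟩ := hK.tendsto_subseq hx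
  have hyl : Tendsto (y ∘ φ) atTop (nhds x0) := by
    have h2 : Tendsto (fun n => y (φ n) - x (φ n)) atTop (nhds 0) := by
      apply squeeze_zero_norm (fun n => hy (φ n))
      exact tendsto_one_div_add_atTop_nhds_zero_nat.comp hφ.tendsto_atTop
    have := hlim.add h2
    rw [add_zero] at this
    exact this.congr fun n => by simp
  have hc := (hρ x0 (hKX hx0)).continuousAt (hX.mem_nhds (hKX hx0))
  have h3 : Tendsto (fun n => |ρ (y (φ n)) - ρ (x (φ n))|) atTop (nhds 0) := by
    have := ((hc.tendsto.comp hyl).sub (hc.tendsto.comp hlim)).abs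
    simpa using this
  obtain ⟨n, hn1, hn2⟩ := ((h3.eventually (gt_mem_nhds hε)).and (hyl.eventually (hX.mem_nhds (hKX hx0)))).exists
  exact absurd (hbad _ hn2) (not_lt.2 hn1.le)

lemma arcs_cover {C O : Set ℝ} (hC : IsCompact C) (hO : IsOpen O) (hCO : C ⊆ O) :
    ∃ t : Finset (Set ℝ), ∃ p r : Set ℝ → ℝ, (∀ i ∈ t, p i < r i) ∧ (∀ i ∈ t, Icc (p i) (r i) ⊆ O) ∧
      (∀ i ∈ t, ∀ j ∈ t, i ≠ j → Disjoint (Icc (p i) (r i)) (Icc (p j) (r j))) ∧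
      ∀ x ∈ C, ∃ i ∈ t, x ∈ Icc (p i) (r i) := by
  classical
  have hopen : ∀ x, IsOpen (connectedComponentIn O x) := fun x => hO.connectedComponentIn
  have hself : ∀ x ∈ O, x ∈ connectedComponentIn O x := fun x hx => mem_connectedComponentIn hx
  have hcomp : ∀ x ∈ C, ∃ p r : ℝ, p < r ∧ Icc p r ⊆ connectedComponentIn O x ∧
      C ∩ connectedComponentIn O x ⊆ Icc p r := by
    intro x hx
    set U := connectedComponentIn O x with hU
    have hcpt : IsCompact (C ∩ U) := by
      have : C ∩ U = C \ ⋃ y ∈ {y | y ∈ O ∧ y ∉ U}, connectedComponentIn O y := by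
        ext w
        constructor
        · rintro ⟨hw, hwU⟩
          refine ⟨hw, fun h => ?_⟩
          obtain ⟨y, ⟨hyO, hyU⟩, hwy⟩ := by simpa only [mem_iUnion, exists_prop] using h
          apply hyU
          have e1 : connectedComponentIn O x = connectedComponentIn O w := connectedComponentIn_eq hwU
          have e2 : connectedComponentIn O y = connectedComponentIn O w := connectedComponentIn_eq hwy
          rw [hU, e1, ← e2]; exact hself y hyO
        · rintro ⟨hw, h⟩
          refine ⟨hw, ?_⟩
          by_contra hwU
          apply h
          simp only [mem_iUnion, exists_prop]
          exact ⟨w, ⟨hCO hw, hwU⟩, hself w (hCO hw)⟩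
      rw [this]
      exact hC.diff (isOpen_biUnion fun y _ => hopen y)
    have hne : (C ∩ U).Nonempty := ⟨x, hx, hself x (hCO hx)⟩
    obtain ⟨p, hp⟩ := hcpt.exists_isLeast hne
    obtain ⟨r, hr⟩ := hcpt.exists_isGreatest hne
    obtain ⟨δ, hδ, hδU⟩ := Metric.isOpen_iff.1 (hopen x) r hr.1.2
    have hord : OrdConnected U := isPreconnected_connectedComponentIn.ordConnected
    have hmem : r + δ / 2 ∈ U := hδU (by simp [abs_of_pos hδ, hδ])
    refine ⟨p, r + δ / 2, by linarith [hp.2 hr.1], hord.out hp.1.2 hmem, ?_⟩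
    intro w hw
    exact ⟨hp.2 hw, by linarith [hr.2 hw]⟩
  choose! p r hpr hsub hcov using hcomp
  obtain ⟨t0, ht0, hcover⟩ := hC.elim_nhds_subcover (fun x => connectedComponentIn O x)
    (fun x hx => (hopen x).mem_nhds (hself x (hCO hx)))
  let rep : Set ℝ → ℝ := fun U => if h : ∃ x ∈ t0, connectedComponentIn O x = U then h.choose else 0
  have hrep : ∀ U ∈ t0.image (connectedComponentIn O), rep U ∈ t0 ∧ connectedComponentIn O (rep U) = U := by
    intro U hU
    have h : ∃ x ∈ t0, connectedComponentIn O x = U := Finset.mem_image.1 hU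
    simp only [rep, dif_pos h]
    exact h.choose_spec
  refine ⟨t0.image (connectedComponentIn O), fun U => p (rep U), fun U => r (rep U), ?_, ?_, ?_, ?_⟩
  · intro U hU; exact hpr _ (ht0 _ (hrep U hU).1)
  · intro U hU
    exact (hsub _ (ht0 _ (hrep U hU).1)).trans (connectedComponentIn_subset _ _)
  · intro U hU V hV hne
    have h1 := hsub _ (ht0 _ (hrep U hU).1)
    have h2 := hsub _ (ht0 _ (hrep V hV).1)
    refine Disjoint.mono h1 h2 ?_
    rw [Set.disjoint_left]
    intro w hw1 hw2
    apply hne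
    rw [← (hrep U hU).2, ← (hrep V hV).2, connectedComponentIn_eq hw1, connectedComponentIn_eq hw2]
  · intro x hx
    obtain ⟨y, hy, hxy⟩ := by simpa only [mem_iUnion, exists_prop] using hcover hx
    have hmem : connectedComponentIn O y ∈ t0.image (connectedComponentIn O) := Finset.mem_image_of_mem _ hy
    refine ⟨_, hmem, ?_⟩
    apply hcov _ (ht0 _ (hrep _ hmem).1)
    rw [(hrep _ hmem).2]
    exact ⟨hx, hxy⟩

end

section

structure Adm {N : ℕ} (X : Set (Cn N)) (D : Set ℂ) (f : ℂ → Cn N) : Prop where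
  cont : ContinuousOn f (closure D)
  hol : DifferentiableOn ℂ f D
  mem : ∀ z ∈ closure D, f z ∈ X

def JetRel {N : ℕ} (D : Set ℂ) (q : ℂ → ℂ) (f g : ℂ → Cn N) : Prop :=
  ∃ S : ℂ → Cn N, DifferentiableOn ℂ S D ∧ ∀ z ∈ D, g z = f z + q z • S z

structure GB {N : ℕ} (X : Set (Cn N)) (ρ : Cn N → ℝ) (x0 v u : Cn N) (c s : ℝ) (A : Cn N → ℂ) :
    Prop where
  cpos : 0 < c
  cle : c ≤ 1
  spos : 0 < s
  Acont : ContinuousOn A (ball x0 s)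
  Ale : ∀ x ∈ ball x0 s, ‖A x‖ ≤ c / 2
  mem : ∀ x ∈ ball x0 s, ∀ μ : ℂ, ‖μ‖ ≤ 2 → x + μ • v + μ ^ 2 • u ∈ X
  gain : ∀ x ∈ ball x0 s, ∀ μ : ℂ, ‖μ‖ ≤ 2 →
    ρ x + (μ * A x).re + c * ‖μ‖ ^ 2 ≤ ρ (x + μ • v + μ ^ 2 • u)

lemma phase_choice (A B : ℂ) : ∃ ω : ℂ, ‖ω‖ = 1 ∧ 0 ≤ (ω * A).re ∧ 0 ≤ (ω * B).re := by
  have key : ∀ A : ℂ, ∃ ω : ℂ, ‖ω‖ = 1 ∧ ω * A = ‖A‖ := by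
    intro A
    by_cases h : A = 0
    · exact ⟨1, by simp, by simp [h]⟩
    · have hA : (‖A‖ : ℂ) ≠ 0 := by simpa using h
      refine ⟨starRingEnd ℂ A / ‖A‖, ?_, ?_⟩
      · rw [norm_div, RCLike.norm_conj]; simp [h]
      · rw [div_mul_eq_mul_div, mul_comm, Complex.mul_conj, Complex.normSq_eq_norm_sq]
        push_cast; field_simp
  obtain ⟨ω, h1, h2⟩ := key A
  by_cases h : 0 ≤ (I * ω * B).re
  · refine ⟨I * ω, by simp [h1], ?_, h⟩
    rw [mul_assoc, h2]; simp
  · refine ⟨-(I * ω), by simp [h1], ?_, ?_⟩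
    · rw [neg_mul, mul_assoc, h2]; simp
    · rw [neg_mul, Complex.neg_re]; push Not at h; linarith

lemma step_arcs {N : ℕ} {X : Set (Cn N)} (hX : IsOpen X) {ρ : Cn N → ℝ} (hρ : ContinuousOn ρ X)
    {D Z : Set ℂ} (hD : IsOpen D) (hDb : Bornology.IsBounded D)
    {e : OpenPartialHomeomorph ℂ ℂ} {a C : ℝ} (he : BChart D Z e a C)
    {q : ℂ → ℂ} (hq : Differentiable ℂ q) (hqZ : ∀ z ∉ Z, q z ≠ 0)
    {x0 v u : Cn N} {c s : ℝ} {A : Cn N → ℂ} (hG : GB X ρ x0 v u c s A)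
    {f : ℂ → Cn N} (hf : Adm X D f)
    {ι : Type*} (t : Finset ι) (p r : ι → ℝ) (hpr : ∀ i ∈ t, p i < r i)
    (hIa : ∀ i ∈ t, ∀ x ∈ Icc (p i) (r i), |x| < a)
    (hIf : ∀ i ∈ t, ∀ x ∈ Icc (p i) (r i), f (e.symm (x : ℂ)) ∈ ball x0 s)
    (hdis : ∀ i ∈ t, ∀ j ∈ t, i ≠ j → Disjoint (Icc (p i) (r i)) (Icc (p j) (r j)))
    {K : Set ℂ} (hK : IsCompact K) (hKD : K ⊆ D) {m : ℝ} (hm : ∀ z ∈ frontier D, m ≤ ρ (f z))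
    {ε : ℝ} (hε : 0 < ε) :
    ∃ g : ℂ → Cn N, Adm X D g ∧ JetRel D q f g ∧ (∀ z ∈ K, ‖g z - f z‖ ≤ ε) ∧
      (∀ z ∈ closure D, min (ρ (f z)) (m - 1) - ε ≤ ρ (g z)) ∧
      (∀ z ∈ frontier D, ρ (f z) + c / (4 * (‖v‖ + 2 * ‖u‖ + 1) ^ 2) * ‖g z - f z‖ ^ 2 - ε ≤ ρ (g z)) ∧
      (∀ i ∈ t, ∀ x ∈ Icc (p i) (r i), ρ (f (e.symm (x : ℂ))) + c / 8 ≤ ρ (g (e.symm (x : ℂ)))) := by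
  classical
  have hcl : IsCompact (closure D) := hDb.isCompact_closure
  have hc := hG.cpos
  have hc1 := hG.cle
  have hfrcl : frontier D ⊆ closure D := frontier_subset_closure
  have hρf : ContinuousOn (fun z => ρ (f z)) (closure D) := hρ.comp hf.cont hf.mem
  let K2 : Set ℂ := {z ∈ closure D | ρ (f z) ≤ m - 1 / 2}
  have hK2c : IsClosed K2 := hρf.preimage_isClosed_of_isClosed isClosed_closure isClosed_Iic
  let KK : Set ℂ := K ∪ K2
  have hKKc : IsClosed KK := hK.isClosed.union hK2c
  have hKKf : ∀ z ∈ frontier D, z ∉ KK := by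
    rintro z hz (h | h)
    · have := hKD h
      rw [hD.frontier_eq] at hz
      exact hz.2 this
    · have h1 := hm z hz
      have h2 := h.2
      linarith
  let F : ℂ → Cn N := fun ζ => f (e.symm ζ)
  have hsc : ∀ ζ ∈ e.target, 0 ≤ ζ.im → e.symm ζ ∈ closure D := by
    intro ζ hζ him
    have h1 := e.map_target hζ
    have h2 := e.right_inv hζ
    rcases him.lt_or_eq with h | h
    · exact subset_closure ((he.memD _ h1).2 (by rw [h2]; exact h))
    · exact hfrcl ((he.memF _ h1).2 (by rw [h2]; exact h.symm))
  have hxt : ∀ x : ℝ, |x| < a → (x : ℂ) ∈ e.target := fun x hx => he.tgt (by simpa using hx)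
  have hxf : ∀ x : ℝ, |x| < a → e.symm (x : ℂ) ∈ frontier D := fun x hx =>
    (he.memF _ (e.map_target (hxt x hx))).2 (by rw [e.right_inv (hxt x hx)]; simp)
  have hFc : ∀ x : ℝ, |x| < a → ContinuousWithinAt F {ζ | 0 ≤ ζ.im} (x : ℂ) := by
    intro x hx
    have h1 : ContinuousWithinAt f (closure D) (e.symm (x : ℂ)) := hf.cont _ (hfrcl (hxf x hx))
    have h2 : ContinuousWithinAt e.symm ({ζ : ℂ | 0 ≤ ζ.im} ∩ e.target) (x : ℂ) :=
      (e.symm.continuousAt (hxt x hx)).continuousWithinAt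
    have h3 : ContinuousWithinAt F ({ζ : ℂ | 0 ≤ ζ.im} ∩ e.target) (x : ℂ) :=
      h1.comp h2 fun w hw => hsc w hw.2 hw.1
    exact (continuousWithinAt_inter (e.open_target.mem_nhds (hxt x hx))).1 h3
  -- phases
  have hph : ∀ i, ∃ ω : ℂ, ‖ω‖ = 1 ∧ 0 ≤ (ω * A (F (p i : ℂ))).re ∧ 0 ≤ (ω * A (F (r i : ℂ))).re :=
    fun i => phase_choice _ _
  choose ω hω1 hωp hωr using hph
  -- neighbourhoods
  let R : ι → Set ℂ := fun i => (fun x : ℝ => (x : ℂ)) '' Icc (p i) (r i)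
  have hRc : ∀ i, IsClosed (R i) := fun i => (isCompact_Icc.image Complex.continuous_ofReal).isClosed
  have hRne : ∀ i ∈ t, (R i).Nonempty := fun i hi => ⟨_, p i, ⟨le_rfl, (hpr i hi).le⟩, rfl⟩
  have hB : 0 < ‖v‖ + 2 * ‖u‖ + 1 := by positivity
  set B := ‖v‖ + 2 * ‖u‖ + 1 with hBdef
  have hB1 : 1 ≤ B := by have := norm_nonneg v; have := norm_nonneg u; linarith
  let Q : ι → ℂ → Prop := fun i ζ => ζ ∈ e.target ∧ (0 ≤ ζ.im → F ζ ∈ ball x0 s) ∧ e.symm ζ ∉ KK ∧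
    (∀ j ∈ t, j ≠ i → infDist ζ (R i) < infDist ζ (R j)) ∧
    (ζ.im = 0 → ζ.re ∉ Icc (p i) (r i) → -(ε / 4) ≤ (ω i * A (F ζ)).re)
  let U : ι → Set ℂ := fun i => interior {ζ | Q i ζ}
  have hUQ : ∀ i ζ, ζ ∈ U i → Q i ζ := fun i ζ h => by
    have h' : ζ ∈ {ζ | Q i ζ} := interior_subset h
    exact h'
  have hpU : ∀ i ∈ t, ∀ x : ℝ, x ∈ Icc (p i) (r i) → (x : ℂ) ∈ U i := by
    intro i hi x hx
    have hxa := hIa i hi x hx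
    rw [mem_interior_iff_mem_nhds]
    have e1 : ∀ᶠ ζ in nhds (x : ℂ), ζ ∈ e.target := e.open_target.mem_nhds (hxt x hxa)
    have e2 : ∀ᶠ ζ in nhds (x : ℂ), 0 ≤ ζ.im → F ζ ∈ ball x0 s := by
      have := (hFc x hxa).tendsto (isOpen_ball.mem_nhds (hIf i hi x hx))
      exact eventually_nhdsWithin_iff.1 this
    have e3 : ∀ᶠ ζ in nhds (x : ℂ), e.symm ζ ∉ KK :=
      (e.symm.continuousAt (hxt x hxa)) (hKKc.isOpen_compl.mem_nhds (hKKf _ (hxf x hxa)))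
    have e4 : ∀ᶠ ζ in nhds (x : ℂ), ∀ j ∈ t, j ≠ i → infDist ζ (R i) < infDist ζ (R j) := by
      rw [Finset.eventually_all]
      intro j hj
      by_cases hji : j = i
      · simp [hji]
      have h0 : infDist (x : ℂ) (R i) = 0 := infDist_zero_of_mem ⟨x, hx, rfl⟩
      have h1 : 0 < infDist (x : ℂ) (R j) := by
        rw [← (hRc j).notMem_iff_infDist_pos (hRne j hj)]
        rintro ⟨y, hy, hyx⟩
        have : y = x := Complex.ofReal_injective hyx
        subst this
        exact (hdis j hj i hi hji).le_bot ⟨hy, hx⟩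
      have h2 : ∀ᶠ ζ in nhds (x : ℂ), infDist ζ (R i) < infDist ζ (R j) :=
        (continuous_infDist_pt (R i)).continuousAt.eventually_lt (continuous_infDist_pt (R j)).continuousAt
          (by rw [h0]; exact h1)
      filter_upwards [h2] with ζ h _ using h
    have hend : 0 ≤ (ω i * A (F (x : ℂ))).re →
        ∀ᶠ ζ in nhds (x : ℂ), ζ.im = 0 → -(ε / 4) ≤ (ω i * A (F ζ)).re := by
      intro h0
      have h1 : ContinuousAt A (F x) :=
        (hG.Acont _ (hIf i hi x hx)).continuousAt (isOpen_ball.mem_nhds (hIf i hi x hx))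
      have h2 : ContinuousWithinAt (fun ζ => (ω i * A (F ζ)).re) {ζ | 0 ≤ ζ.im} (x : ℂ) :=
        Complex.continuous_re.continuousAt.comp_continuousWithinAt
          (continuousWithinAt_const.mul (h1.comp_continuousWithinAt (hFc x hxa)))
      have h3 := h2.tendsto.eventually (lt_mem_nhds (by linarith : -(ε / 4) < (ω i * A (F (x : ℂ))).re))
      filter_upwards [eventually_nhdsWithin_iff.1 h3] with ζ h hζ
      exact (h (by simp [hζ])).le
    have e5 : ∀ᶠ ζ in nhds (x : ℂ), ζ.im = 0 → ζ.re ∉ Icc (p i) (r i) → -(ε / 4) ≤ (ω i * A (F ζ)).re := by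
      by_cases hxp : x = p i
      · filter_upwards [hend (by rw [hxp]; exact hωp i)] with ζ h h1 _ using h h1
      by_cases hxr : x = r i
      · filter_upwards [hend (by rw [hxr]; exact hωr i)] with ζ h h1 _ using h h1
      have h1 : Ioo (p i) (r i) ∈ nhds (x : ℂ).re := by
        rw [Complex.ofReal_re]
        exact Ioo_mem_nhds (lt_of_le_of_ne hx.1 (Ne.symm hxp)) (lt_of_le_of_ne hx.2 hxr)
      filter_upwards [Complex.continuous_re.continuousAt h1] with ζ h _ h2
      exact absurd (Ioo_subset_Icc_self h) h2
    filter_upwards [e1, e2, e3, e4, e5] with ζ h1 h2 h3 h4 h5 using ⟨h1, h2, h3, h4, h5⟩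
  have hUdis : ∀ i ∈ t, ∀ j ∈ t, i ≠ j → Disjoint (U i) (U j) := by
    intro i hi j hj hij
    rw [Set.disjoint_left]
    intro ζ h1 h2
    have a1 := (hUQ i ζ h1).2.2.2.1 j hj hij.symm
    have a2 := (hUQ j ζ h2).2.2.2.1 i hi hij
    exact lt_asymm a1 a2
  -- tolerances
  have hfc : IsCompact (f '' closure D) := hcl.image_of_continuousOn hf.cont
  obtain ⟨η, hη, hηX⟩ := unif_nbhd hX hρ hfc (by rintro _ ⟨z, hz, rfl⟩; exact hf.mem z hz)
    (by linarith : 0 < ε / 2)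
  obtain ⟨δ, hδ, hδ1, hδη, hδε⟩ : ∃ δ > 0, δ ≤ 1 / 4 ∧ δ * B ≤ η ∧ δ * B ≤ ε / 4 := by
    refine ⟨min (1 / 4) (min (η / B) (ε / 4 / B)), by positivity, min_le_left _ _, ?_, ?_⟩
    · rw [← le_div_iff₀ hB]; exact (min_le_right _ _).trans (min_le_left _ _)
    · rw [← le_div_iff₀ hB]; exact (min_le_right _ _).trans (min_le_right _ _)
  have hδε' : δ ≤ ε / 4 := le_trans (by nlinarith) hδε
  obtain ⟨ψ, k1, k2, k3, k4, k5, k6⟩ := multi_arc hD hDb he hq hqZ t p r U ω hpr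
    (fun i _ => isOpen_interior) (fun i _ ζ h => (hUQ i ζ h).1) (fun i _ => hω1 i) hUdis hpU hδ
  let φ : ℂ → ℂ := fun z => q z * ψ z
  have hφ2 : ∀ z ∈ closure D, ‖φ z‖ ≤ 2 := fun z hz => (k3 z hz).trans (by linarith)
  let g : ℂ → Cn N := fun z => f z + φ z • v + φ z ^ 2 • u
  have hgf : ∀ z ∈ closure D, ‖g z - f z‖ ≤ ‖φ z‖ * B := by
    intro z hz
    have h1 : g z - f z = φ z • v + φ z ^ 2 • u := by simp only [g]; abel
    rw [h1]
    refine (norm_add_le _ _).trans ?_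
    rw [norm_smul, norm_smul, norm_pow]
    have := hφ2 z hz
    have h3 := norm_nonneg (φ z)
    have h4 := norm_nonneg u
    have h5 : ‖φ z‖ ^ 2 * ‖u‖ ≤ ‖φ z‖ * (2 * ‖u‖) := by nlinarith [mul_nonneg h3 h4]
    rw [hBdef]; nlinarith
  -- dichotomy
  have hact : ∀ z ∈ closure D, (∃ i ∈ t, z ∈ e.source ∧ e z ∈ U i) ∨ ‖φ z‖ ≤ δ := by
    intro z hz
    by_cases h : ∃ i ∈ t, z ∈ e.source ∧ e z ∈ U i
    · exact Or.inl h
    · right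
      apply k4 z hz
      intro i hi h'
      exact h ⟨i, hi, h'⟩
  have hclim : ∀ z ∈ closure D, z ∈ e.source → 0 ≤ (e z).im := by
    intro z hz hzs
    by_cases h : z ∈ D
    · exact ((he.memD z hzs).1 h).le
    · have : z ∈ frontier D := ⟨hz, by rwa [hD.interior_eq]⟩
      exact ((he.memF z hzs).1 this).ge
  have hactball : ∀ z ∈ closure D, ∀ i ∈ t, z ∈ e.source → e z ∈ U i → f z ∈ ball x0 s ∧ z ∉ KK := by
    intro z hz i hi hzs hzU
    have hQ := hUQ i _ hzU
    have h1 := hQ.2.1 (hclim z hz hzs)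
    have h2 := hQ.2.2.1
    simp only [F] at h1
    rw [e.left_inv hzs] at h1 h2
    exact ⟨h1, h2⟩
  have hsmall : ∀ z ∈ closure D, ‖φ z‖ ≤ δ → ‖g z - f z‖ ≤ δ * B := fun z hz h =>
    (hgf z hz).trans (mul_le_mul_of_nonneg_right h hB.le)
  have hsmall' : ∀ z ∈ closure D, ‖φ z‖ ≤ δ → g z ∈ X ∧ |ρ (g z) - ρ (f z)| ≤ ε / 2 := fun z hz h =>
    hηX _ ⟨z, hz, rfl⟩ _ ((hsmall z hz h).trans hδη)
  have hlow : ∀ x ∈ ball x0 s, ∀ μ : ℂ, -(c / 2 * ‖μ‖) ≤ (μ * A x).re := by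
    intro x hx μ
    have h1 := (abs_le.1 (Complex.abs_re_le_norm (μ * A x))).1
    rw [norm_mul] at h1
    nlinarith [hG.Ale x hx, norm_nonneg μ]
  have hκ : ∀ z ∈ closure D, c / (4 * B ^ 2) * ‖g z - f z‖ ^ 2 ≤ c / 4 * ‖φ z‖ ^ 2 := by
    intro z hz
    have h1 : ‖g z - f z‖ ^ 2 ≤ (‖φ z‖ * B) ^ 2 := pow_le_pow_left₀ (norm_nonneg _) (hgf z hz) 2
    calc _ ≤ c / (4 * B ^ 2) * (‖φ z‖ * B) ^ 2 := mul_le_mul_of_nonneg_left h1 (by positivity)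
      _ = c / 4 * ‖φ z‖ ^ 2 := by field_simp
  have harc : ∀ z ∈ closure D, f z ∈ ball x0 s → 1 - δ ≤ ‖φ z‖ →
      ρ (f z) + c / 4 * ‖φ z‖ ^ 2 ≤ ρ (g z) ∧ ρ (f z) + c / 8 ≤ ρ (g z) := by
    intro z hz hb h1
    have h2 := hG.gain _ hb (φ z) (hφ2 z hz)
    have h3 := hlow _ hb (φ z)
    have h4 : 3 / 4 ≤ ‖φ z‖ := by linarith
    have h5 : c / 4 * ‖φ z‖ ^ 2 ≤ c * ‖φ z‖ ^ 2 - c / 2 * ‖φ z‖ := by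
      have : 0 ≤ c * ‖φ z‖ * (3 / 4 * ‖φ z‖ - 1 / 2) := mul_nonneg (by positivity) (by linarith)
      nlinarith
    have h6 : c / 8 ≤ c / 4 * ‖φ z‖ ^ 2 := by nlinarith
    change ρ (f z) + (φ z * A (f z)).re + c * ‖φ z‖ ^ 2 ≤ ρ (g z) at h2
    constructor <;> linarith
  have harcz : ∀ i ∈ t, ∀ x ∈ Icc (p i) (r i), 1 - δ ≤ ‖φ (e.symm (x : ℂ))‖ := fun i hi x hx => k5 i hi x hx
  refine ⟨g, ⟨?_, ?_, ?_⟩, ?_, ?_, ?_, ?_, ?_⟩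
  · have hφc : ContinuousOn φ (closure D) := hq.continuous.continuousOn.mul k1
    exact (hf.cont.add (hφc.smul continuousOn_const)).add ((hφc.pow 2).smul continuousOn_const)
  · have hφd : DifferentiableOn ℂ φ D := hq.differentiableOn.mul k2
    exact (hf.hol.add (hφd.smul_const v)).add ((hφd.pow 2).smul_const u)
  · intro z hz
    rcases hact z hz with ⟨i, hi, hzs, hzU⟩ | h
    · exact hG.mem _ (hactball z hz i hi hzs hzU).1 _ (hφ2 z hz)
    · exact (hsmall' z hz h).1
  · refine ⟨fun z => ψ z • v + (q z * ψ z ^ 2) • u,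
      (k2.smul_const v).add ((hq.differentiableOn.mul (k2.pow 2)).smul_const u), ?_⟩
    intro z _
    simp only [g, φ]
    rw [smul_add, smul_smul, smul_smul, add_assoc]
    congr 3
    ring
  · intro z hz
    have hzc := subset_closure (hKD hz)
    rcases hact z hzc with ⟨i, hi, hzs, hzU⟩ | h
    · exact absurd (Or.inl hz) (hactball z hzc i hi hzs hzU).2
    · exact (hsmall z hzc h).trans (by linarith)
  · intro z hz
    rcases hact z hz with ⟨i, hi, hzs, hzU⟩ | h
    · obtain ⟨hb, hnK⟩ := hactball z hz i hi hzs hzU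
      have h1 : m - 1 / 2 < ρ (f z) := by
        by_contra h'
        push Not at h'
        exact hnK (Or.inr ⟨hz, h'⟩)
      have h2 := hG.gain _ hb (φ z) (hφ2 z hz)
      have h3 := hlow _ hb (φ z)
      change ρ (f z) + (φ z * A (f z)).re + c * ‖φ z‖ ^ 2 ≤ ρ (g z) at h2
      have h4 : min (ρ (f z)) (m - 1) ≤ m - 1 := min_le_right _ _
      have h5 : -(c / 16) ≤ c * ‖φ z‖ ^ 2 - c / 2 * ‖φ z‖ := by
        nlinarith [mul_nonneg hc.le (sq_nonneg (‖φ z‖ - 1 / 4))]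
      linarith
    · have h1 := (abs_le.1 (hsmall' z hz h).2).1
      have h2 : min (ρ (f z)) (m - 1) ≤ ρ (f z) := min_le_left _ _
      linarith
  · intro z hzf
    have hz := hfrcl hzf
    have hk := hκ z hz
    rcases hact z hz with ⟨i, hi, hzs, hzU⟩ | h
    · obtain ⟨hb, hnK⟩ := hactball z hz i hi hzs hzU
      have him := (he.memF z hzs).1 hzf
      by_cases hre : (e z).re ∈ Icc (p i) (r i)
      · have hez : e z = ((e z).re : ℂ) := Complex.ext (by simp) (by simp [him])
        have h1 := harcz i hi _ hre
        rw [← hez, e.left_inv hzs] at h1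
        have := (harc z hz hb h1).1
        linarith
      · obtain ⟨τ, t0, t1, hτ⟩ := k6 i hi z hzs hzU him hre
        have hQ := (hUQ i _ hzU).2.2.2.2 him hre
        simp only [F] at hQ
        rw [e.left_inv hzs] at hQ
        have h2 := hG.gain _ hb (φ z) (hφ2 z hz)
        change ρ (f z) + (φ z * A (f z)).re + c * ‖φ z‖ ^ 2 ≤ ρ (g z) at h2
        have h3 := hlow _ hb (φ z - τ * ω i)
        have h4 : (φ z * A (f z)).re = ((φ z - τ * ω i) * A (f z)).re + τ * (ω i * A (f z)).re := by
          rw [← Complex.re_ofReal_mul, ← Complex.add_re]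
          congr 1; ring
        have h5 : c / 2 * ‖φ z - τ * ω i‖ ≤ δ := by
          have : ‖φ z - τ * ω i‖ ≤ δ := hτ
          nlinarith [norm_nonneg (φ z - τ * ω i)]
        have h6 : -(ε / 4) ≤ τ * (ω i * A (f z)).re := by nlinarith
        have h7 : c / 4 * ‖φ z‖ ^ 2 ≤ c * ‖φ z‖ ^ 2 := by nlinarith [sq_nonneg ‖φ z‖]
        linarith
    · have h1 := (abs_le.1 (hsmall' z hz h).2).1
      have h2 : c / 4 * ‖φ z‖ ^ 2 ≤ ε / 2 := by
        have : ‖φ z‖ ^ 2 ≤ ‖φ z‖ := by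
          nlinarith [norm_nonneg (φ z)]
        nlinarith [norm_nonneg (φ z), sq_nonneg ‖φ z‖]
      linarith
  · intro i hi x hx
    exact (harc _ (hfrcl (hxf x (hIa i hi x hx))) (hIf i hi x hx) (harcz i hi x hx)).2

end

section

structure StepOut {N : ℕ} (X : Set (Cn N)) (ρ : Cn N → ℝ) (D : Set ℂ) (q : ℂ → ℂ) (K : Set ℂ)
    (m ε κ : ℝ) (f g : ℂ → Cn N) : Prop where
  adm : Adm X D g
  jet : JetRel D q f g
  close : ∀ z ∈ K, ‖g z - f z‖ ≤ ε
  inter : ∀ z ∈ closure D, min (ρ (f z)) (m - 1) - ε ≤ ρ (g z)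
  bd : ∀ z ∈ frontier D, ρ (f z) + κ * ‖g z - f z‖ ^ 2 - ε ≤ ρ (g z)

def IsTask {N : ℕ} (X : Set (Cn N)) (ρ : Cn N → ℝ) (D : Set ℂ) (q : ℂ → ℂ)
    (x0 : Cn N) (s : ℝ) (Y : Set ℂ) (κ γ : ℝ) : Prop :=
  ∀ f, Adm X D f → ∀ K, IsCompact K → K ⊆ D → ∀ m, (∀ z ∈ frontier D, m ≤ ρ (f z)) → ∀ ε > 0,
    ∃ g, StepOut X ρ D q K m ε κ f g ∧
      ∀ z ∈ frontier D, z ∈ Y → ‖f z - x0‖ ≤ s / 2 → ρ (f z) + γ ≤ ρ (g z)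

def chartPart (e : OpenPartialHomeomorph ℂ ℂ) (a : ℝ) : Set ℂ := {z | z ∈ e.source ∧ ‖e z‖ < a / 2}

lemma isTask_of {N : ℕ} {X : Set (Cn N)} (hX : IsOpen X) {ρ : Cn N → ℝ} (hρ : ContinuousOn ρ X)
    {D Z : Set ℂ} (hD : IsOpen D) (hDb : Bornology.IsBounded D)
    {e : OpenPartialHomeomorph ℂ ℂ} {a C : ℝ} (he : BChart D Z e a C)
    {q : ℂ → ℂ} (hq : Differentiable ℂ q) (hqZ : ∀ z ∉ Z, q z ≠ 0)
    {x0 v u : Cn N} {c s : ℝ} {A : Cn N → ℂ} (hG : GB X ρ x0 v u c s A) :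
    IsTask X ρ D q x0 s (chartPart e a) (c / (4 * (‖v‖ + 2 * ‖u‖ + 1) ^ 2)) (c / 8) := by
  intro f hf K hK hKD m hm ε hε
  have ha := he.apos
  have hs := hG.spos
  have hfrcl : frontier D ⊆ closure D := frontier_subset_closure
  have hxt : ∀ x ∈ Ioo (-a) a, (x : ℂ) ∈ e.target := fun x hx => he.tgt (by
    simpa using abs_lt.2 hx)
  have hxf : ∀ x ∈ Ioo (-a) a, e.symm (x : ℂ) ∈ frontier D := fun x hx =>
    (he.memF _ (e.map_target (hxt x hx))).2 (by rw [e.right_inv (hxt x hx)]; simp)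
  let h : ℝ → ℝ := fun x => ‖f (e.symm (x : ℂ)) - x0‖
  have hh : ContinuousOn h (Ioo (-a) a) := by
    have h1 : ContinuousOn (fun x : ℝ => e.symm (x : ℂ)) (Ioo (-a) a) :=
      e.continuousOn_symm.comp Complex.continuous_ofReal.continuousOn hxt
    have h2 : ContinuousOn (fun x : ℝ => f (e.symm (x : ℂ))) (Ioo (-a) a) :=
      hf.cont.comp h1 fun x hx => hfrcl (hxf x hx)
    exact (h2.sub continuousOn_const).norm
  have hsub : Icc (-(a / 2)) (a / 2) ⊆ Ioo (-a) a := fun x hx => ⟨by linarith [hx.1], by linarith [hx.2]⟩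
  have hO : IsOpen (Ioo (-a) a ∩ h ⁻¹' Iio s) := hh.isOpen_inter_preimage isOpen_Ioo isOpen_Iio
  have hC : IsCompact (Icc (-(a / 2)) (a / 2) ∩ h ⁻¹' Iic (s / 2)) :=
    isCompact_Icc.of_isClosed_subset
      ((hh.mono hsub).preimage_isClosed_of_isClosed isClosed_Icc isClosed_Iic) inter_subset_left
  obtain ⟨t, p, r, h1, h2, h3, h4⟩ := arcs_cover hC hO (by
    rintro x ⟨hx1, hx2⟩
    refine ⟨hsub hx1, ?_⟩
    have : h x ≤ s / 2 := hx2
    change h x < s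
    linarith)
  obtain ⟨g, g1, g2, g3, g4, g5, g6⟩ := step_arcs hX hρ hD hDb he hq hqZ hG hf t p r h1
    (fun i hi x hx => abs_lt.2 (h2 i hi hx).1)
    (fun i hi x hx => by rw [mem_ball_iff_norm]; exact (h2 i hi hx).2) h3 hK hKD hm hε
  refine ⟨g, ⟨g1, g2, g3, g4, g5⟩, ?_⟩
  intro z hz hzY hzx
  have hzs := hzY.1
  have him := (he.memF z hzs).1 hz
  have hez : e z = ((e z).re : ℂ) := Complex.ext (by simp) (by simp [him])
  have hzz : e.symm ((e z).re : ℂ) = z := by rw [← hez]; exact e.left_inv hzs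
  have habs : |(e z).re| < a / 2 := (Complex.abs_re_le_norm _).trans_lt hzY.2
  have hb := abs_lt.1 habs
  obtain ⟨i, hi, hx⟩ := h4 (e z).re ⟨⟨hb.1.le, hb.2.le⟩, by
    change ‖f (e.symm ((e z).re : ℂ)) - x0‖ ≤ s / 2
    rw [hzz]; exact hzx⟩
  have := g6 i hi _ hx
  rw [hzz] at this
  exact this

lemma JetRel.refl {N : ℕ} {D : Set ℂ} {q : ℂ → ℂ} (f : ℂ → Cn N) : JetRel D q f f :=
  ⟨fun _ => 0, differentiableOn_const _, fun z _ => by simp⟩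

lemma JetRel.trans {N : ℕ} {D : Set ℂ} {q : ℂ → ℂ} {f g h : ℂ → Cn N} (h1 : JetRel D q f g)
    (h2 : JetRel D q g h) : JetRel D q f h := by
  obtain ⟨S, hS, e1⟩ := h1
  obtain ⟨T, hT, e2⟩ := h2
  exact ⟨fun z => S z + T z, hS.add hT, fun z hz => by rw [e2 z hz, e1 z hz, smul_add, add_assoc]⟩

lemma StepOut.refl {N : ℕ} {X : Set (Cn N)} {ρ : Cn N → ℝ} {D : Set ℂ} {q : ℂ → ℂ} {K : Set ℂ}
    {m ε κ : ℝ} (hε : 0 ≤ ε) {f : ℂ → Cn N} (hf : Adm X D f) : StepOut X ρ D q K m ε κ f f := by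
  refine ⟨hf, JetRel.refl f, ?_, ?_, ?_⟩
  · intro z _; simpa using hε
  · intro z _; linarith [min_le_left (ρ (f z)) (m - 1)]
  · intro z _; simp; linarith

lemma StepOut.trans {N : ℕ} {X : Set (Cn N)} {ρ : Cn N → ℝ} {D : Set ℂ} {q : ℂ → ℂ} {K : Set ℂ}
    {m ε δ κ κ' : ℝ} (hκ : 0 ≤ κ) (hκ' : 0 ≤ κ') {f g h : ℂ → Cn N}
    (h1 : StepOut X ρ D q K m ε κ f g) (h2 : StepOut X ρ D q K (m - ε) δ κ' g h) :
    StepOut X ρ D q K m (ε + δ) (min κ κ' / 2) f h := by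
  refine ⟨h2.adm, h1.jet.trans h2.jet, ?_, ?_, ?_⟩
  · intro z hz
    have := norm_sub_le_norm_sub_add_norm_sub (h z) (g z) (f z)
    linarith [h1.close z hz, h2.close z hz]
  · intro z hz
    have a1 := h1.inter z hz
    have a2 := h2.inter z hz
    have a3 : min (ρ (f z)) (m - 1) - ε ≤ min (ρ (g z)) (m - ε - 1) :=
      le_min a1 (by linarith [min_le_right (ρ (f z)) (m - 1)])
    linarith
  · intro z hz
    have a1 := h1.bd z hz
    have a2 := h2.bd z hz
    have a3 := norm_sub_le_norm_sub_add_norm_sub (h z) (g z) (f z)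
    have n1 := norm_nonneg (h z - f z)
    have n2 := norm_nonneg (h z - g z)
    have n3 := norm_nonneg (g z - f z)
    have a4 : ‖h z - f z‖ ^ 2 ≤ 2 * ‖g z - f z‖ ^ 2 + 2 * ‖h z - g z‖ ^ 2 := by
      nlinarith [sq_nonneg (‖h z - g z‖ - ‖g z - f z‖)]
    have m0 : 0 ≤ min κ κ' := le_min hκ hκ'
    have m1 : min κ κ' * ‖g z - f z‖ ^ 2 ≤ κ * ‖g z - f z‖ ^ 2 :=
      mul_le_mul_of_nonneg_right (min_le_left _ _) (sq_nonneg _)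
    have m2 : min κ κ' * ‖h z - g z‖ ^ 2 ≤ κ' * ‖h z - g z‖ ^ 2 :=
      mul_le_mul_of_nonneg_right (min_le_right _ _) (sq_nonneg _)
    have m3 := mul_le_mul_of_nonneg_left a4 m0
    linarith

lemma StepOut.bd0 {N : ℕ} {X : Set (Cn N)} {ρ : Cn N → ℝ} {D : Set ℂ} {q : ℂ → ℂ} {K : Set ℂ}
    {m ε κ : ℝ} (hκ : 0 ≤ κ) {f g : ℂ → Cn N}
    (h1 : StepOut X ρ D q K m ε κ f g) : ∀ z ∈ frontier D, ρ (f z) - ε ≤ ρ (g z) := by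
  intro z hz
  have := h1.bd z hz
  have : 0 ≤ κ * ‖g z - f z‖ ^ 2 := by positivity
  linarith

lemma StepOut.weaken {N : ℕ} {X : Set (Cn N)} {ρ : Cn N → ℝ} {D : Set ℂ} {q : ℂ → ℂ} {K : Set ℂ}
    {m ε κ : ℝ} (hκ : 0 ≤ κ) {f g : ℂ → Cn N}
    (h1 : StepOut X ρ D q K m ε κ f g) : StepOut X ρ D q K m ε 0 f g :=
  ⟨h1.adm, h1.jet, h1.close, h1.inter, fun z hz => by simpa using h1.bd0 hκ z hz⟩

lemma chain {N : ℕ} {X : Set (Cn N)} {ρ : Cn N → ℝ} {D : Set ℂ} {q : ℂ → ℂ}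
    (L : List (Cn N × ℝ × Set ℂ))
    (hL : ∀ T ∈ L, 0 < T.2.1 ∧ ∃ κ > 0, ∃ γ > 0, IsTask X ρ D q T.1 T.2.1 T.2.2 κ γ) :
    ∃ κ > 0, ∃ γ > 0, ∀ f, Adm X D f → ∀ K, IsCompact K → K ⊆ D →
      ∀ m, (∀ z ∈ frontier D, m ≤ ρ (f z)) → ∀ ε > 0,
      ∃ g, StepOut X ρ D q K m ε κ f g ∧ ∀ T ∈ L, ∀ z ∈ frontier D, z ∈ T.2.2 →
        ‖f z - T.1‖ ≤ T.2.1 / 4 → ρ (f z) + γ - ε ≤ ρ (g z) := by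
  induction L with
  | nil =>
    refine ⟨1, one_pos, 1, one_pos, ?_⟩
    intro f hf K _ _ m _ ε hε
    exact ⟨f, StepOut.refl hε.le hf, fun T hT => by simp at hT⟩
  | cons T L ih =>
    obtain ⟨κ, hκ, γ, hγ, H⟩ := ih fun T hT => hL T (List.mem_cons_of_mem _ hT)
    obtain ⟨hs, κ', hκ', γ', hγ', H'⟩ := hL T List.mem_cons_self
    refine ⟨min κ κ' / 2, by positivity, min γ (min γ' (κ * (T.2.1 / 4) ^ 2)), by positivity, ?_⟩
    intro f hf K hK hKD m hm ε hε
    have hε2 : 0 < ε / 2 := by linarith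
    obtain ⟨g, g1, g2⟩ := H f hf K hK hKD m hm (ε / 2) hε2
    have hbd1 := g1.bd0 hκ.le
    obtain ⟨h, h1, h2⟩ := H' g g1.adm K hK hKD (m - ε / 2)
      (fun z hz => by linarith [hbd1 z hz, hm z hz]) (ε / 2) hε2
    have hbd2 := h1.bd0 hκ'.le
    refine ⟨h, ?_, ?_⟩
    · have := g1.trans hκ.le hκ'.le h1
      rwa [add_halves] at this
    intro T' hT' z hz hzY hzx
    rcases List.mem_cons.1 hT' with rfl | hT''
    · by_cases hc : ‖g z - T'.1‖ ≤ T'.2.1 / 2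
      · have a1 := h2 z hz hzY hc
        have a2 : min γ (min γ' (κ * (T'.2.1 / 4) ^ 2)) ≤ γ' := (min_le_right _ _).trans (min_le_left _ _)
        linarith [hbd1 z hz]
      · push Not at hc
        have a2 : min γ (min γ' (κ * (T'.2.1 / 4) ^ 2)) ≤ κ * (T'.2.1 / 4) ^ 2 :=
          (min_le_right _ _).trans (min_le_right _ _)
        have a3 := norm_sub_le_norm_sub_add_norm_sub (g z) (f z) T'.1
        have a4 : T'.2.1 / 4 ≤ ‖g z - f z‖ := by linarith
        have a5 : κ * (T'.2.1 / 4) ^ 2 ≤ κ * ‖g z - f z‖ ^ 2 := by gcongr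
        linarith [g1.bd z hz, hbd2 z hz]
    · have a1 := g2 T' hT'' z hz hzY hzx
      have a2 : min γ (min γ' (κ * (T.2.1 / 4) ^ 2)) ≤ γ := min_le_left _ _
      linarith [hbd2 z hz]

lemma raise_once {N : ℕ} {X : Set (Cn N)} (hX : IsOpen X) {ρ : Cn N → ℝ}
    (hρ : ContDiffOn ℝ (⊤ : ℕ∞) ρ X) (hexh : ∀ c : ℝ, IsCompact {x ∈ X | ρ x ≤ c})
    (hLevi : ∀ x ∈ X, TwoPosEigen ρ x)
    {D Z : Set ℂ} (hD : IsOpen D) (hDb : Bornology.IsBounded D) (hDsb : SmoothlyBounded D)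
    (hZ : IsClosed Z) (hZD : Z ⊆ D)
    {q : ℂ → ℂ} (hq : Differentiable ℂ q) (hqZ : ∀ z ∉ Z, q z ≠ 0) (M : ℝ) :
    ∃ γ > 0, ∀ f, Adm X D f → ∀ K, IsCompact K → K ⊆ D →
      ∀ m, (∀ z ∈ frontier D, m ≤ ρ (f z)) → ∀ ε > 0,
      ∃ g, StepOut X ρ D q K m ε 0 f g ∧ ∀ z ∈ frontier D, min (ρ (f z) + γ) M - ε ≤ ρ (g z) := by
  have h1 : ∀ x ∈ X, ∃ v u : Cn N, ∃ c s : ℝ, ∃ A : Cn N → ℂ, GB X ρ x v u c s A := by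
    intro x hx
    obtain ⟨v, u, c, s, A, a1, a2, a3, a4, a5, a6⟩ := goodBall hX hρ hx (hLevi x hx)
    exact ⟨v, u, c, s, A, a1, a2, a3, a5, fun y hy => (a6 y hy).1,
      fun y hy μ hμ => ((a6 y hy).2 μ hμ).1, fun y hy μ hμ => ((a6 y hy).2 μ hμ).2⟩
  choose! v u c s A hGB using h1
  have h2 : ∀ p ∈ frontier D, ∃ e : OpenPartialHomeomorph ℂ ℂ, ∃ a C : ℝ, p ∈ e.source ∧ e p = 0 ∧
      BChart D Z e a C := by
    intro p hp
    refine exists_chart hDsb hZ hp fun h => ?_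
    rw [hD.frontier_eq] at hp
    exact hp.2 (hZD h)
  haveI : Nonempty (OpenPartialHomeomorph ℂ ℂ) := ⟨OpenPartialHomeomorph.refl ℂ⟩
  choose! e a C hpe he0 hch using h2
  obtain ⟨t1, ht1, hcov1⟩ := (hexh M).elim_nhds_subcover (fun x => ball x (s x / 4)) (fun x hx =>
    ball_mem_nhds x (by linarith [(hGB x hx.1).spos]))
  have hfc : IsCompact (frontier D) := hDb.isCompact_closure.of_isClosed_subset isClosed_frontier
    frontier_subset_closure
  obtain ⟨t2, ht2, hcov2⟩ := hfc.elim_nhds_subcover (fun p => chartPart (e p) (a p)) (fun p hp => by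
    have b1 : ∀ᶠ z in nhds p, z ∈ (e p).source := (e p).open_source.mem_nhds (hpe p hp)
    have b2 : ∀ᶠ z in nhds p, ‖e p z‖ < a p / 2 := by
      have := ((e p).continuousAt (hpe p hp)).norm.tendsto
      rw [he0 p hp, norm_zero] at this
      exact this.eventually (gt_mem_nhds (by linarith [(hch p hp).apos]))
    exact b1.and b2)
  let L : List (Cn N × ℝ × Set ℂ) := (t1 ×ˢ t2).toList.map
    fun xp => (xp.1, s xp.1, chartPart (e xp.2) (a xp.2))
  obtain ⟨κ, hκ, γ, hγ, H⟩ := chain (X := X) (ρ := ρ) (D := D) (q := q) L (by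
    intro T hT
    obtain ⟨⟨x, p⟩, hxp, rfl⟩ := List.mem_map.1 hT
    rw [Finset.mem_toList, Finset.mem_product] at hxp
    have g1 := hGB x (ht1 x hxp.1).1
    have hcp := g1.cpos
    exact ⟨g1.spos, _, by positivity, _, by positivity,
      isTask_of hX hρ.continuousOn hD hDb (hch p (ht2 p hxp.2)) hq hqZ g1⟩)
  refine ⟨γ, hγ, ?_⟩
  intro f hf K hK hKD m hm ε hε
  obtain ⟨g, g1, g2⟩ := H f hf K hK hKD m hm ε hε
  refine ⟨g, g1.weaken hκ.le, ?_⟩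
  intro z hz
  by_cases hM : ρ (f z) ≤ M
  · have b1 := hcov1 (show f z ∈ _ from ⟨hf.mem z (frontier_subset_closure hz), hM⟩)
    have b2 := hcov2 hz
    simp only [mem_iUnion, exists_prop] at b1 b2
    obtain ⟨x, hx, hfx⟩ := b1
    obtain ⟨p, hp, hzp⟩ := b2
    have hT : (x, s x, chartPart (e p) (a p)) ∈ L :=
      List.mem_map.2 ⟨(x, p), by rw [Finset.mem_toList, Finset.mem_product]; exact ⟨hx, hp⟩, rfl⟩
    have := g2 _ hT z hz hzp (mem_ball_iff_norm.1 hfx).le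
    linarith [min_le_left (ρ (f z) + γ) M]
  · push Not at hM
    linarith [g1.bd0 hκ.le z hz, min_le_right (ρ (f z) + γ) M]

lemma raise {N : ℕ} {X : Set (Cn N)} (hX : IsOpen X) {ρ : Cn N → ℝ}
    (hρ : ContDiffOn ℝ (⊤ : ℕ∞) ρ X) (hexh : ∀ c : ℝ, IsCompact {x ∈ X | ρ x ≤ c})
    (hLevi : ∀ x ∈ X, TwoPosEigen ρ x)
    {D Z : Set ℂ} (hD : IsOpen D) (hDb : Bornology.IsBounded D) (hDsb : SmoothlyBounded D)
    (hZ : IsClosed Z) (hZD : Z ⊆ D)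
    {q : ℂ → ℂ} (hq : Differentiable ℂ q) (hqZ : ∀ z ∉ Z, q z ≠ 0) (M : ℝ)
    {f : ℂ → Cn N} (hf : Adm X D f) {K : Set ℂ} (hK : IsCompact K) (hKD : K ⊆ D)
    {m : ℝ} (hm : ∀ z ∈ frontier D, m ≤ ρ (f z)) {ε : ℝ} (hε : 0 < ε) :
    ∃ g, StepOut X ρ D q K m ε 0 f g ∧ ∀ z ∈ frontier D, M - ε ≤ ρ (g z) := by
  obtain ⟨γ, hγ, H⟩ := raise_once hX hρ hexh hLevi hD hDb hDsb hZ hZD hq hqZ M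
  have key : ∀ n : ℕ, ∀ ε > 0, ∃ g, StepOut X ρ D q K m ε 0 f g ∧
      ∀ z ∈ frontier D, min (m + n * γ) M - ε ≤ ρ (g z) := by
    intro n
    induction n with
    | zero =>
      intro ε hε
      refine ⟨f, StepOut.refl hε.le hf, ?_⟩
      intro z hz
      have := min_le_left (m + ((0:ℕ):ℝ) * γ) M
      have h0 : m + ((0:ℕ):ℝ) * γ = m := by simp
      linarith [hm z hz]
    | succ n ih =>
      intro ε hε
      obtain ⟨g, g1, g2⟩ := ih (ε / 2) (by linarith)
      obtain ⟨h, h1, h2⟩ := H g g1.adm K hK hKD (m - ε / 2)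
        (fun z hz => by linarith [g1.bd0 le_rfl z hz, hm z hz]) (ε / 2) (by linarith)
      refine ⟨h, ?_, ?_⟩
      · have := g1.trans le_rfl le_rfl h1
        rw [add_halves] at this
        simpa using this
      · intro z hz
        have a1 := g2 z hz
        have a2 := h2 z hz
        have a3 : min (m + ((n + 1 : ℕ) : ℝ) * γ) M - ε / 2 ≤ min (ρ (g z) + γ) M := by
          have b1 := min_le_right (m + ((n + 1 : ℕ) : ℝ) * γ) M
          have b2 := min_le_left (m + ((n + 1 : ℕ) : ℝ) * γ) M
          push_cast at b1 b2 ⊢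
          refine le_min ?_ (by linarith)
          rcases le_total (m + n * γ) M with h | h
          · rw [min_eq_left h] at a1; linarith
          · rw [min_eq_right h] at a1; linarith
        linarith
  obtain ⟨n, hn⟩ := exists_nat_gt ((M - m) / γ)
  rw [div_lt_iff₀ hγ] at hn
  obtain ⟨g, g1, g2⟩ := key n ε hε
  rw [min_eq_right (by linarith)] at g2
  exact ⟨g, g1, g2⟩

end

section

lemma exhaust {D : Set ℂ} (hD : IsOpen D) (hDb : Bornology.IsBounded D) :
    ∃ E : ℕ → Set ℂ, (∀ n, IsCompact (E n)) ∧ (∀ n, E n ⊆ D) ∧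
      ∀ K, IsCompact K → K ⊆ D → ∃ n : ℕ, ∀ m ≥ n, K ⊆ E m := by
  have hne : (Dᶜ).Nonempty := by
    by_contra h
    rw [not_nonempty_iff_eq_empty, compl_empty_iff] at h
    rw [h] at hDb
    exact NoncompactSpace.noncompact_univ (X := ℂ)
      (isCompact_of_isClosed_isBounded isClosed_univ hDb)
  have hsub : ∀ n : ℕ, {z : ℂ | 1 / ((n:ℝ) + 1) ≤ infDist z Dᶜ} ⊆ D := by
    intro n z hz
    by_contra hzD
    have h0 : infDist z Dᶜ = 0 := infDist_zero_of_mem hzD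
    have h1 : 1 / ((n:ℝ) + 1) ≤ infDist z Dᶜ := hz
    have : 0 < 1 / ((n:ℝ) + 1) := by positivity
    linarith
  refine ⟨fun n => {z | 1 / ((n:ℝ) + 1) ≤ infDist z Dᶜ}, ?_, hsub, ?_⟩
  · intro n
    exact isCompact_of_isClosed_isBounded
      (isClosed_le continuous_const (continuous_infDist_pt _)) (hDb.subset (hsub n))
  · intro K hK hKD
    obtain ⟨δ, hδ, hδK⟩ := hK.exists_cthickening_subset_open hD hKD
    obtain ⟨n, hn⟩ := exists_nat_one_div_lt hδ
    refine ⟨n, fun m hm z hz => ?_⟩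
    have h1 : 1 / ((m:ℝ) + 1) ≤ 1 / ((n:ℝ) + 1) := by
      apply one_div_le_one_div_of_le (by positivity)
      have : (n:ℝ) ≤ m := by exact_mod_cast hm
      linarith
    have h2 : δ ≤ infDist z Dᶜ := by
      rw [le_infDist hne]
      intro y hy
      by_contra hlt
      push Not at hlt
      apply hy
      apply hδK
      apply mem_cthickening_of_dist_le y z δ K hz
      rw [dist_comm]; exact hlt.le
    show 1 / ((m:ℝ) + 1) ≤ infDist z Dᶜ
    linarith

lemma diffOn_iter {N : ℕ} {D : Set ℂ} (hD : IsOpen D) {f : ℂ → Cn N} (hf : DifferentiableOn ℂ f D)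
    (i : ℕ) : DifferentiableOn ℂ (iteratedDeriv i f) D := by
  induction i with
  | zero => simpa using hf
  | succ i ih => rw [iteratedDeriv_succ]; exact ih.deriv hD

lemma jets_aux {N : ℕ} {D : Set ℂ} (hD : IsOpen D) {a : ℂ} {f g : ℂ → Cn N}
    (hf : DifferentiableOn ℂ f D) (i : ℕ) : ∀ n : ℕ, ∀ T : ℂ → Cn N, DifferentiableOn ℂ T D →
    (∀ z ∈ D, g z = f z + (z - a) ^ (n + i) • T z) →
    ∃ T' : ℂ → Cn N, DifferentiableOn ℂ T' D ∧
      ∀ z ∈ D, iteratedDeriv i g z = iteratedDeriv i f z + (z - a) ^ n • T' z := by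
  induction i with
  | zero => intro n T hT h; exact ⟨T, hT, by simpa using h⟩
  | succ i ih =>
    intro n T hT h
    obtain ⟨S, hS, e⟩ := ih (n + 1) T hT (fun z hz => by
      rw [h z hz, show n + 1 + i = n + (i + 1) by ring])
    refine ⟨fun z => ((n:ℂ) + 1) • S z + (z - a) • deriv S z, ?_, ?_⟩
    · have d1 : DifferentiableOn ℂ (fun z => ((n:ℂ) + 1) • S z) D := hS.const_smul ((n:ℂ) + 1)
      have d0 : DifferentiableOn ℂ (fun z : ℂ => z - a) D := by fun_prop
      have d2 : DifferentiableOn ℂ (fun z => (z - a) • deriv S z) D := d0.smul (hS.deriv hD)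
      exact d1.add d2
    · intro z hz
      have hn := hD.mem_nhds hz
      have ev : iteratedDeriv i g =ᶠ[nhds z]
          fun z => iteratedDeriv i f z + (z - a) ^ (n + 1) • S z := by
        filter_upwards [hn] with w hw using e w hw
      rw [iteratedDeriv_succ, iteratedDeriv_succ, ev.deriv_eq]
      have h1 : HasDerivAt (iteratedDeriv i f) (deriv (iteratedDeriv i f) z) z :=
        ((diffOn_iter hD hf i).differentiableAt hn).hasDerivAt
      have h2 : HasDerivAt S (deriv S z) z := (hS.differentiableAt hn).hasDerivAt
      have h3 : HasDerivAt (fun z : ℂ => (z - a) ^ (n + 1)) (((n:ℂ) + 1) * (z - a) ^ n) z := by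
        have := ((hasDerivAt_id z).sub_const a).pow (n + 1)
        refine HasDerivAt.congr_deriv this ?_
        simp
      have h4 : HasDerivAt (fun z => iteratedDeriv i f z + (z - a) ^ (n + 1) • S z) _ z :=
        h1.add (h3.smul h2)
      rw [h4.deriv]
      congr 1
      simp only [smul_add, smul_smul, pow_succ]
      rw [add_comm, mul_comm ((n:ℂ) + 1)]

lemma jets {N : ℕ} {D : Set ℂ} (hD : IsOpen D) {a : ℂ} (ha : a ∈ D) {q r : ℂ → ℂ} {k : ℕ}
    (hr : Differentiable ℂ r) (hq : ∀ z, q z = (z - a) ^ (k + 1) * r z)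
    {f g : ℂ → Cn N} (hf : DifferentiableOn ℂ f D) (h : JetRel D q f g) :
    ∀ i ≤ k, iteratedDeriv i g a = iteratedDeriv i f a := by
  intro i hi
  obtain ⟨S, hS, e⟩ := h
  obtain ⟨T, -, hT⟩ := jets_aux (a := a) (g := g) hD hf i (k - i + 1) (fun z => r z • S z)
    (hr.differentiableOn.smul hS) (fun z hz => by
      rw [e z hz, hq, mul_smul, show k - i + 1 + i = k + 1 by omega])
  rw [hT a ha]; simp

lemma lim_iter {N : ℕ} {D : Set ℂ} (hD : IsOpen D) {F : ℕ → ℂ → Cn N} {g : ℂ → Cn N}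
    (hF : ∀ n, DifferentiableOn ℂ (F n) D) (h : TendstoLocallyUniformlyOn F g atTop D) (i : ℕ) :
    TendstoLocallyUniformlyOn (fun n => iteratedDeriv i (F n)) (iteratedDeriv i g) atTop D := by
  induction i with
  | zero => simpa using h
  | succ i ih =>
    simp only [iteratedDeriv_succ]
    exact ih.deriv (Eventually.of_forall fun n => diffOn_iter hD (hF n) i) hD

structure St {N : ℕ} (X : Set (Cn N)) (ρ : Cn N → ℝ) (D : Set ℂ) (q : ℂ → ℂ) (f : ℂ → Cn N) where
  F : ℂ → Cn N
  K : Set ℂ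
  ε : ℝ
  M : ℝ
  adm : Adm X D F
  Kc : IsCompact K
  KD : K ⊆ D
  εpos : 0 < ε
  εle : ε ≤ 1
  nb : ∀ z ∈ K, ∀ y, ‖y - F z‖ ≤ 2 * ε → y ∈ X ∧ |ρ y - ρ (F z)| ≤ 1
  bd : ∀ z ∈ frontier D, M ≤ ρ (F z)
  off : ∀ z ∈ closure D, z ∉ K → M - 1 ≤ ρ (F z)
  jet : JetRel D q f F

lemma mkSt {N : ℕ} {X : Set (Cn N)} (hX : IsOpen X) {ρ : Cn N → ℝ} (hρ : ContinuousOn ρ X)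
    {D : Set ℂ} (hD : IsOpen D) (hDb : Bornology.IsBounded D) {q : ℂ → ℂ} {f F : ℂ → Cn N}
    (hF : Adm X D F) (hj : JetRel D q f F) {K0 : Set ℂ} (hK0 : IsCompact K0) (hK0D : K0 ⊆ D)
    {M : ℝ} (hM : ∀ z ∈ frontier D, M ≤ ρ (F z)) {ε0 : ℝ} (hε0 : 0 < ε0) :
    ∃ s : St X ρ D q f, s.F = F ∧ s.M = M ∧ K0 ⊆ s.K ∧ s.ε ≤ ε0 := by
  have hcl : IsCompact (closure D) := hDb.isCompact_closure
  have hc : ContinuousOn (fun z => ρ (F z)) (closure D) := hρ.comp hF.cont hF.mem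
  set K1 : Set ℂ := closure D ∩ (fun z => ρ (F z)) ⁻¹' (Iic (M - 1)) with hK1
  have hK1c : IsCompact K1 :=
    hcl.of_isClosed_subset (hc.preimage_isClosed_of_isClosed isClosed_closure isClosed_Iic)
      inter_subset_left
  have hK1D : K1 ⊆ D := by
    rintro z ⟨h1, h2⟩
    by_contra hz
    have hfr : z ∈ frontier D := by rw [hD.frontier_eq]; exact ⟨h1, hz⟩
    have := hM z hfr
    have h2' : ρ (F z) ≤ M - 1 := h2
    linarith
  have hKD : K0 ∪ K1 ⊆ D := union_subset hK0D hK1D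
  have hKc : IsCompact (K0 ∪ K1) := hK0.union hK1c
  have hKcl : K0 ∪ K1 ⊆ closure D := hKD.trans subset_closure
  obtain ⟨η, hη, hnb⟩ := unif_nbhd hX hρ (hKc.image_of_continuousOn (hF.cont.mono hKcl))
    (by rintro _ ⟨z, hz, rfl⟩; exact hF.mem z (hKcl hz)) one_pos
  refine ⟨{ F := F, K := K0 ∪ K1, ε := min (min ε0 1) (η / 2), M := M, adm := hF, Kc := hKc, KD := hKD
            εpos := by positivity
            εle := (min_le_left _ _).trans (min_le_right _ _)
            nb := ?_, bd := hM, off := ?_, jet := hj }, rfl, rfl, subset_union_left,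
            (min_le_left _ _).trans (min_le_left _ _)⟩
  · intro z hz y hy
    refine hnb _ (mem_image_of_mem F hz) y (hy.trans ?_)
    linarith [min_le_right (min ε0 1) (η / 2)]
  · intro z hz hzK
    by_contra hlt
    push Not at hlt
    exact hzK (Or.inr ⟨hz, hlt.le⟩)

structure StNext {N : ℕ} {X : Set (Cn N)} {ρ : Cn N → ℝ} {D : Set ℂ} {q : ℂ → ℂ} {f : ℂ → Cn N}
    (E : Set ℂ) (s t : St X ρ D q f) : Prop where
  close : ∀ z ∈ s.K, ‖t.F z - s.F z‖ ≤ s.ε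
  inter : ∀ z ∈ closure D, min (ρ (s.F z)) (s.M - 1) - s.ε ≤ ρ (t.F z)
  Ksub : s.K ⊆ t.K
  Esub : E ⊆ t.K
  εle : t.ε ≤ s.ε / 2
  Mge : t.M = s.M + 1

lemma exists_next {N : ℕ} {X : Set (Cn N)} (hX : IsOpen X) {ρ : Cn N → ℝ}
    (hρ : ContDiffOn ℝ (⊤ : ℕ∞) ρ X) (hexh : ∀ c : ℝ, IsCompact {x ∈ X | ρ x ≤ c})
    (hLevi : ∀ x ∈ X, TwoPosEigen ρ x)
    {D Z : Set ℂ} (hD : IsOpen D) (hDb : Bornology.IsBounded D) (hDsb : SmoothlyBounded D)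
    (hZ : IsClosed Z) (hZD : Z ⊆ D)
    {q : ℂ → ℂ} (hq : Differentiable ℂ q) (hqZ : ∀ z ∉ Z, q z ≠ 0) {f : ℂ → Cn N}
    {E : Set ℂ} (hE : IsCompact E) (hED : E ⊆ D) (s : St X ρ D q f) :
    ∃ t : St X ρ D q f, StNext E s t := by
  obtain ⟨g, g1, g2⟩ := raise hX hρ hexh hLevi hD hDb hDsb hZ hZD hq hqZ (s.M + 2) s.adm s.Kc s.KD
    s.bd s.εpos
  obtain ⟨t, t1, t2, t3, t4⟩ := mkSt hX hρ.continuousOn hD hDb g1.adm (s.jet.trans g1.jet)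
    (s.Kc.union hE) (union_subset s.KD hED) (M := s.M + 1)
    (fun z hz => by linarith [g2 z hz, s.εle]) (half_pos s.εpos)
  refine ⟨t, ?_, ?_, subset_union_left.trans t3, subset_union_right.trans t3, t4, t2⟩
  · rw [t1]; exact g1.close
  · rw [t1]; exact g1.inter

lemma exists_proper {N : ℕ} {X : Set (Cn N)} (hX : IsOpen X) {ρ : Cn N → ℝ}
    (hρ : ContDiffOn ℝ (⊤ : ℕ∞) ρ X) (hexh : ∀ c : ℝ, IsCompact {x ∈ X | ρ x ≤ c})
    (hLevi : ∀ x ∈ X, TwoPosEigen ρ x)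
    {D Z : Set ℂ} (hD : IsOpen D) (hDb : Bornology.IsBounded D) (hDsb : SmoothlyBounded D)
    (hZ : IsClosed Z) (hZD : Z ⊆ D)
    {q : ℂ → ℂ} (hq : Differentiable ℂ q) (hqZ : ∀ z ∉ Z, q z ≠ 0) {f : ℂ → Cn N}
    (hf : Adm X D f) {K0 : Set ℂ} (hK0 : IsCompact K0) (hK0D : K0 ⊆ D) {ε0 : ℝ} (hε0 : 0 < ε0) :
    ∃ (g : ℂ → Cn N) (F : ℕ → ℂ → Cn N), (∀ n, DifferentiableOn ℂ (F n) D) ∧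
      (∀ n, JetRel D q f (F n)) ∧ TendstoLocallyUniformlyOn F g atTop D ∧
      (∀ z ∈ D, g z ∈ X) ∧
      (∀ L : Set (Cn N), L ⊆ X → IsCompact L → IsCompact {z ∈ D | g z ∈ L}) ∧
      ∀ z ∈ K0, ‖g z - f z‖ ≤ ε0 := by
  obtain ⟨E, hEc, hED, hEx⟩ := exhaust hD hDb
  have hfrc : IsCompact (frontier D) :=
    hDb.isCompact_closure.of_isClosed_subset isClosed_frontier frontier_subset_closure
  obtain ⟨M, hM⟩ : ∃ M, ∀ z ∈ frontier D, M ≤ ρ (f z) := by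
    have hc : ContinuousOn (fun z => ρ (f z)) (frontier D) :=
      (hρ.continuousOn.comp hf.cont hf.mem).mono frontier_subset_closure
    obtain ⟨M, hM⟩ := (hfrc.image_of_continuousOn hc).bddBelow
    exact ⟨M, fun z hz => hM (mem_image_of_mem _ hz)⟩
  obtain ⟨s0, a1, a2, a3, a4⟩ := mkSt hX hρ.continuousOn hD hDb hf (JetRel.refl (q := q) f) hK0 hK0D
    hM (half_pos hε0)
  have hnext : ∀ n : ℕ, ∀ s : St X ρ D q f, ∃ t : St X ρ D q f, StNext (E n) s t := fun n s =>
    exists_next hX hρ hexh hLevi hD hDb hDsb hZ hZD hq hqZ (hEc n) (hED n) s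
  choose nx hnx using hnext
  let s : ℕ → St X ρ D q f := fun n => Nat.rec s0 nx n
  have hs0 : s 0 = s0 := rfl
  have hs : ∀ n, StNext (E n) (s n) (s (n + 1)) := fun n => hnx n (s n)
  have hKmono : Monotone fun n => (s n).K := monotone_nat_of_le_succ fun n => (hs n).Ksub
  have hMeq : ∀ n : ℕ, (s n).M = (s 0).M + n := by
    intro n
    induction n with
    | zero => simp
    | succ n ih => rw [(hs n).Mge, ih]; push_cast; ring
  have hεle : ∀ n : ℕ, (s n).ε ≤ (s 0).ε / 2 ^ n := by
    intro n
    induction n with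
    | zero => simp
    | succ n ih =>
      have := (hs n).εle
      rw [pow_succ, ← div_div]; linarith
  have hε0' : Tendsto (fun n => 2 * (s n).ε) atTop (nhds 0) := by
    have h1 : Tendsto (fun n : ℕ => 2 * ((s 0).ε / 2 ^ n)) atTop (nhds 0) := by
      have := (tendsto_pow_atTop_nhds_zero_of_lt_one (r := (1/2 : ℝ)) (by norm_num)
        (by norm_num)).const_mul (2 * (s 0).ε)
      rw [mul_zero] at this
      refine this.congr fun n => ?_
      rw [div_pow, one_pow]; ring
    exact squeeze_zero (fun n => by have := (s n).εpos; linarith)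
      (fun n => by linarith [hεle n]) h1
  have hstep : ∀ n j : ℕ, ∀ z ∈ (s n).K,
      ‖(s (n + j)).F z - (s n).F z‖ ≤ 2 * (s n).ε - 2 * (s (n + j)).ε := by
    intro n j z hz
    induction j with
    | zero => simp
    | succ j ih =>
      have h1 := (hs (n + j)).close z (hKmono (Nat.le_add_right n j) hz)
      have h2 := (hs (n + j)).εle
      have h3 := norm_sub_le_norm_sub_add_norm_sub ((s (n + j + 1)).F z) ((s (n + j)).F z) ((s n).F z)
      show ‖(s (n + j + 1)).F z - (s n).F z‖ ≤ 2 * (s n).ε - 2 * (s (n + j + 1)).ε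
      linarith
  have hstep' : ∀ n m : ℕ, n ≤ m → ∀ z ∈ (s n).K, ‖(s m).F z - (s n).F z‖ ≤ 2 * (s n).ε := by
    intro n m hnm z hz
    obtain ⟨j, rfl⟩ := Nat.exists_eq_add_of_le hnm
    have := hstep n j z hz
    linarith [(s (n + j)).εpos]
  have hcov : ∀ K, IsCompact K → K ⊆ D → ∃ n, K ⊆ (s n).K := by
    intro K hK hKD
    obtain ⟨n, hn⟩ := hEx K hK hKD
    exact ⟨n + 1, (hn n le_rfl).trans (hs n).Esub⟩
  have hptc : ∀ z ∈ D, ∃ n, z ∈ (s n).K := by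
    intro z hz
    obtain ⟨n, hn⟩ := hcov {z} isCompact_singleton (singleton_subset_iff.2 hz)
    exact ⟨n, hn rfl⟩
  have hlim : ∀ z, ∃ y : Cn N, z ∈ D → Tendsto (fun n => (s n).F z) atTop (nhds y) := by
    intro z
    by_cases hz : z ∈ D
    · obtain ⟨n0, hn0⟩ := hptc z hz
      have hcs : CauchySeq fun n => (s (n + n0)).F z := by
        refine cauchySeq_of_le_tendsto_0' (fun n => 2 * (s (n + n0)).ε) ?_
          ((tendsto_add_atTop_iff_nat n0).2 hε0')
        intro n m hnm
        rw [dist_comm, dist_eq_norm]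
        exact hstep' _ _ (by omega) z (hKmono (Nat.le_add_left n0 n) hn0)
      obtain ⟨y, hy⟩ := cauchySeq_tendsto_of_complete hcs
      exact ⟨y, fun _ => (tendsto_add_atTop_iff_nat n0).1 hy⟩
    · exact ⟨0, fun h => absurd h hz⟩
  choose g hg using hlim
  have hgF : ∀ n : ℕ, ∀ z ∈ (s n).K, ‖g z - (s n).F z‖ ≤ 2 * (s n).ε := by
    intro n z hz
    have h1 : Tendsto (fun m => ‖(s m).F z - (s n).F z‖) atTop (nhds ‖g z - (s n).F z‖) :=
      ((hg z ((s n).KD hz)).sub_const _).norm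
    apply le_of_tendsto h1
    filter_upwards [eventually_ge_atTop n] with m hm using hstep' n m hm z hz
  have hloc : TendstoLocallyUniformlyOn (fun n => (s n).F) g atTop D := by
    rw [tendstoLocallyUniformlyOn_iff_forall_isCompact hD]
    intro K hKD hK
    obtain ⟨n0, hn0⟩ := hcov K hK hKD
    rw [Metric.tendstoUniformlyOn_iff]
    intro e he
    filter_upwards [eventually_ge_atTop n0, hε0'.eventually (gt_mem_nhds he)] with n hn hne z hz
    rw [dist_eq_norm]
    exact (hgF n z (hKmono hn (hn0 hz))).trans_lt hne
  have hgX : ∀ z ∈ D, g z ∈ X := by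
    intro z hz
    obtain ⟨n, hn⟩ := hptc z hz
    exact ((s n).nb z hn _ (hgF n z hn)).1
  have hgdiff : DifferentiableOn ℂ g D :=
    hloc.differentiableOn (Eventually.of_forall fun n => (s n).adm.hol) hD
  have hbig : ∀ n : ℕ, ∀ z ∈ D, z ∉ (s n).K → (s n).M - 3 ≤ ρ (g z) := by
    intro n z hz hzn
    classical
    have hex := hptc z hz
    have hmin := Nat.find_spec hex
    have hlt : n < Nat.find hex := by
      by_contra h
      push Not at h
      exact hzn (hKmono h hmin)
    obtain ⟨j, hj⟩ : ∃ j, Nat.find hex = j + 1 := ⟨Nat.find hex - 1, by omega⟩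
    have hzj : z ∉ (s j).K := Nat.find_min hex (by omega)
    rw [hj] at hmin hlt
    have h1 := (s j).off z (subset_closure hz) hzj
    have h2 := (hs j).inter z (subset_closure hz)
    rw [min_eq_right h1] at h2
    have h3 := abs_le.1 ((s (j+1)).nb z hmin _ (hgF (j+1) z hmin)).2
    have h4 := (s j).εle
    have h5 := hMeq n
    have h6 := hMeq j
    have h7 : (n:ℝ) ≤ j := by exact_mod_cast Nat.lt_succ_iff.1 hlt
    linarith [h3.1]
  refine ⟨g, fun n => (s n).F, fun n => (s n).adm.hol, fun n => (s n).jet, hloc, hgX, ?_, ?_⟩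
  · intro L hLX hL
    obtain ⟨c, hc⟩ := (hL.image_of_continuousOn (hρ.continuousOn.mono hLX)).bddAbove
    obtain ⟨n, hn⟩ := exists_nat_gt (c + 3 - (s 0).M)
    have heq : {z ∈ D | g z ∈ L} = (s n).K ∩ g ⁻¹' L := by
      ext z
      constructor
      · rintro ⟨h1, h2⟩
        refine ⟨?_, h2⟩
        by_contra hz
        have h3 := hbig n z h1 hz
        have h4 : ρ (g z) ≤ c := hc (mem_image_of_mem _ h2)
        linarith [hMeq n]
      · rintro ⟨h1, h2⟩
        exact ⟨(s n).KD h1, h2⟩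
    rw [heq]
    exact (s n).Kc.of_isClosed_subset
      ((hgdiff.continuousOn.mono (s n).KD).preimage_isClosed_of_isClosed (s n).Kc.isClosed
        hL.isClosed) inter_subset_left
  · intro z hz
    have h := hgF 0 z (a3 hz)
    rw [hs0, a1] at h
    linarith

end

/-- If `X ⊆ ℂ^N` admits a smooth exhaustion function whose Levi form has at
least two positive eigenvalues everywhere, every `C²` map `D̄ → X` holomorphic in
`D` can be approximated, uniformly on compacts in `D` and with interpolation of
`k`-jets at finitely many points, by proper holomorphic maps `D → X`. -/
theorem proper_maps_into_complete_domains
    (N : ℕ) (hN : 2 ≤ N) (X : Set (Cn N)) (hXopen : IsOpen X) (hXconn : IsConnected X)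
    (ρ : Cn N → ℝ) (hρ : ContDiffOn ℝ (⊤ : ℕ∞) ρ X)
    (hexh : ∀ c : ℝ, IsCompact {x ∈ X | ρ x ≤ c})
    (hLevi : ∀ x ∈ X, TwoPosEigen ρ x)
    (D : Set ℂ) (hDopen : IsOpen D) (hDbdd : Bornology.IsBounded D)
    (hDconn : IsConnected D) (hDsb : SmoothlyBounded D)
    (f : ℂ → Cn N) (hf : ClassA 2 D f) (hfX : ∀ z ∈ closure D, f z ∈ X)
    (k : ℕ) (l : ℕ) (zs : Fin l → ℂ) (hzs : ∀ j, zs j ∈ D) :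
    ∃ g : ℕ → ℂ → Cn N,
      (∀ ν, DifferentiableOn ℂ (g ν) D) ∧
      (∀ ν, ∀ z ∈ D, g ν z ∈ X) ∧
      (∀ ν, ∀ K : Set (Cn N), K ⊆ X → IsCompact K → IsCompact {z ∈ D | g ν z ∈ K}) ∧
      (∀ ν, ∀ j : Fin l, ∀ i ≤ k, iteratedDeriv i (g ν) (zs j) = iteratedDeriv i f (zs j)) ∧
      (∀ K : Set ℂ, K ⊆ D → IsCompact K → TendstoUniformlyOn (fun ν => g ν) f atTop K) := by
  have hadm : Adm X D f := ⟨hf.1, hf.2.1, hfX⟩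
  obtain ⟨E, hEc, hED, hEx⟩ := exhaust hDopen hDbdd
  set q : ℂ → ℂ := fun z => ∏ j, (z - zs j) ^ (k + 1) with hqdef
  have hq : Differentiable ℂ q := by
    rw [hqdef]; fun_prop
  have hqZ : ∀ z ∉ range zs, q z ≠ 0 := by
    intro z hz
    rw [hqdef]
    refine Finset.prod_ne_zero_iff.2 fun j _ => pow_ne_zero _ (sub_ne_zero.2 ?_)
    rintro rfl
    exact hz (mem_range_self j)
  have H : ∀ ν : ℕ, _ := fun ν => exists_proper hXopen hρ hexh hLevi hDopen hDbdd hDsb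
    (finite_range zs).isClosed (range_subset_iff.2 hzs) hq hqZ hadm (hEc ν) (hED ν)
    (ε0 := 1 / ((ν:ℝ) + 1)) (by positivity)
  choose g F hF hJ hL hgX hgP hgc using H
  refine ⟨g, ?_, hgX, hgP, ?_, ?_⟩
  · intro ν
    exact (hL ν).differentiableOn (Eventually.of_forall (hF ν)) hDopen
  · intro ν j i hi
    have h1 := (lim_iter hDopen (hF ν) (hL ν) i).tendsto_at (hzs j)
    have h2 : ∀ n, iteratedDeriv i (F ν n) (zs j) = iteratedDeriv i f (zs j) := by
      intro n
      refine jets hDopen (hzs j) (k := k)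
        (r := fun z => ∏ j' ∈ Finset.univ.erase j, (z - zs j') ^ (k + 1)) (by fun_prop) ?_
        hadm.hol (hJ ν n) i hi
      intro z
      exact (Finset.mul_prod_erase Finset.univ (fun j' => (z - zs j') ^ (k + 1))
        (Finset.mem_univ j)).symm
    simp only [h2] at h1
    exact (tendsto_nhds_unique h1 tendsto_const_nhds)
  · intro K hKD hK
    obtain ⟨n0, hn0⟩ := hEx K hK hKD
    rw [Metric.tendstoUniformlyOn_iff]
    intro e he
    filter_upwards [eventually_ge_atTop n0,
      tendsto_one_div_add_atTop_nhds_zero_nat.eventually (gt_mem_nhds he)] with n hn hne z hz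
    rw [dist_comm, dist_eq_norm]
    exact (hgc n z (hn0 n hn hz)).trans_lt hne
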